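/- Let H : 𝕋^d × ℝ^d → ℝ be a C² Tonelli Hamiltonian with Lax–Oleinik semigroup (T_t)_{t≥0}. Let u₀ ∈ C⁰(𝕋^d, ℝ), u_t = T_t u₀, and u = lim_{t→+∞} u_t (which exists by the weak K.A.M. theorem). If u is C¹ and upper Green regular, then u is a weak K.A.M. solution and lim_{t→+∞} d_{2,1}(u_t, u) = 0. -/

import Mathlib

/-!
Throughout, the closed manifold `M = 𝕋^d = ℝ^d/ℤ^d` is modelled by `ℤ^d`-periodic
functions on `ℝ^d` (with the Euclidean structure), and its (co)tangent bundle
`T^*𝕋^d = 𝕋^d × ℝ^d` by `ℤ^d`-periodic (in the base variable) data on `ℝ^d × ℝ^d`.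
-/

open scoped RealInnerProductSpace
open Filter MeasureTheory Metric Set Asymptotics

noncomputable section

/-- The universal cover `ℝ^d` of the torus `𝕋^d`. -/
abbrev Euc (d : ℕ) : Type := EuclideanSpace ℝ (Fin d)

/-- The phase space `T^*𝕋^d`, modelled as `ℝ^d × ℝ^d` with `ℤ^d`-periodic data. -/
abbrev Phase (d : ℕ) : Type := Euc d × Euc d

/-- An integer vector, viewed in `ℝ^d`. -/
def intVec {d : ℕ} (k : Fin d → ℤ) : Euc d := WithLp.toLp 2 fun i => (k i : ℝ)

/-- `f` descends to the torus `𝕋^d = ℝ^d/ℤ^d`. -/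
def PerFun {d : ℕ} {α : Type*} (f : Euc d → α) : Prop :=
  ∀ (k : Fin d → ℤ) (x : Euc d), f (x + intVec k) = f x

/-- `H` descends to `T^*𝕋^d = 𝕋^d × ℝ^d`. -/
def PerPhase {d : ℕ} {α : Type*} (H : Phase d → α) : Prop :=
  ∀ (k : Fin d → ℤ) (q p : Euc d), H (q + intVec k, p) = H (q, p)

/-- Positive definiteness of the fiberwise Hessian. -/
def ConvexInFiber {d : ℕ} (H : Phase d → ℝ) : Prop :=
  ∀ q p v, v ≠ 0 → 0 < iteratedFDeriv ℝ 2 (fun p' => H (q, p')) p ![v, v]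

/-- A `C²` Tonelli Hamiltonian on `T^*𝕋^d`. -/
structure TonelliHam {d : ℕ} (H : Phase d → ℝ) : Prop where
  periodic : PerPhase H
  smooth : ContDiff ℝ 2 H
  convex : ConvexInFiber H
  superlinear : ∀ A : ℝ, ∃ B : ℝ, ∀ q p, A * ‖p‖ + B ≤ H (q, p)

/-- A `C²` Tonelli Lagrangian on `T𝕋^d`. -/
structure TonelliLag {d : ℕ} (L : Phase d → ℝ) : Prop where
  periodic : PerPhase L
  smooth : ContDiff ℝ 2 L
  convex : ConvexInFiber L
  superlinear : ∀ A : ℝ, ∃ B : ℝ, ∀ q v, A * ‖v‖ + B ≤ L (q, v)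

/-- The Lagrangian associated to `H` by Legendre duality. -/
def LegendreL {d : ℕ} (H : Phase d → ℝ) (x : Phase d) : ℝ :=
  sSup {r | ∃ p : Euc d, r = ⟪p, x.2⟫ - H (x.1, p)}

/-- The Mañé critical value `α(H)`. -/
def maneCritical {d : ℕ} (H : Phase d → ℝ) : ℝ :=
  sInf {c | ∃ u : Euc d → ℝ, ContDiff ℝ (⊤ : ℕ∞) u ∧ PerFun u ∧ ∀ q, H (q, gradient u q) ≤ c}

/-- The Mañé critical value `α(c)` of the cohomology class of the constant form `cf`. -/
def maneCriticalOf {d : ℕ} (H : Phase d → ℝ) (cf : Euc d) : ℝ :=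
  maneCritical fun x : Phase d => H (x.1, cf + x.2)

/-- `γ` is absolutely continuous on `[a,b]` with a.e. derivative `γ'`. -/
def ACOn {d : ℕ} (γ γ' : ℝ → Euc d) (a b : ℝ) : Prop :=
  IntervalIntegrable γ' volume a b ∧ ∀ t ∈ Icc a b, γ t = γ a + ∫ s in a..t, γ' s

/-- Values entering the (discounted, cohomologically twisted) Lax–Oleinik infimum. -/
def LOvals {d : ℕ} (L : Phase d → ℝ) (cf : Euc d) (av lam : ℝ) (u : Euc d → ℝ) (t : ℝ)
    (q : Euc d) : Set ℝ :=
  {r | ∃ γ γ' : ℝ → Euc d, ACOn γ γ' (-t) 0 ∧ γ 0 = q ∧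
     IntervalIntegrable (fun s => Real.exp (lam * s) * (L (γ s, γ' s) - ⟪cf, γ' s⟫ + av))
       volume (-t) 0 ∧
     r = Real.exp (-(lam * t)) * u (γ (-t)) +
         ∫ s in (-t)..0, Real.exp (lam * s) * (L (γ s, γ' s) - ⟪cf, γ' s⟫ + av)}

/-- The (discounted, twisted) Lax–Oleinik semigroup `T^{cf,λ}_t u (q)`. -/
def LaxOleinik {d : ℕ} (L : Phase d → ℝ) (cf : Euc d) (av lam : ℝ) (u : Euc d → ℝ) (t : ℝ)
    (q : Euc d) : ℝ :=
  sInf (LOvals L cf av lam u t q)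

/-- A weak K.A.M. solution: a fixed point of the Lax–Oleinik semigroup. -/
def IsWeakKAM {d : ℕ} (H : Phase d → ℝ) (u : Euc d → ℝ) : Prop :=
  Continuous u ∧ PerFun u ∧
    ∀ t > (0:ℝ), ∀ q, LaxOleinik (LegendreL H) 0 (maneCritical H) 0 u t q = u q

/-- A fixed point of the modified Lax–Oleinik semigroup `T^c_t` for the class `cf`. -/
def IsFixedPtModified {d : ℕ} (H : Phase d → ℝ) (cf : Euc d) (u : Euc d → ℝ) : Prop :=
  Continuous u ∧ PerFun u ∧
    ∀ t > (0:ℝ), ∀ q, LaxOleinik (LegendreL H) cf (maneCriticalOf H cf) 0 u t q = u q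

/-- The discounted solution `u_λ` of `λu + H(x,du) = α(H)`, via its variational formula. -/
def IsDiscountedSol {d : ℕ} (H : Phase d → ℝ) (lam : ℝ) (u : Euc d → ℝ) : Prop :=
  Continuous u ∧ PerFun u ∧
    ∀ q, u q = sInf {r | ∃ γ γ' : ℝ → Euc d, (∀ a ≤ (0:ℝ), ACOn γ γ' a 0) ∧ γ 0 = q ∧
      IntegrableOn (fun s => Real.exp (lam * s) * (LegendreL H (γ s, γ' s) + maneCritical H))
        (Iic 0) volume ∧
      r = ∫ s in Iic (0:ℝ), Real.exp (lam * s) * (LegendreL H (γ s, γ' s) + maneCritical H)}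

/-- The `λ`-discounted Hamiltonian vector field `(∂H/∂p, -∂H/∂q - λp)`. -/
def hamVF {d : ℕ} (H : Phase d → ℝ) (lam : ℝ) (x : Phase d) : Phase d :=
  (gradient (fun p => H (x.1, p)) x.2, -gradient (fun q => H (q, x.2)) x.1 - lam • x.2)

/-- `φ` is the (conformally) Hamiltonian flow of equation (1) for `(H, λ)`. -/
def IsConformalFlow {d : ℕ} (H : Phase d → ℝ) (lam : ℝ) (φ : ℝ → Phase d → Phase d) : Prop :=
  (∀ x, φ 0 x = x) ∧ (∀ s t x, φ s (φ t x) = φ (s + t) x) ∧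
    ∀ x t, HasDerivAt (fun τ => φ τ x) (hamVF H lam (φ t x)) t

/-- The vertical subspace `V = ker Dπ`. -/
def Vert (d : ℕ) : Submodule ℝ (Phase d) :=
  Submodule.prod (⊥ : Submodule ℝ (Euc d)) (⊤ : Submodule ℝ (Euc d))

/-- The image `Dφ_t(y) V(y)` of the vertical at `y` by the linearized flow. -/
def pushV {d : ℕ} (φ : ℝ → Phase d → Phase d) (t : ℝ) (y : Phase d) : Submodule ℝ (Phase d) :=
  Submodule.map (fderiv ℝ (φ t) y).toLinearMap (Vert d)

/-- `G_t(x) = Dφ_t V(φ_{-t} x)`. -/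
def GreenT {d : ℕ} (φ : ℝ → Phase d → Phase d) (t : ℝ) (x : Phase d) : Submodule ℝ (Phase d) :=
  pushV φ t (φ (-t) x)

/-- The piece of orbit `(φ_t x)_{t ∈ I}` has no conjugate points. -/
def NoConjPts {d : ℕ} (φ : ℝ → Phase d → Phase d) (x : Phase d) (I : Set ℝ) : Prop :=
  ∀ s ∈ I, ∀ t ∈ I, s ≠ t → pushV φ (t - s) (φ s x) ⊓ Vert d = ⊥

/-- `S` is the height `ℋ(G)` of the Lagrangian subspace `G`:
`G` is the graph `{(δθ, S δθ)}` of the symmetric map `S`. -/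
def IsHeight {d : ℕ} (G : Submodule ℝ (Phase d)) (S : Euc d →L[ℝ] Euc d) : Prop :=
  (∀ v w, ⟪S v, w⟫ = ⟪v, S w⟫) ∧ G = LinearMap.graph (S : Euc d →ₗ[ℝ] Euc d)

open Classical in
/-- The height of a subspace transverse to the vertical (junk value `0` otherwise). -/
def heightOf {d : ℕ} (G : Submodule ℝ (Phase d)) : Euc d →L[ℝ] Euc d :=
  if h : ∃ S, IsHeight G S then h.choose else 0

/-- Order of symmetric operators as quadratic forms. -/
def SymLE {d : ℕ} (S T : Euc d →L[ℝ] Euc d) : Prop := ∀ v, ⟪S v, v⟫ ≤ ⟪T v, v⟫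

/-- Strict order of symmetric operators as quadratic forms (positive definite difference). -/
def SymLT {d : ℕ} (S T : Euc d →L[ℝ] Euc d) : Prop := ∀ v, v ≠ 0 → ⟪S v, v⟫ < ⟪T v, v⟫

/-- `u` has (Alexandrov) derivative `p` and second derivative `S` at `θ`. -/
def HasAlexandrovAt {d : ℕ} (u : Euc d → ℝ) (p : Euc d) (S : Euc d →L[ℝ] Euc d)
    (θ : Euc d) : Prop :=
  HasGradientAt u p θ ∧
    (fun y => u y - u θ - ⟪p, y - θ⟫ - (1/2) * ⟪S (y - θ), y - θ⟫)
      =o[nhds θ] fun y => ‖y - θ‖ ^ 2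

open Classical in
/-- The Alexandrov second derivative `D²u(θ)` (junk value `0` where it does not exist). -/
def D2 {d : ℕ} (u : Euc d → ℝ) (θ : Euc d) : Euc d →L[ℝ] Euc d :=
  if h : ∃ pS : Euc d × (Euc d →L[ℝ] Euc d), HasAlexandrovAt u pS.1 pS.2 θ then h.choose.2 else 0

/-- `‖S‖ = sup_{‖v‖=1} |S(v,v)|`. -/
def qNorm {d : ℕ} (S : Euc d →L[ℝ] Euc d) : ℝ :=
  ⨆ v : (sphere (0 : Euc d) 1 : Set (Euc d)), |⟪S v.1, v.1⟫|

/-- A fundamental domain of `𝕋^d` in `ℝ^d`. -/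
def fundCube (d : ℕ) : Set (Euc d) := {x | ∀ i, x i ∈ Ico (0:ℝ) 1}

/-- The distance `d_{2,1}(u,v) = ∫_{𝕋^d} ‖D²u - D²v‖`. -/
def d21 {d : ℕ} (u v : Euc d → ℝ) : ℝ := ∫ θ in fundCube d, qNorm (D2 u θ - D2 v θ)

/-- Semi-concavity. -/
def SemiConcave {d : ℕ} (u : Euc d → ℝ) : Prop :=
  ∃ K : ℝ, ∀ x, ∃ p, ∀ y, u y ≤ u x + ⟪p, y - x⟫ + K * ‖y - x‖ ^ 2

/-- `u` is upper Green regular: at Lebesgue-a.e. `θ`, `ℋ(G₊(θ, du(θ))) = D²u(θ)`. -/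
def UpperGreenRegular {d : ℕ} (φ : ℝ → Phase d → Phase d) (u : Euc d → ℝ) : Prop :=
  ∀ᵐ θ ∂(volume : Measure (Euc d)), ∃ p S, HasGradientAt u p θ ∧
    (∀ t > (0:ℝ), ∃ S', IsHeight (GreenT φ t (θ, p)) S') ∧
    Tendsto (fun t : ℝ => heightOf (GreenT φ t (θ, p))) atTop (nhds S) ∧
    HasAlexandrovAt u p S θ

/-- The graph `𝒢(du) ⊂ T^*𝕋^d` of the differential of `u`. -/
def gradGraph {d : ℕ} (u : Euc d → ℝ) : Set (Phase d) := {x | HasGradientAt u x.2 x.1}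

/-- The graph `𝒢(η_c + du)` where `η_c` is the constant form `cf`. -/
def gradGraphShift {d : ℕ} (cf : Euc d) (u : Euc d → ℝ) : Set (Phase d) :=
  {x | ∃ p, HasGradientAt u p x.1 ∧ x.2 = cf + p}


def Hp {d : ℕ} (H : Phase d → ℝ) (z : Phase d) : Euc d :=
  (InnerProductSpace.toDual ℝ (Euc d)).symm
    ((fderiv ℝ H z).comp (ContinuousLinearMap.inr ℝ (Euc d) (Euc d)))

def Hq {d : ℕ} (H : Phase d → ℝ) (z : Phase d) : Euc d :=
  (InnerProductSpace.toDual ℝ (Euc d)).symm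
    ((fderiv ℝ H z).comp (ContinuousLinearMap.inl ℝ (Euc d) (Euc d)))

lemma inner_Hp {d : ℕ} (H : Phase d → ℝ) (z : Phase d) (b : Euc d) :
    ⟪Hp H z, b⟫ = fderiv ℝ H z (0, b) := by
  simp [Hp]

lemma inner_Hq {d : ℕ} (H : Phase d → ℝ) (z : Phase d) (a : Euc d) :
    ⟪Hq H z, a⟫ = fderiv ℝ H z (a, 0) := by
  simp [Hq]

lemma fderiv_split {d : ℕ} (H : Phase d → ℝ) (z w : Phase d) :
    fderiv ℝ H z w = ⟪Hq H z, w.1⟫ + ⟪Hp H z, w.2⟫ := by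
  rw [inner_Hp, inner_Hq, ← map_add]; simp

lemma contDiff_Hp {d : ℕ} {H : Phase d → ℝ} (hs : ContDiff ℝ 2 H) : ContDiff ℝ 1 (Hp H) := by
  have h1 : ContDiff ℝ 1 (fderiv ℝ H) := hs.fderiv_right (by norm_num)
  exact (LinearIsometryEquiv.contDiff _).comp (h1.clm_comp contDiff_const)

lemma contDiff_Hq {d : ℕ} {H : Phase d → ℝ} (hs : ContDiff ℝ 2 H) : ContDiff ℝ 1 (Hq H) := by
  have h1 : ContDiff ℝ 1 (fderiv ℝ H) := hs.fderiv_right (by norm_num)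
  exact (LinearIsometryEquiv.contDiff _).comp (h1.clm_comp contDiff_const)

lemma hasFDerivAt_slice_p {d : ℕ} {H : Phase d → ℝ} (hs : ContDiff ℝ 2 H) (x p : Euc d) :
    HasFDerivAt (fun p' => H (x, p'))
      ((fderiv ℝ H (x, p)).comp (ContinuousLinearMap.inr ℝ (Euc d) (Euc d))) p := by
  have h := (hs.differentiable (by norm_num) (x, p)).hasFDerivAt
  exact h.comp p (hasFDerivAt_prodMk_right x p)

lemma hasFDerivAt_slice_q {d : ℕ} {H : Phase d → ℝ} (hs : ContDiff ℝ 2 H) (x p : Euc d) :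
    HasFDerivAt (fun x' => H (x', p))
      ((fderiv ℝ H (x, p)).comp (ContinuousLinearMap.inl ℝ (Euc d) (Euc d))) x := by
  have h := (hs.differentiable (by norm_num) (x, p)).hasFDerivAt
  exact h.comp x (hasFDerivAt_prodMk_left x p)

lemma hamVF_eq {d : ℕ} {H : Phase d → ℝ} (hs : ContDiff ℝ 2 H) (z : Phase d) :
    hamVF H 0 z = (Hp H z, - Hq H z) := by
  obtain ⟨x, p⟩ := z
  simp [hamVF, gradient, Hp, Hq, (hasFDerivAt_slice_p hs x p).fderiv,
    (hasFDerivAt_slice_q hs x p).fderiv]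

lemma Hp_pos {d : ℕ} {H : Phase d → ℝ} (hH : TonelliHam H) (z : Phase d) (b : Euc d)
    (hb : b ≠ 0) : 0 < ⟪fderiv ℝ (Hp H) z (0, b), b⟫ := by
  obtain ⟨x, p⟩ := z
  have h := hH.convex x p b hb
  rw [iteratedFDeriv_two_apply] at h
  have e : fderiv ℝ (fun p' => H (x, p')) =
      fun p' => InnerProductSpace.toDual ℝ (Euc d) (Hp H (x, p')) := by
    funext p'
    rw [(hasFDerivAt_slice_p hH.smooth x p').fderiv]; simp [Hp]
  rw [e] at h
  have h1 : HasFDerivAt (fun p' => Hp H (x, p'))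
      ((fderiv ℝ (Hp H) (x, p)).comp (ContinuousLinearMap.inr ℝ (Euc d) (Euc d))) p :=
    (((contDiff_Hp hH.smooth).differentiable (by norm_num) (x, p)).hasFDerivAt).comp p
      (hasFDerivAt_prodMk_right x p)
  have h2 := ((InnerProductSpace.toDual ℝ (Euc d)).toContinuousLinearEquiv.hasFDerivAt
      (x := Hp H (x, p))).comp p h1
  have h3 : fderiv ℝ (fun p' => InnerProductSpace.toDual ℝ (Euc d) (Hp H (x, p'))) p = _ :=
    h2.fderiv
  rw [h3] at h
  simpa using h

lemma Hp_inj {d : ℕ} {H : Phase d → ℝ} (hH : TonelliHam H) (x p p' : Euc d)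
    (h : Hp H (x, p) = Hp H (x, p')) : p = p' := by
  by_contra hne
  have hb : p' - p ≠ 0 := sub_ne_zero.2 (Ne.symm hne)
  have hd : ∀ s : ℝ, HasDerivAt (fun s : ℝ => ⟪Hp H (x, p + s • (p' - p)), p' - p⟫)
      ⟪fderiv ℝ (Hp H) (x, p + s • (p' - p)) (0, p' - p), p' - p⟫ s := by
    intro s
    have h1 : HasDerivAt (fun s : ℝ => ((x, p + s • (p' - p)) : Phase d)) (0, p' - p) s := by
      have h2 : HasDerivAt (fun s : ℝ => p + s • (p' - p)) (p' - p) s := by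
        simpa using ((hasDerivAt_id s).smul_const (p' - p)).const_add p
      exact (hasDerivAt_const s x).prodMk h2
    have h3 := (((contDiff_Hp hH.smooth).differentiable (by norm_num)
      (x, p + s • (p' - p))).hasFDerivAt).comp_hasDerivAt s h1
    simpa using h3.inner ℝ (hasDerivAt_const s (p' - p))
  have hm : StrictMono (fun s : ℝ => ⟪Hp H (x, p + s • (p' - p)), p' - p⟫) :=
    strictMono_of_deriv_pos (fun s => by rw [(hd s).deriv]; exact Hp_pos hH _ _ hb)
  have := hm (zero_lt_one)
  simp [h] at this

lemma leg_exists {d : ℕ} {H : Phase d → ℝ} (hH : TonelliHam H) (x v : Euc d) :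
    ∃ p, Hp H (x, p) = v ∧ ∀ p', ⟪p', v⟫ - H (x, p') ≤ ⟪p, v⟫ - H (x, p) := by
  have hc : Continuous (fun p' => H (x, p') - ⟪p', v⟫) := by
    have := hH.smooth.continuous
    fun_prop
  have ht : Tendsto (fun p' => H (x, p') - ⟪p', v⟫) (cocompact (Euc d)) atTop := by
    obtain ⟨B, hB⟩ := hH.superlinear (‖v‖ + 1)
    have h1 : Tendsto (fun p' : Euc d => ‖p'‖ + B) (cocompact (Euc d)) atTop :=
      tendsto_atTop_add_const_right _ _ (tendsto_norm_cocompact_atTop)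
    refine tendsto_atTop_mono (fun p' => ?_) h1
    have h2 := hB x p'
    have h3 := real_inner_le_norm p' v
    nlinarith
  obtain ⟨p, hp⟩ := hc.exists_forall_le ht
  refine ⟨p, ?_, fun p' => by have := hp p'; linarith⟩
  have hmin : IsLocalMin (fun p' => H (x, p') - ⟪p', v⟫) p := Filter.Eventually.of_forall hp
  have hd : HasFDerivAt (fun p' => H (x, p') - ⟪p', v⟫)
      ((fderiv ℝ H (x, p)).comp (ContinuousLinearMap.inr ℝ (Euc d) (Euc d)) - innerSL ℝ v) p := by
    refine (hasFDerivAt_slice_p hH.smooth x p).sub ?_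
    have := (innerSL ℝ v).hasFDerivAt (x := p)
    refine this.congr_of_eventuallyEq (Filter.Eventually.of_forall fun y => ?_)
    simp [real_inner_comm]
  have h0 := hmin.hasFDerivAt_eq_zero hd
  refine ext_inner_right ℝ fun b => ?_
  have := congrArg (fun f => f b) h0
  simp at this
  rw [inner_Hp]; linarith

/-- inverse Legendre map -/
def Pm {d : ℕ} {H : Phase d → ℝ} (hH : TonelliHam H) (y : Phase d) : Euc d :=
  (leg_exists hH y.1 y.2).choose

lemma Hp_Pm {d : ℕ} {H : Phase d → ℝ} (hH : TonelliHam H) (y : Phase d) :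
    Hp H (y.1, Pm hH y) = y.2 := (leg_exists hH y.1 y.2).choose_spec.1

lemma Pm_Hp {d : ℕ} {H : Phase d → ℝ} (hH : TonelliHam H) (x p : Euc d) :
    Pm hH (x, Hp H (x, p)) = p := Hp_inj hH x _ _ (Hp_Pm hH (x, Hp H (x, p)))

lemma leg_isLUB {d : ℕ} {H : Phase d → ℝ} (hH : TonelliHam H) (y : Phase d) :
    LegendreL H y = ⟪Pm hH y, y.2⟫ - H (y.1, Pm hH y) := by
  have h := (leg_exists hH y.1 y.2).choose_spec.2
  refine IsGreatest.csSup_eq ⟨⟨_, rfl⟩, ?_⟩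
  rintro r ⟨p, rfl⟩
  exact h p

lemma fenchel {d : ℕ} {H : Phase d → ℝ} (hH : TonelliHam H) (x v p : Euc d) :
    ⟪p, v⟫ - H (x, p) ≤ LegendreL H (x, v) := by
  rw [leg_isLUB hH]
  exact (leg_exists hH x v).choose_spec.2 p

lemma leg_Hp {d : ℕ} {H : Phase d → ℝ} (hH : TonelliHam H) (x p : Euc d) :
    LegendreL H (x, Hp H (x, p)) = ⟪p, Hp H (x, p)⟫ - H (x, p) := by
  rw [leg_isLUB hH, Pm_Hp]

/-- derivative of Λ -/
def dLam {d : ℕ} (H : Phase d → ℝ) (z : Phase d) : Phase d →L[ℝ] Phase d :=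
  (ContinuousLinearMap.fst ℝ (Euc d) (Euc d)).prod (fderiv ℝ (Hp H) z)

lemma hasFDerivAt_Lam {d : ℕ} {H : Phase d → ℝ} (hs : ContDiff ℝ 2 H) (z : Phase d) :
    HasFDerivAt (fun z : Phase d => ((z.1, Hp H z) : Phase d)) (dLam H z) z :=
  hasFDerivAt_fst.prodMk ((contDiff_Hp hs).differentiable (by norm_num) z).hasFDerivAt

lemma dLam_inj {d : ℕ} {H : Phase d → ℝ} (hH : TonelliHam H) (z : Phase d) :
    Function.Injective (dLam H z) := by
  rw [injective_iff_map_eq_zero]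
  rintro ⟨a, b⟩ h
  simp [dLam] at h
  obtain ⟨rfl, h⟩ := h
  by_contra hne
  have hb : b ≠ 0 := by rintro rfl; exact hne rfl
  have := Hp_pos hH z b hb
  rw [h] at this
  simp at this

lemma contDiff_Pm {d : ℕ} {H : Phase d → ℝ} (hH : TonelliHam H) : ContDiff ℝ 1 (Pm hH) := by
  rw [contDiff_iff_contDiffAt]
  intro y
  set z : Phase d := (y.1, Pm hH y) with hz
  set F : Phase d → Phase d := fun z => (z.1, Hp H z) with hF
  have hFz : F z = y := by simp [hF, hz, Hp_Pm hH y]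
  let e : Phase d ≃L[ℝ] Phase d :=
    (LinearEquiv.ofInjectiveEndo (dLam H z).toLinearMap (dLam_inj hH z)).toContinuousLinearEquiv
  have he : (e : Phase d →L[ℝ] Phase d) = dLam H z := by ext w <;> rfl
  have hFc : ContDiffAt ℝ 1 F z := (contDiff_fst.prodMk (contDiff_Hp hH.smooth)).contDiffAt
  have hFd : HasFDerivAt F (e : Phase d →L[ℝ] Phase d) z := by
    rw [he]; exact hasFDerivAt_Lam hH.smooth z
  have h1 := hFc.to_localInverse hFd one_ne_zero
  have h2 := (hFc.hasStrictFDerivAt' hFd one_ne_zero).eventually_right_inverse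
  rw [hFz] at h1 h2
  have h3 : ContDiffAt ℝ 1 (fun y' => (hFc.localInverse hFd one_ne_zero y').2) y :=
    contDiffAt_snd.comp y h1
  refine h3.congr_of_eventuallyEq ?_
  filter_upwards [h2] with y' hy'
  change F (hFc.localInverse hFd one_ne_zero y') = y' at hy'
  have h4 := Pm_Hp hH (hFc.localInverse hFd one_ne_zero y').1
    (hFc.localInverse hFd one_ne_zero y').2
  change Pm hH (F (hFc.localInverse hFd one_ne_zero y')) = _ at h4
  rw [hy'] at h4
  exact h4

/-- gradient of L -/
def gradL {d : ℕ} {H : Phase d → ℝ} (hH : TonelliHam H) (y : Phase d) : Phase d :=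
  (- Hq H (y.1, Pm hH y), Pm hH y)

lemma contDiff_gradL {d : ℕ} {H : Phase d → ℝ} (hH : TonelliHam H) : ContDiff ℝ 1 (gradL hH) :=
  (((contDiff_Hq hH.smooth).comp (contDiff_fst.prodMk (contDiff_Pm hH))).neg).prodMk
    (contDiff_Pm hH)

/-- the pairing -/
def pair {d : ℕ} (a b : Phase d) : ℝ := ⟪a.1, b.1⟫ + ⟪a.2, b.2⟫

lemma hasDerivAt_L {d : ℕ} {H : Phase d → ℝ} (hH : TonelliHam H) (y w : Phase d) (s : ℝ) :
    HasDerivAt (fun s : ℝ => LegendreL H (y + s • w)) (pair (gradL hH (y + s • w)) w) s := by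
  have hL : (fun s : ℝ => LegendreL H (y + s • w)) = fun s : ℝ =>
      ⟪Pm hH (y + s • w), (y + s • w).2⟫ - H ((y + s • w).1, Pm hH (y + s • w)) := by
    funext s; rw [leg_isLUB hH]
  rw [hL]
  have h1 : HasDerivAt (fun s : ℝ => y + s • w) w s := by
    simpa using ((hasDerivAt_id s).smul_const w).const_add y
  have h11 : HasDerivAt (fun s : ℝ => (y + s • w).1) w.1 s := by
    simpa using ((hasDerivAt_id s).smul_const w.1).const_add y.1
  have h12 : HasDerivAt (fun s : ℝ => (y + s • w).2) w.2 s := by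
    simpa using ((hasDerivAt_id s).smul_const w.2).const_add y.2
  have hP := (((contDiff_Pm hH).differentiable (by norm_num) (y + s • w)).hasFDerivAt).comp_hasDerivAt
    s h1
  have hHd := ((hH.smooth.differentiable (by norm_num)
    ((y + s • w).1, Pm hH (y + s • w))).hasFDerivAt).comp_hasDerivAt s (h11.prodMk hP)
  have := (hP.inner ℝ h12).sub hHd
  refine this.congr_deriv ?_
  rw [fderiv_split, Hp_Pm]
  simp only [pair, gradL, inner_neg_left]
  simp only [Function.comp]
  rw [real_inner_comm (fderiv ℝ (Pm hH) (y + s • w) w) (y + s • w).2]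
  ring

lemma continuous_L {d : ℕ} {H : Phase d → ℝ} (hH : TonelliHam H) : Continuous (LegendreL H) := by
  have : LegendreL H = fun y => ⟪Pm hH y, y.2⟫ - H (y.1, Pm hH y) := funext (leg_isLUB hH)
  rw [this]
  have h1 := (contDiff_Pm hH).continuous
  have h2 := hH.smooth.continuous
  fun_prop


lemma exists_int_shift {d : ℕ} : ∃ C : ℝ, 0 ≤ C ∧ ∀ x : Euc d, ∃ k : Fin d → ℤ,
    ‖x + intVec k‖ ≤ C := by
  refine ⟨Real.sqrt d, Real.sqrt_nonneg _, fun x => ⟨fun i => -⌊x i⌋, ?_⟩⟩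
  rw [EuclideanSpace.norm_eq]
  apply Real.sqrt_le_sqrt
  calc ∑ i, ‖(x + intVec fun i => -⌊x i⌋) i‖ ^ 2 ≤ ∑ i : Fin d, (1:ℝ) := by
        refine Finset.sum_le_sum fun i _ => ?_
        have h1 : (x + intVec fun i => -⌊x i⌋) i = Int.fract (x i) := by
          simp [intVec, Int.fract, sub_eq_add_neg]
        rw [h1, Real.norm_eq_abs, sq_abs]
        have := Int.fract_nonneg (x i)
        have := Int.fract_lt_one (x i)
        nlinarith
    _ = d := by simp

lemma per_bdd {d : ℕ} {Y : Type*} [NormedAddCommGroup Y] {F : Phase d → Y} (hF : Continuous F)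
    (hp : PerPhase F) (R : ℝ) : ∃ C : ℝ, 0 ≤ C ∧ ∀ x v, ‖v‖ ≤ R → ‖F (x, v)‖ ≤ C := by
  obtain ⟨D, hD0, hD⟩ := exists_int_shift (d := d)
  have hK : IsCompact ((closedBall (0 : Euc d) D) ×ˢ (closedBall (0 : Euc d) R)) :=
    (isCompact_closedBall _ _).prod (isCompact_closedBall _ _)
  obtain ⟨C, hC⟩ := hK.exists_bound_of_continuousOn hF.continuousOn
  refine ⟨max C 0, le_max_right _ _, fun x v hv => ?_⟩
  obtain ⟨k, hk⟩ := hD x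
  rw [← hp k x v]
  exact (hC _ ⟨by simpa using hk, by simpa using hv⟩).trans (le_max_left _ _)

lemma per_uc {d : ℕ} {Y : Type*} [NormedAddCommGroup Y] {F : Phase d → Y} (hF : Continuous F)
    (hp : PerPhase F) (R ε : ℝ) (hε : 0 < ε) : ∃ C : ℝ, 0 ≤ C ∧ ∀ z z' : Phase d, ‖z.2‖ ≤ R →
      ‖z'.2‖ ≤ R → ‖F z - F z'‖ ≤ ε + C * ‖z - z'‖ ^ 2 := by
  obtain ⟨D, hD0, hD⟩ := exists_int_shift (d := d)
  have hK : IsCompact ((closedBall (0 : Euc d) (D + 1)) ×ˢ (closedBall (0 : Euc d) R)) :=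
    (isCompact_closedBall _ _).prod (isCompact_closedBall _ _)
  have hu := hK.uniformContinuousOn_of_continuous hF.continuousOn
  rw [Metric.uniformContinuousOn_iff] at hu
  obtain ⟨δ, hδ, hu⟩ := hu ε hε
  obtain ⟨M, hM0, hM⟩ := per_bdd hF hp R
  set δ' := min δ 1
  have hδ' : 0 < δ' := lt_min hδ one_pos
  refine ⟨2 * M / δ' ^ 2, by positivity, fun z z' hz hz' => ?_⟩
  obtain ⟨x, v⟩ := z
  obtain ⟨x', v'⟩ := z'
  by_cases h : ‖((x, v) : Phase d) - (x', v')‖ < δ'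
  · obtain ⟨k, hk⟩ := hD x
    rw [← hp k x v, ← hp k x' v', ← dist_eq_norm]
    have h1 : ‖x - x'‖ ≤ ‖((x, v) : Phase d) - (x', v')‖ := norm_fst_le (((x, v) : Phase d) - (x', v'))
    have h2 : dist (F (x + intVec k, v)) (F (x' + intVec k, v')) < ε := by
      apply hu
      · exact ⟨by simp; linarith, by simpa using hz⟩
      · refine ⟨?_, by simpa using hz'⟩
        simp only [mem_closedBall, dist_zero_right]
        have : x' + intVec k = (x + intVec k) - (x - x') := by abel
        rw [this]
        have h3 := norm_sub_le (x + intVec k) (x - x')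
        have : δ' ≤ 1 := min_le_right _ _
        linarith
      · rw [dist_eq_norm]
        have e : ((x + intVec k, v) : Phase d) - (x' + intVec k, v') = (x, v) - (x', v') := by
          simp
        rw [e]; exact h.trans_le (min_le_left _ _)
    have : 0 ≤ 2 * M / δ' ^ 2 * ‖((x, v) : Phase d) - (x', v')‖ ^ 2 := by positivity
    linarith
  · push Not at h
    have h1 : ‖F (x, v) - F (x', v')‖ ≤ 2 * M := by
      have := norm_sub_le (F (x, v)) (F (x', v'))
      have := hM x v hz
      have := hM x' v' hz'
      linarith
    have h2 : 2 * M ≤ 2 * M / δ' ^ 2 * ‖((x, v) : Phase d) - (x', v')‖ ^ 2 := by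
      rw [div_mul_eq_mul_div, le_div_iff₀ (by positivity)]
      have : δ' ^ 2 ≤ ‖((x, v) : Phase d) - (x', v')‖ ^ 2 := by gcongr
      gcongr
    linarith

lemma per_fderiv {d : ℕ} {Y : Type*} [NormedAddCommGroup Y] [NormedSpace ℝ Y] {F : Phase d → Y}
    (hp : PerPhase F) : PerPhase (fderiv ℝ F) := by
  intro k q p
  have e : (fun z : Phase d => F (z + (intVec k, 0))) = F := by
    funext z; obtain ⟨a, b⟩ := z
    simpa using hp k a b
  have := fderiv_comp_add_right (𝕜 := ℝ) (f := F) (x := (q, p)) ((intVec k, 0) : Phase d)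
  rw [e] at this
  simpa using this.symm

lemma convex_strip {d : ℕ} (R : ℝ) : Convex ℝ {z : Phase d | ‖z.2‖ ≤ R} := by
  have : {z : Phase d | ‖z.2‖ ≤ R} = (LinearMap.snd ℝ (Euc d) (Euc d)) ⁻¹' closedBall 0 R := by
    ext z; simp
  rw [this]
  exact (convex_closedBall 0 R).linear_preimage _

lemma per_lip {d : ℕ} {Y : Type*} [NormedAddCommGroup Y] [NormedSpace ℝ Y] {F : Phase d → Y}
    (hF : ContDiff ℝ 1 F) (hp : PerPhase F) (R : ℝ) : ∃ C : ℝ, 0 ≤ C ∧ ∀ z z' : Phase d,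
      ‖z.2‖ ≤ R → ‖z'.2‖ ≤ R → ‖F z - F z'‖ ≤ C * ‖z - z'‖ := by
  obtain ⟨C, hC0, hC⟩ := per_bdd (hF.continuous_fderiv (by norm_num)) (per_fderiv hp) R
  refine ⟨C, hC0, fun z z' hz hz' => ?_⟩
  exact (convex_strip R).norm_image_sub_le_of_norm_fderiv_le
    (fun x _ => hF.differentiable (by norm_num) x) (fun x hx => hC x.1 x.2 hx) hz' hz

lemma per_Hp {d : ℕ} {H : Phase d → ℝ} (hH : TonelliHam H) : PerPhase (Hp H) := by
  intro k q p; simp only [Hp, per_fderiv hH.periodic k q p]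

lemma per_Hq {d : ℕ} {H : Phase d → ℝ} (hH : TonelliHam H) : PerPhase (Hq H) := by
  intro k q p; simp only [Hq, per_fderiv hH.periodic k q p]

lemma per_Pm {d : ℕ} {H : Phase d → ℝ} (hH : TonelliHam H) : PerPhase (Pm hH) := by
  intro k q v
  apply Hp_inj hH q
  have h1 := Hp_Pm hH (q + intVec k, v)
  have h2 := Hp_Pm hH (q, v)
  simp only at h1 h2
  rw [per_Hp hH] at h1
  rw [h1, h2]

lemma per_L {d : ℕ} {H : Phase d → ℝ} (hH : TonelliHam H) : PerPhase (LegendreL H) := by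
  intro k q v
  simp only [LegendreL, hH.periodic k q]

lemma per_gradL {d : ℕ} {H : Phase d → ℝ} (hH : TonelliHam H) : PerPhase (gradL hH) := by
  intro k q v
  simp only [gradL, per_Pm hH k q v, per_Hq hH k q]

lemma pair_le {d : ℕ} (a b : Phase d) : |pair a b| ≤ 2 * ‖a‖ * ‖b‖ := by
  have h1 := abs_real_inner_le_norm a.1 b.1
  have h2 := abs_real_inner_le_norm a.2 b.2
  have h3 : ‖a.1‖ * ‖b.1‖ ≤ ‖a‖ * ‖b‖ :=
    mul_le_mul (norm_fst_le a) (norm_fst_le b) (norm_nonneg _) (norm_nonneg _)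
  have h4 : ‖a.2‖ * ‖b.2‖ ≤ ‖a‖ * ‖b‖ :=
    mul_le_mul (norm_snd_le a) (norm_snd_le b) (norm_nonneg _) (norm_nonneg _)
  have := abs_add_le ⟪a.1, b.1⟫ ⟪a.2, b.2⟫
  simp only [pair]; linarith

lemma pair_sub_left {d : ℕ} (a b c : Phase d) : pair (a - b) c = pair a c - pair b c := by
  simp [pair, inner_sub_left]; ring

lemma strip_seg {d : ℕ} {R : ℝ} {y w : Phase d} (h0 : ‖y.2‖ ≤ R) (h1 : ‖(y + w).2‖ ≤ R)
    {s : ℝ} (hs : s ∈ Icc (0:ℝ) 1) : ‖(y + s • w).2‖ ≤ R := by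
  have := (convex_strip (d := d) R).add_smul_mem (x := y) (y := w) h0 h1 hs
  exact this

lemma taylor1 {d : ℕ} {H : Phase d → ℝ} (hH : TonelliHam H) (R : ℝ) : ∃ K : ℝ, 0 ≤ K ∧
    ∀ y w : Phase d, ‖y.2‖ ≤ R → ‖(y + w).2‖ ≤ R →
      |LegendreL H (y + w) - LegendreL H y - pair (gradL hH y) w| ≤ K * ‖w‖ ^ 2 := by
  obtain ⟨C, hC0, hC⟩ := per_lip (contDiff_gradL hH) (per_gradL hH) R
  refine ⟨2 * C, by positivity, fun y w h0 h1 => ?_⟩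
  obtain ⟨c, hc, he⟩ := exists_hasDerivAt_eq_slope (fun s : ℝ => LegendreL H (y + s • w))
    (fun s => pair (gradL hH (y + s • w)) w) one_pos
    (fun s _ => (hasDerivAt_L hH y w s).continuousAt.continuousWithinAt)
    (fun s _ => hasDerivAt_L hH y w s)
  simp at he
  rw [← he, ← pair_sub_left]
  have hcs : ‖(y + c • w).2‖ ≤ R := strip_seg h0 h1 ⟨hc.1.le, hc.2.le⟩
  refine (pair_le _ _).trans ?_
  have h2 := hC _ _ hcs h0
  have h3 : ‖y + c • w - y‖ ≤ ‖w‖ := by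
    rw [add_sub_cancel_left, norm_smul, Real.norm_eq_abs, abs_of_pos hc.1]
    have := norm_nonneg w
    nlinarith [hc.2]
  have h4 : ‖gradL hH (y + c • w) - gradL hH y‖ ≤ C * ‖w‖ := h2.trans (by gcongr)
  calc 2 * ‖gradL hH (y + c • w) - gradL hH y‖ * ‖w‖ ≤ 2 * (C * ‖w‖) * ‖w‖ := by gcongr
    _ = _ := by ring

lemma taylor2 {d : ℕ} {H : Phase d → ℝ} (hH : TonelliHam H) (R ε : ℝ) (hε : 0 < ε) :
    ∃ C : ℝ, 0 ≤ C ∧ ∀ z w y : Phase d, ‖(z + w).2‖ ≤ R → ‖(z - w).2‖ ≤ R → ‖y.2‖ ≤ R →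
      LegendreL H (z + w) + LegendreL H (z - w) - 2 * LegendreL H z ≤
        pair (fderiv ℝ (gradL hH) y w) w + (ε + C * (‖z - y‖ + ‖w‖) ^ 2) * ‖w‖ ^ 2 := by
  obtain ⟨C, hC0, hC⟩ := per_uc ((contDiff_gradL hH).continuous_fderiv (by norm_num))
    (per_fderiv (per_gradL hH)) R (ε / 2) (by positivity)
  refine ⟨2 * C, by positivity, fun z w y h1 h2 h3 => ?_⟩
  have hm : ∀ s : ℝ, HasDerivAt (fun s : ℝ => LegendreL H (z + s • (-w)))
      (pair (gradL hH (z + s • (-w))) (-w)) s := fun s => hasDerivAt_L hH z (-w) s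
  have hg : ∀ s : ℝ, HasDerivAt
      (fun s : ℝ => LegendreL H (z + s • w) + LegendreL H (z + s • (-w)))
      (pair (gradL hH (z + s • w)) w + pair (gradL hH (z + s • (-w))) (-w)) s :=
    fun s => (hasDerivAt_L hH z w s).add (hm s)
  have hsq : ∀ s : ℝ, HasDerivAt (fun s : ℝ => s ^ 2) (2 * s) s := fun s => by
    simpa using hasDerivAt_pow 2 s
  obtain ⟨c, hc, he⟩ := exists_ratio_hasDerivAt_eq_ratio_slope _ _ (one_pos (α := ℝ))
    (fun s _ => (hg s).continuousAt.continuousWithinAt) (fun s _ => hg s)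
    (fun s : ℝ => s ^ 2) (fun s => 2 * s) (fun s _ => (hsq s).continuousAt.continuousWithinAt)
    (fun s _ => hsq s)
  have hr : ∀ r : ℝ, HasDerivAt (fun r : ℝ => pair (gradL hH (z + r • w)) w)
      (pair (fderiv ℝ (gradL hH) (z + r • w) w) w) r := by
    intro r
    have k1 : HasDerivAt (fun s : ℝ => z + s • w) w r := by
      simpa using ((hasDerivAt_id r).smul_const w).const_add z
    have k2 := (((contDiff_gradL hH).differentiable (by norm_num)
      (z + r • w)).hasFDerivAt).comp_hasDerivAt r k1
    have k3 := (hasFDerivAt_fst (𝕜 := ℝ) (p := gradL hH (z + r • w))).comp_hasDerivAt r k2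
    have k4 := (hasFDerivAt_snd (𝕜 := ℝ) (p := gradL hH (z + r • w))).comp_hasDerivAt r k2
    have k5 := (k3.inner ℝ (hasDerivAt_const r w.1)).add (k4.inner ℝ (hasDerivAt_const r w.2))
    refine k5.congr_deriv ?_
    simp [pair]
  obtain ⟨r, hr1, hr2⟩ := exists_hasDerivAt_eq_slope (fun r : ℝ => pair (gradL hH (z + r • w)) w)
    (fun r => pair (fderiv ℝ (gradL hH) (z + r • w) w) w) (show -c < c by linarith [hc.1])
    (fun s _ => (hr s).continuousAt.continuousWithinAt)
    (fun s _ => hr s)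
  have hc0 := hc.1
  have e1 : pair (gradL hH (z + c • w)) w + pair (gradL hH (z + c • (-w))) (-w) =
      2 * c * pair (fderiv ℝ (gradL hH) (z + r • w) w) w := by
    rw [hr2]
    have : z + c • (-w) = z + (-c) • w := by simp
    rw [this]
    have e2 : ∀ a : Phase d, pair a (-w) = - pair a w := fun a => by simp [pair]; ring
    rw [e2]
    field_simp
    ring
  simp only [one_smul, zero_smul, add_zero] at he
  rw [e1] at he
  have e3 : LegendreL H (z + w) + LegendreL H (z - w) - 2 * LegendreL H z =
      pair (fderiv ℝ (gradL hH) (z + r • w) w) w := by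
    have : (2 * c) ≠ 0 := by positivity
    apply mul_left_cancel₀ this
    rw [sub_eq_add_neg z w]
    linarith
  rw [e3]
  have hz : ‖(z + r • w).2‖ ≤ R := by
    have hz' : ‖((z - w) + ((r + 1)/2) • ((2:ℝ) • w)).2‖ ≤ R := by
      apply strip_seg h2
      · have : z - w + (2:ℝ) • w = z + w := by rw [two_smul]; abel
        rw [this]; exact h1
      · constructor <;> linarith [hr1.1, hr1.2, hc.2]
    have : (z - w) + ((r + 1)/2) • ((2:ℝ) • w) = z + r • w := by
      rw [smul_smul]; have : (r+1)/2*2 = r + 1 := by ring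
      rw [this, add_smul, one_smul]; abel
    rwa [this] at hz'
  have k := hC (z + r • w) y hz h3
  have k2 : ‖z + r • w - y‖ ≤ ‖z - y‖ + ‖w‖ := by
    have : z + r • w - y = (z - y) + r • w := by abel
    rw [this]
    refine (norm_add_le _ _).trans ?_
    gcongr
    rw [norm_smul, Real.norm_eq_abs]
    have : |r| ≤ 1 := abs_le.2 ⟨by linarith [hr1.1, hc.2], by linarith [hr1.2, hc.2]⟩
    nlinarith [norm_nonneg w]
  have k3 := (abs_le.1 (pair_le ((fderiv ℝ (gradL hH) (z + r • w) - fderiv ℝ (gradL hH) y) w) w)).2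
  have k4 : pair ((fderiv ℝ (gradL hH) (z + r • w) - fderiv ℝ (gradL hH) y) w) w =
    pair (fderiv ℝ (gradL hH) (z + r • w) w) w - pair (fderiv ℝ (gradL hH) y w) w := by
    rw [← pair_sub_left]; rfl
  have k5 := (fderiv ℝ (gradL hH) (z + r • w) - fderiv ℝ (gradL hH) y).le_opNorm w
  have k6 : ‖fderiv ℝ (gradL hH) (z + r • w) - fderiv ℝ (gradL hH) y‖ ≤
      ε / 2 + C * (‖z - y‖ + ‖w‖) ^ 2 := k.trans (by gcongr)
  have k7 : 2 * ‖(fderiv ℝ (gradL hH) (z + r • w) - fderiv ℝ (gradL hH) y) w‖ * ‖w‖ ≤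
      2 * ((ε / 2 + C * (‖z - y‖ + ‖w‖) ^ 2) * ‖w‖) * ‖w‖ := by
    gcongr
    exact k5.trans (by gcongr)
  calc _ ≤ pair (fderiv ℝ (gradL hH) y w) w +
        2 * ((ε / 2 + C * (‖z - y‖ + ‖w‖) ^ 2) * ‖w‖) * ‖w‖ := by linarith
    _ = _ := by ring

/-- quadratic Fenchel gap -/
lemma fenchel_gap {d : ℕ} {H : Phase d → ℝ} (hH : TonelliHam H) (R M : ℝ) : ∃ c : ℝ, 0 < c ∧
    ∀ x v p : Euc d, ‖v‖ ≤ R → ‖p‖ ≤ M →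
      c * ‖v - Hp H (x, p)‖ ^ 2 ≤ LegendreL H (x, v) + H (x, p) - ⟪p, v⟫ := by
  obtain ⟨B, hB0, hB⟩ := per_bdd (contDiff_Hp hH.smooth).continuous (per_Hp hH) M
  obtain ⟨C, hC0, hC⟩ := per_lip (contDiff_Hp hH.smooth) (per_Hp hH) (|M| + 1)
  set s : ℝ := 1 / (2 * (C + 1) + (|R| + B)) with hs
  have hden : 0 < 2 * (C + 1) + (|R| + B) := by positivity
  have hs0 : 0 < s := by positivity
  refine ⟨s / 2, by positivity, fun x v p hv hp => ?_⟩
  set w := v - Hp H (x, p) with hw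
  have hwn : s * ‖w‖ ≤ 1 := by
    have : ‖w‖ ≤ |R| + B := (norm_sub_le _ _).trans (add_le_add (hv.trans (le_abs_self _)) (hB x p hp))
    rw [hs, div_mul_eq_mul_div, div_le_one hden]; linarith
  have hsC : s * C ≤ 1 / 2 := by
    rw [hs, div_mul_eq_mul_div, div_le_div_iff₀ hden two_pos]
    have := abs_nonneg R
    linarith
  have hd : ∀ r : ℝ, HasDerivAt (fun r : ℝ => H (x, p + r • w)) ⟪Hp H (x, p + r • w), w⟫ r := by
    intro r
    have h1 : HasDerivAt (fun s : ℝ => p + s • w) w r := by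
      simpa using ((hasDerivAt_id r).smul_const w).const_add p
    have h2 := (hasFDerivAt_slice_p hH.smooth x (p + r • w)).comp_hasDerivAt r h1
    refine h2.congr_deriv ?_
    rw [inner_Hp]; simp
  obtain ⟨c, hc, he⟩ := exists_hasDerivAt_eq_slope _ _ hs0
    (fun r _ => (hd r).continuousAt.continuousWithinAt) (fun r _ => hd r)
  simp only [zero_smul, add_zero, sub_zero] at he
  rw [eq_div_iff hs0.ne'] at he
  have hf := fenchel hH x v (p + s • w)
  have hM : M ≤ |M| := le_abs_self M
  have hpc : ‖p + c • w‖ ≤ |M| + 1 := by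
    refine (norm_add_le _ _).trans (add_le_add (hp.trans hM) ?_)
    rw [norm_smul, Real.norm_eq_abs, abs_of_pos hc.1]
    have := norm_nonneg w
    nlinarith [hc.2]
  have h5 := hC (x, p + c • w) (x, p) hpc (by simp; linarith)
  have h6 : ‖((x, p + c • w) : Phase d) - (x, p)‖ ≤ s * ‖w‖ := by
    simp only [Prod.mk_sub_mk, sub_self, add_sub_cancel_left, Prod.norm_mk, norm_zero]
    rw [max_eq_right (norm_nonneg _), norm_smul, Real.norm_eq_abs, abs_of_pos hc.1]
    have := norm_nonneg w
    nlinarith [hc.2]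
  have h7 : ⟪Hp H (x, p + c • w) - Hp H (x, p), w⟫ ≤ C * (s * ‖w‖) * ‖w‖ := by
    refine (real_inner_le_norm _ _).trans ?_
    gcongr
    exact h5.trans (by gcongr)
  rw [inner_sub_left] at h7
  have h8 : ⟪Hp H (x, p), w⟫ + ‖w‖ ^ 2 = ⟪v, w⟫ := by
    rw [← real_inner_self_eq_norm_sq, ← inner_add_left, hw]; simp
  rw [inner_add_left, inner_smul_left, real_inner_comm v w] at hf
  simp only [conj_trivial] at hf
  have h9 : 0 ≤ ‖w‖ ^ 2 := by positivity
  have h10 : s * (C * (s * ‖w‖) * ‖w‖) ≤ s * (1 / 2 * ‖w‖ ^ 2) := by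
    apply mul_le_mul_of_nonneg_left _ hs0.le
    nlinarith
  have h11 : s * ⟪Hp H (x, p + c • w), w⟫ ≤ s * (⟪v, w⟫ - ‖w‖ ^ 2 + C * (s * ‖w‖) * ‖w‖) := by
    apply mul_le_mul_of_nonneg_left _ hs0.le
    linarith
  linarith

/-- superlinearity of L -/
lemma L_superlinear {d : ℕ} {H : Phase d → ℝ} (hH : TonelliHam H) (A : ℝ) (hA : 0 ≤ A) :
    ∃ B : ℝ, 0 ≤ B ∧ ∀ q v, A * ‖v‖ - B ≤ LegendreL H (q, v) := by
  obtain ⟨B, hB0, hB⟩ := per_bdd hH.smooth.continuous hH.periodic A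
  refine ⟨B, hB0, fun q v => ?_⟩
  by_cases hv : v = 0
  · have h1 := fenchel hH q v 0
    have h2 := hB q 0 (by simpa using hA)
    have h3 := le_abs_self (H (q, 0))
    rw [Real.norm_eq_abs] at h2
    simp [hv] at h1 ⊢
    linarith
  · have hv' : 0 < ‖v‖ := norm_pos_iff.2 hv
    have h1 := fenchel hH q v ((A / ‖v‖) • v)
    have h2 := hB q ((A / ‖v‖) • v) (by
      rw [norm_smul, Real.norm_eq_abs, abs_of_nonneg (by positivity), div_mul_cancel₀ _ hv'.ne'])
    have h3 := le_abs_self (H (q, (A / ‖v‖) • v))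
    rw [Real.norm_eq_abs] at h2
    rw [inner_smul_left, real_inner_self_eq_norm_sq] at h1
    have h4 : A / ‖v‖ * ‖v‖ ^ 2 = A * ‖v‖ := by field_simp
    simp only [conj_trivial] at h1
    linarith


def Adm {d : ℕ} (L : Phase d → ℝ) (av s : ℝ) (y q : Euc d) (a : ℝ) : Prop :=
  ∃ γ γ' : ℝ → Euc d, ACOn γ γ' (-s) 0 ∧ γ 0 = q ∧ γ (-s) = y ∧
    IntervalIntegrable (fun τ => L (γ τ, γ' τ) + av) volume (-s) 0 ∧
    a = ∫ τ in (-s)..0, (L (γ τ, γ' τ) + av)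

lemma LOvals_eq {d : ℕ} (L : Phase d → ℝ) (av : ℝ) (u : Euc d → ℝ) (t : ℝ) (q : Euc d) :
    LOvals L 0 av 0 u t q = {r | ∃ y a, Adm L av t y q a ∧ r = u y + a} := by
  ext r
  simp only [LOvals, Adm, zero_mul, Real.exp_zero, one_mul, inner_zero_left, sub_zero, neg_zero,
    mem_setOf_eq]
  constructor
  · rintro ⟨γ, γ', h1, h2, h3, h4⟩
    exact ⟨γ (-t), _, ⟨γ, γ', h1, h2, rfl, h3, rfl⟩, h4⟩
  · rintro ⟨y, a, ⟨γ, γ', h1, h2, h3, h4, h5⟩, h6⟩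
    exact ⟨γ, γ', h1, h2, h4, by rw [h6, h3, h5]⟩

/-- general-interval admissibility -/
def AdmI {d : ℕ} (L : Phase d → ℝ) (av b c : ℝ) (y q : Euc d) (a : ℝ) : Prop :=
  ∃ γ γ' : ℝ → Euc d, ACOn γ γ' b c ∧ γ c = q ∧ γ b = y ∧
    IntervalIntegrable (fun τ => L (γ τ, γ' τ) + av) volume b c ∧
    a = ∫ τ in b..c, (L (γ τ, γ' τ) + av)

lemma AdmI.shift {d : ℕ} {L : Phase d → ℝ} {av b c : ℝ} {y q : Euc d} {a : ℝ}
    (h : AdmI L av b c y q a) (e : ℝ) : AdmI L av (b - e) (c - e) y q a := by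
  obtain ⟨γ, γ', ⟨h1, h2⟩, h3, h4, h5, h6⟩ := h
  refine ⟨fun τ => γ (τ + e), fun τ => γ' (τ + e), ⟨h1.comp_add_right e, ?_⟩, by simp [h3],
    by simp [h4], h5.comp_add_right e, ?_⟩
  · intro t ht
    rw [intervalIntegral.integral_comp_add_right (fun s => γ' s)]
    have := h2 (t + e) ⟨by linarith [ht.1], by linarith [ht.2]⟩
    simpa using this
  · rw [intervalIntegral.integral_comp_add_right (fun τ => L (γ τ, γ' τ) + av)]
    simpa using h6

lemma AdmI.restrict {d : ℕ} {L : Phase d → ℝ} {av b m c : ℝ} {y q : Euc d} {a : ℝ}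
    (h : AdmI L av b c y q a) (hbm : b ≤ m) (hmc : m ≤ c) :
    ∃ x a1 a2, AdmI L av b m y x a1 ∧ AdmI L av m c x q a2 ∧ a = a1 + a2 := by
  obtain ⟨γ, γ', ⟨h1, h2⟩, h3, h4, h5, h6⟩ := h
  have hu : uIcc b m ⊆ uIcc b c := by
    rw [uIcc_of_le hbm, uIcc_of_le (hbm.trans hmc)]; exact Icc_subset_Icc_right hmc
  have hu' : uIcc m c ⊆ uIcc b c := by
    rw [uIcc_of_le hmc, uIcc_of_le (hbm.trans hmc)]; exact Icc_subset_Icc_left hbm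
  refine ⟨γ m, _, _, ⟨γ, γ', ⟨h1.mono_set hu, fun t ht => h2 t ⟨ht.1, ht.2.trans hmc⟩⟩, rfl, h4,
    h5.mono_set hu, rfl⟩, ⟨γ, γ', ⟨h1.mono_set hu', fun t ht => ?_⟩, h3, rfl, h5.mono_set hu', rfl⟩, ?_⟩
  · rw [h2 t ⟨hbm.trans ht.1, ht.2⟩, h2 m ⟨hbm, hmc⟩, add_assoc,
      intervalIntegral.integral_add_adjacent_intervals (h1.mono_set hu)]
    apply h1.mono_set
    rw [uIcc_of_le ht.1, uIcc_of_le (hbm.trans hmc)]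
    exact Icc_subset_Icc hbm ht.2
  · rw [h6, intervalIntegral.integral_add_adjacent_intervals (h5.mono_set hu) (h5.mono_set hu')]

lemma AdmI.concat {d : ℕ} {L : Phase d → ℝ} {av b m c : ℝ} {y x q : Euc d} {a1 a2 : ℝ}
    (h : AdmI L av b m y x a1) (h' : AdmI L av m c x q a2) (hbm : b ≤ m) (hmc : m ≤ c) :
    AdmI L av b c y q (a1 + a2) := by
  obtain ⟨γ, γ', ⟨h1, h2⟩, h3, h4, h5, h6⟩ := h
  obtain ⟨β, β', ⟨k1, k2⟩, k3, k4, k5, k6⟩ := h'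
  set Γ : ℝ → Euc d := fun τ => if τ ≤ m then γ τ else β τ with hΓ
  set Γ' : ℝ → Euc d := fun τ => if τ ≤ m then γ' τ else β' τ with hΓ'
  have eΓ1 : ∀ τ ≤ m, Γ τ = γ τ := fun τ h => by simp [hΓ, h]
  have eΓ2 : ∀ τ, m < τ → Γ τ = β τ := fun τ h => by simp [hΓ, not_le.2 h]
  have eΓ3 : ∀ τ, m ≤ τ → Γ τ = β τ := fun τ h => by
    rcases h.eq_or_lt with rfl | h
    · rw [eΓ1 _ le_rfl, h3, k4]
    · exact eΓ2 τ h
  have e1 : ∀ τ ≤ m, Γ' τ = γ' τ := fun τ h => by simp [hΓ', h]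
  have e2 : ∀ τ, m < τ → Γ' τ = β' τ := fun τ h => by simp [hΓ', not_le.2 h]
  have i1 : IntervalIntegrable Γ' volume b m := by
    refine h1.congr fun τ hτ => ?_
    rw [uIoc_of_le hbm] at hτ
    exact (e1 τ hτ.2).symm
  have i2 : IntervalIntegrable Γ' volume m c := by
    refine k1.congr fun τ hτ => ?_
    rw [uIoc_of_le hmc] at hτ
    exact (e2 τ hτ.1).symm
  have j1 : IntervalIntegrable (fun τ => L (Γ τ, Γ' τ) + av) volume b m := by
    refine h5.congr fun τ hτ => ?_
    rw [uIoc_of_le hbm] at hτ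
    simp only [e1 τ hτ.2, eΓ1 τ hτ.2]
  have j2 : IntervalIntegrable (fun τ => L (Γ τ, Γ' τ) + av) volume m c := by
    refine k5.congr fun τ hτ => ?_
    rw [uIoc_of_le hmc] at hτ
    simp only [e2 τ hτ.1, eΓ2 τ hτ.1]
  have v1 : ∀ t ∈ Icc b m, ∫ s in b..t, Γ' s = ∫ s in b..t, γ' s := fun t ht => by
    refine intervalIntegral.integral_congr fun τ hτ => ?_
    rw [uIcc_of_le ht.1] at hτ
    exact e1 τ (hτ.2.trans ht.2)
  have v2 : ∀ t ∈ Icc m c, ∫ s in m..t, Γ' s = ∫ s in m..t, β' s := fun t ht => by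
    refine intervalIntegral.integral_congr_ae (Eventually.of_forall fun τ hτ => ?_)
    rw [uIoc_of_le ht.1] at hτ
    exact e2 τ hτ.1
  refine ⟨Γ, Γ', ⟨i1.trans i2, fun t ht => ?_⟩, by rw [eΓ3 c hmc, k3], by rw [eΓ1 b hbm, h4],
    j1.trans j2, ?_⟩
  · rcases le_total t m with htm | htm
    · rw [v1 t ⟨ht.1, htm⟩, eΓ1 t htm, eΓ1 b hbm, h2 t ⟨ht.1, htm⟩]
    · have i3 : IntervalIntegrable Γ' volume m t := by
        apply i2.mono_set
        rw [uIcc_of_le hmc, uIcc_of_le htm]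
        exact Icc_subset_Icc_right ht.2
      rw [← intervalIntegral.integral_add_adjacent_intervals i1 i3, v1 m ⟨hbm, le_rfl⟩,
        v2 t ⟨htm, ht.2⟩, eΓ3 t htm, eΓ1 b hbm, k2 t ⟨htm, ht.2⟩, ← add_assoc,
        ← h2 m ⟨hbm, le_rfl⟩, h3, k4]
  · rw [← intervalIntegral.integral_add_adjacent_intervals j1 j2, h6, k6]
    congr 1
    · refine intervalIntegral.integral_congr fun τ hτ => ?_
      rw [uIcc_of_le hbm] at hτ
      simp only [e1 τ hτ.2, eΓ1 τ hτ.2]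
    · refine intervalIntegral.integral_congr_ae (Eventually.of_forall fun τ hτ => ?_)
      rw [uIoc_of_le hmc] at hτ
      simp only [e2 τ hτ.1, eΓ2 τ hτ.1]

lemma adm_concat {d : ℕ} {L : Phase d → ℝ} {av t s : ℝ} {y x q : Euc d} {a b : ℝ}
    (ht : 0 ≤ t) (hs : 0 ≤ s) (h : Adm L av t y x a) (h' : Adm L av s x q b) :
    Adm L av (t + s) y q (a + b) := by
  have h1 : AdmI L av (-t - s) (0 - s) y x a := AdmI.shift h s
  have h2 : AdmI L av (0 - s) 0 x q b := by rw [zero_sub]; exact h'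
  have := h1.concat h2 (by linarith) (by linarith)
  rw [show -t - s = -(t + s) by ring] at this
  exact this

lemma adm_split {d : ℕ} {L : Phase d → ℝ} {av t s : ℝ} {y q : Euc d} {c : ℝ}
    (ht : 0 ≤ t) (hs : 0 ≤ s) (h : Adm L av (t + s) y q c) :
    ∃ x a b, Adm L av t y x a ∧ Adm L av s x q b ∧ c = a + b := by
  have h' : AdmI L av (-(t + s)) 0 y q c := h
  obtain ⟨x, a, b, h1, h2, h3⟩ := h'.restrict (m := -s) (by linarith) (by linarith)
  refine ⟨x, a, b, ?_, h2, h3⟩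
  have := h1.shift (-s)
  rw [show -(t + s) - -s = -t by ring, sub_self] at this
  exact this

lemma adm_per {d : ℕ} {H : Phase d → ℝ} (hH : TonelliHam H) {av t : ℝ} {y q : Euc d} {c : ℝ}
    (k : Fin d → ℤ) (h : Adm (LegendreL H) av t y q c) :
    Adm (LegendreL H) av t (y + intVec k) (q + intVec k) c := by
  obtain ⟨γ, γ', ⟨h1, h2⟩, h3, h4, h5, h6⟩ := h
  refine ⟨fun τ => γ τ + intVec k, γ', ⟨h1, fun t ht => ?_⟩, by simp [h3], by simp [h4], ?_, ?_⟩
  · simp only; rw [h2 t ht]; abel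
  · simpa only [per_L hH k] using h5
  · simpa only [per_L hH k] using h6

/-- straight segments -/
lemma adm_segment {d : ℕ} {H : Phase d → ℝ} (hH : TonelliHam H) (av R : ℝ) :
    ∃ C : ℝ, 0 ≤ C ∧ ∀ (s : ℝ) (q v : Euc d), 0 ≤ s → s ≤ 1 → ‖v‖ ≤ R →
      ∃ a, Adm (LegendreL H) av s (q - s • v) q a ∧
        a ≤ s * (LegendreL H (q, v) + av) + C * s ^ 2 := by
  obtain ⟨K, hK0, hK⟩ := taylor1 hH R
  obtain ⟨M, hM0, hM⟩ := per_bdd (contDiff_gradL hH).continuous (per_gradL hH) R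
  refine ⟨2 * M * |R| + K * |R| ^ 2, by positivity, fun s q v hs hs1 hv => ?_⟩
  have hc : Continuous (fun τ : ℝ => LegendreL H (q + τ • v, v) + av) := by
    have := continuous_L hH
    fun_prop
  have hv' : ‖v‖ ≤ |R| := hv.trans (le_abs_self R)
  refine ⟨_, ⟨fun τ => q + τ • v, fun _ => v, ⟨intervalIntegrable_const, fun t ht => ?_⟩, by simp,
    by simp [sub_eq_add_neg], hc.intervalIntegrable _ _, rfl⟩, ?_⟩
  · simp [add_smul]; abel
  · have hb : ∀ τ ∈ Icc (-s) 0, LegendreL H (q + τ • v, v) + av ≤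
        LegendreL H (q, v) + av + (2 * M * |R| + K * |R| ^ 2) * s := by
      intro τ hτ
      have h1 := hK (q, v) (τ • v, 0) hv (by simpa using hv)
      have h2 := hM q v hv
      have h3 := pair_le (gradL hH (q, v)) (τ • v, 0)
      have h4 : ‖((τ • v, 0) : Phase d)‖ ≤ s * |R| := by
        simp only [Prod.norm_mk, norm_zero]
        rw [max_eq_left (norm_nonneg _), norm_smul, Real.norm_eq_abs]
        have : |τ| ≤ s := abs_le.2 ⟨hτ.1, hτ.2.trans hs⟩
        gcongr
      simp only [Prod.mk_add_mk, add_zero] at h1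
      have h5 : 2 * ‖gradL hH (q, v)‖ * ‖((τ • v, 0) : Phase d)‖ ≤ 2 * M * (s * |R|) := by
        gcongr
      have h6 : K * ‖((τ • v, 0) : Phase d)‖ ^ 2 ≤ K * (s * |R|) ^ 2 := by gcongr
      have h7 : K * (s * |R|) ^ 2 ≤ K * |R| ^ 2 * s := by
        have : s ^ 2 ≤ s := by nlinarith
        calc K * (s * |R|) ^ 2 = K * |R| ^ 2 * s ^ 2 := by ring
          _ ≤ _ := by gcongr
      have h8 := (abs_le.1 h1).2
      have h9 := (abs_le.1 h3).2
      linarith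
    have h1 := intervalIntegral.integral_mono_on (μ := volume) (show -s ≤ 0 by linarith)
      (hc.intervalIntegrable (-s) 0) intervalIntegrable_const hb
    rw [intervalIntegral.integral_const] at h1
    refine h1.trans (le_of_eq ?_)
    simp only [smul_eq_mul]; ring

lemma adm_ac_bound {d : ℕ} {H : Phase d → ℝ} (hH : TonelliHam H) (av A : ℝ) (hA : 0 ≤ A) :
    ∃ B : ℝ, 0 ≤ B ∧ ∀ (s : ℝ) (γ γ' : ℝ → Euc d), 0 ≤ s → ACOn γ γ' (-s) 0 →
      IntervalIntegrable (fun τ => LegendreL H (γ τ, γ' τ) + av) volume (-s) 0 →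
      A * (∫ τ in (-s)..0, ‖γ' τ‖) ≤ (∫ τ in (-s)..0, (LegendreL H (γ τ, γ' τ) + av)) + B * s := by
  obtain ⟨B, hB0, hB⟩ := L_superlinear hH A hA
  refine ⟨B + |av|, by positivity, fun s γ γ' hs h1 h2 => ?_⟩
  have h3 : ∫ τ in (-s)..0, (A * ‖γ' τ‖ - (B + |av|)) ≤
      ∫ τ in (-s)..0, (LegendreL H (γ τ, γ' τ) + av) := by
    refine intervalIntegral.integral_mono_on (by linarith)
      ((h1.1.norm.const_mul A).sub intervalIntegrable_const) h2 fun τ _ => ?_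
    have := hB (γ τ) (γ' τ)
    have := neg_abs_le av
    linarith
  rw [intervalIntegral.integral_sub (h1.1.norm.const_mul A) intervalIntegrable_const,
    intervalIntegral.integral_const, intervalIntegral.integral_const_mul] at h3
  simp only [smul_eq_mul] at h3
  linarith

lemma ac_sub {d : ℕ} {γ γ' : ℝ → Euc d} {s : ℝ} (h : ACOn γ γ' (-s) 0) {τ : ℝ}
    (hτ : τ ∈ Icc (-s) 0) : γ 0 - γ τ = ∫ r in τ..0, γ' r := by
  have hs : -s ≤ 0 := hτ.1.trans hτ.2
  rw [h.2 0 ⟨hs, le_rfl⟩, h.2 τ hτ, add_sub_add_left_eq_sub,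
    intervalIntegral.integral_interval_sub_left h.1]
  apply h.1.mono_set
  rw [uIcc_of_le hτ.1, uIcc_of_le hs]
  exact Icc_subset_Icc_right hτ.2

lemma ac_dist {d : ℕ} {γ γ' : ℝ → Euc d} {s : ℝ} (h : ACOn γ γ' (-s) 0) {τ : ℝ}
    (hτ : τ ∈ Icc (-s) 0) : ‖γ 0 - γ τ‖ ≤ ∫ r in (-s)..0, ‖γ' r‖ := by
  have hs : -s ≤ 0 := hτ.1.trans hτ.2
  rw [ac_sub h hτ]
  refine (intervalIntegral.norm_integral_le_integral_norm hτ.2).trans ?_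
  refine intervalIntegral.integral_mono_interval hτ.1 hτ.2 le_rfl
    (Eventually.of_forall fun _ => norm_nonneg _) h.1.norm

/-- F2 -/
lemma adm_lower {d : ℕ} {H : Phase d → ℝ} (hH : TonelliHam H) (av A : ℝ) (hA : 0 ≤ A) :
    ∃ B : ℝ, 0 ≤ B ∧ ∀ (s : ℝ) (y q : Euc d) (a : ℝ), 0 ≤ s → Adm (LegendreL H) av s y q a →
      A * ‖q - y‖ ≤ a + B * s := by
  obtain ⟨B, hB0, hB⟩ := adm_ac_bound hH av A hA
  refine ⟨B, hB0, ?_⟩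
  rintro s y q a hs ⟨γ, γ', h1, h2, h3, h4, h5⟩
  have := hB s γ γ' hs h1 h4
  have h6 := ac_dist h1 (τ := -s) ⟨le_rfl, by linarith⟩
  rw [h2, h3] at h6
  rw [h5]
  nlinarith

/-- F3 -/
lemma adm_lower' {d : ℕ} {H : Phase d → ℝ} (hH : TonelliHam H) (av M : ℝ) :
    ∃ C B : ℝ, 0 ≤ C ∧ 0 ≤ B ∧ ∀ (s : ℝ) (y q p : Euc d) (a : ℝ), 0 ≤ s → ‖p‖ ≤ M →
      Adm (LegendreL H) av s y q a →
      ⟪p, q - y⟫ + s * (av - H (q, p)) - C * s * (a + B * s) ≤ a := by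
  obtain ⟨B, hB0, hB⟩ := adm_ac_bound hH av 1 zero_le_one
  have h1H : ContDiff ℝ 1 H := hH.smooth.of_le (by norm_num)
  obtain ⟨C, hC0, hC⟩ := per_lip h1H hH.periodic M
  refine ⟨C, B, hC0, hB0, ?_⟩
  rintro s y q p a hs hp ⟨γ, γ', h1, h2, h3, h4, h5⟩
  have h6 := hB s γ γ' hs h1 h4
  rw [← h5, one_mul] at h6
  have hip : IntervalIntegrable (fun τ => ⟪p, γ' τ⟫) volume (-s) 0 := by
    have := (innerSL ℝ p).integrable_comp (μ := volume.restrict (Ioc (-s) 0)) h1.1.1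
    rw [intervalIntegrable_iff_integrableOn_Ioc_of_le (by linarith)]
    exact this
  have hii : ∫ τ in (-s)..0, ⟪p, γ' τ⟫ = ⟪p, q - y⟫ := by
    have := (innerSL ℝ p).intervalIntegral_comp_comm h1.1
    simp only [innerSL_apply_apply] at this
    rw [this, ← ac_sub h1 ⟨le_rfl, by linarith⟩, h2, h3]
  have h7 : ∫ τ in (-s)..0, (⟪p, γ' τ⟫ + (av - H (q, p) - C * (a + B * s))) ≤ a := by
    rw [h5]
    refine intervalIntegral.integral_mono_on (by linarith) (hip.add intervalIntegrable_const) h4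
      fun τ hτ => ?_
    have k1 := fenchel hH (γ τ) (γ' τ) p
    have k2 := hC (γ τ, p) (q, p) hp hp
    have k3 : ‖((γ τ, p) : Phase d) - (q, p)‖ ≤ a + B * s := by
      simp only [Prod.mk_sub_mk, sub_self, Prod.norm_mk, norm_zero]
      rw [max_eq_left (norm_nonneg _), ← h2, norm_sub_rev]
      exact (ac_dist h1 hτ).trans h6
    have k4 : H (γ τ, p) - H (q, p) ≤ C * (a + B * s) :=
      (le_abs_self _).trans (k2.trans (by gcongr))
    rw [← h5]
    linarith
  rw [intervalIntegral.integral_add hip intervalIntegrable_const, hii,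
    intervalIntegral.integral_const, smul_eq_mul] at h7
  linarith


structure SG {d : ℕ} (H : Phase d → ℝ) (av : ℝ) (U : ℝ → Euc d → ℝ) : Prop where
  per : ∀ t, 0 ≤ t → PerFun (U t)
  s1 : ∀ (t s : ℝ) (y q : Euc d) (a : ℝ), 0 ≤ t → 0 ≤ s → Adm (LegendreL H) av s y q a →
    U (t + s) q ≤ U t y + a
  s2 : ∀ (t s : ℝ) (q : Euc d) (ε : ℝ), 0 ≤ t → 0 ≤ s → 0 < ε →
    ∃ y a, Adm (LegendreL H) av s y q a ∧ U t y + a ≤ U (t + s) q + ε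
  bdd : ∃ B : ℝ, 0 ≤ B ∧ ∀ t, 0 ≤ t → ∀ q, |U t q| ≤ B

lemma perfun_bdd {d : ℕ} {f : Euc d → ℝ} (hf : Continuous f) (hp : PerFun f) :
    ∃ B : ℝ, 0 ≤ B ∧ ∀ q, |f q| ≤ B := by
  obtain ⟨C, h0, hC⟩ := per_bdd (F := fun z : Phase d => f z.1) (by fun_prop)
    (fun k q p => hp k q) 0
  exact ⟨C, h0, fun q => hC q 0 (by simp)⟩

lemma adm_exists {d : ℕ} {H : Phase d → ℝ} (hH : TonelliHam H) (av t : ℝ) (q : Euc d) :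
    ∃ a, Adm (LegendreL H) av t q q a := by
  have := continuous_L hH
  exact ⟨_, fun _ => q, fun _ => 0, ⟨intervalIntegrable_const, fun t _ => by simp⟩, rfl, rfl,
    intervalIntegrable_const, rfl⟩

section LO
variable {d : ℕ} {H : Phase d → ℝ} (hH : TonelliHam H) (av : ℝ) {u0 : Euc d → ℝ}
  (hu0 : Continuous u0) (hu0p : PerFun u0)

include hH hu0 hu0p in
lemma LO_bddBelow {t : ℝ} (ht : 0 ≤ t) (q : Euc d) :
    BddBelow (LOvals (LegendreL H) 0 av 0 u0 t q) := by
  obtain ⟨B, hB0, hB⟩ := perfun_bdd hu0 hu0p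
  obtain ⟨C, hC0, hC⟩ := adm_lower hH av 0 le_rfl
  refine ⟨-B - C * t, ?_⟩
  rw [LOvals_eq]
  rintro r ⟨y, a, h, rfl⟩
  have := hC t y q a ht h
  have := (abs_le.1 (hB y)).1
  linarith

include hH in
lemma LO_nonempty (t : ℝ) (q : Euc d) :
    (LOvals (LegendreL H) 0 av 0 u0 t q).Nonempty := by
  rw [LOvals_eq]
  obtain ⟨a, ha⟩ := adm_exists hH av t q
  exact ⟨_, q, a, ha, rfl⟩

include hH hu0 hu0p in
lemma LO_le {t : ℝ} (ht : 0 ≤ t) {y q : Euc d} {a : ℝ} (h : Adm (LegendreL H) av t y q a) :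
    LaxOleinik (LegendreL H) 0 av 0 u0 t q ≤ u0 y + a := by
  refine csInf_le (LO_bddBelow hH av hu0 hu0p ht q) ?_
  rw [LOvals_eq]
  exact ⟨y, a, h, rfl⟩

include hH in
lemma LO_near (t : ℝ) (q : Euc d) {ε : ℝ} (hε : 0 < ε) :
    ∃ y a, Adm (LegendreL H) av t y q a ∧
      u0 y + a ≤ LaxOleinik (LegendreL H) 0 av 0 u0 t q + ε := by
  obtain ⟨r, hr, hr'⟩ := exists_lt_of_csInf_lt (LO_nonempty hH av t q (u0 := u0))
    (show sInf _ < LaxOleinik (LegendreL H) 0 av 0 u0 t q + ε by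
      rw [LaxOleinik]; linarith)
  rw [LOvals_eq] at hr
  obtain ⟨y, a, h, rfl⟩ := hr
  exact ⟨y, a, h, hr'.le⟩

include hH hu0 hu0p in
lemma LO_s1 (t s : ℝ) (y q : Euc d) (a : ℝ) (ht : 0 ≤ t) (hs : 0 ≤ s)
    (h : Adm (LegendreL H) av s y q a) :
    LaxOleinik (LegendreL H) 0 av 0 u0 (t + s) q ≤ LaxOleinik (LegendreL H) 0 av 0 u0 t y + a := by
  refine le_of_forall_pos_le_add fun ε hε => ?_
  obtain ⟨y', a', h1, h2⟩ := LO_near hH av t y hε (u0 := u0)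
  have := LO_le hH av hu0 hu0p (by positivity) (adm_concat ht hs h1 h)
  linarith

include hH hu0 hu0p in
lemma LO_s2 (t s : ℝ) (q : Euc d) (ε : ℝ) (ht : 0 ≤ t) (hs : 0 ≤ s) (hε : 0 < ε) :
    ∃ y a, Adm (LegendreL H) av s y q a ∧ LaxOleinik (LegendreL H) 0 av 0 u0 t y + a
      ≤ LaxOleinik (LegendreL H) 0 av 0 u0 (t + s) q + ε := by
  obtain ⟨y', c, h1, h2⟩ := LO_near hH av (t + s) q hε (u0 := u0)
  obtain ⟨x, a, b, h3, h4, rfl⟩ := adm_split ht hs h1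
  refine ⟨x, b, h4, ?_⟩
  have := LO_le hH av hu0 hu0p ht h3
  linarith

include hH hu0 hu0p in
lemma LO_per (t : ℝ) (ht : 0 ≤ t) : PerFun (LaxOleinik (LegendreL H) 0 av 0 u0 t) := by
  have key : ∀ k q, LaxOleinik (LegendreL H) 0 av 0 u0 t (q + intVec k) ≤
      LaxOleinik (LegendreL H) 0 av 0 u0 t q := by
    intro k q
    refine le_of_forall_pos_le_add fun ε hε => ?_
    obtain ⟨y, a, h1, h2⟩ := LO_near hH av t q hε (u0 := u0)
    have := LO_le hH av hu0 hu0p ht (adm_per hH k h1)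
    rw [hu0p k y] at this
    linarith
  intro k q
  refine le_antisymm (key k q) ?_
  have := key (-k) (q + intVec k)
  have e : q + intVec k + intVec (-k) = q := by
    ext i; simp [intVec]
  rwa [e] at this

include hH hu0 hu0p in
lemma SG_LO {u : Euc d → ℝ} (hu : Continuous u)
    (hconv : TendstoUniformly (fun t q => LaxOleinik (LegendreL H) 0 av 0 u0 t q) u atTop) :
    PerFun u ∧ ∃ t0 : ℝ, 0 ≤ t0 ∧
      SG H av (fun t => LaxOleinik (LegendreL H) 0 av 0 u0 (t0 + t)) ∧ SG H av (fun _ => u) := by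
  have hpt : ∀ q, Tendsto (fun t => LaxOleinik (LegendreL H) 0 av 0 u0 t q) atTop (nhds (u q)) :=
    fun q => hconv.tendsto_at q
  have hper : PerFun u := by
    intro k q
    refine tendsto_nhds_unique (hpt (q + intVec k)) ((hpt q).congr' ?_)
    filter_upwards [eventually_ge_atTop 0] with t ht
    exact (LO_per hH av hu0 hu0p t ht k q).symm
  obtain ⟨B, hB0, hB⟩ := perfun_bdd hu hper
  have hu' := Metric.tendstoUniformly_iff.1 hconv
  obtain ⟨t0, ht0⟩ := eventually_atTop.1 ((hu' 1 one_pos).and (eventually_ge_atTop 0))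
  refine ⟨hper, t0, (ht0 t0 le_rfl).2, ⟨?_, ?_, ?_, ?_⟩, ⟨fun _ _ => hper, ?_, ?_, ?_⟩⟩
  · intro t ht; exact LO_per hH av hu0 hu0p _ (add_nonneg (ht0 t0 le_rfl).2 ht)
  · intro t s y q a ht hs h
    rw [← add_assoc]
    exact LO_s1 hH av hu0 hu0p _ s y q a (add_nonneg (ht0 t0 le_rfl).2 ht) hs h
  · intro t s q ε ht hs hε
    simp only [← add_assoc]
    exact LO_s2 hH av hu0 hu0p _ s q ε (add_nonneg (ht0 t0 le_rfl).2 ht) hs hε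
  · refine ⟨B + 1, by positivity, fun t ht q => ?_⟩
    have := (ht0 (t0 + t) (by linarith)).1 q
    rw [Real.dist_eq, abs_lt] at this
    have := abs_le.1 (hB q)
    exact abs_le.2 ⟨by linarith, by linarith⟩
  · intro t s y q a _ hs h
    refine le_of_tendsto_of_tendsto ((hpt q).comp (tendsto_atTop_add_const_right _ s tendsto_id))
      ((hpt y).add_const a) ?_
    filter_upwards [eventually_ge_atTop 0] with t ht
    exact LO_s1 hH av hu0 hu0p _ s y q a ht hs h
  · intro t s q ε _ hs hε
    obtain ⟨t1, ht1⟩ := eventually_atTop.1 ((hu' (ε/3) (by positivity)).and (eventually_ge_atTop 0))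
    obtain ⟨y, a, h1, h2⟩ := LO_s2 hH av hu0 hu0p t1 s q (ε/3) (ht1 t1 le_rfl).2 hs (by positivity)
    refine ⟨y, a, h1, ?_⟩
    have h3 := (ht1 t1 le_rfl).1 y
    have h4 := (ht1 (t1 + s) (by linarith)).1 q
    rw [Real.dist_eq, abs_lt] at h3 h4
    linarith
  · exact ⟨B, hB0, fun t _ => hB⟩

include hH in
lemma SG_weakKAM {u : Euc d → ℝ} (hu : Continuous u) (h : SG H (maneCritical H) (fun _ => u)) :
    IsWeakKAM H u := by
  have hper := h.per 0 le_rfl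
  refine ⟨hu, hper, fun t ht q => le_antisymm ?_ ?_⟩
  · refine le_of_forall_pos_le_add fun ε hε => ?_
    obtain ⟨y, a, h1, h2⟩ := h.s2 0 t q ε le_rfl ht.le hε
    have := LO_le hH _ hu hper ht.le h1
    linarith
  · refine le_of_forall_pos_le_add fun ε hε => ?_
    obtain ⟨y, a, h1, h2⟩ := LO_near hH (maneCritical H) t q hε (u0 := u)
    have := h.s1 0 t y q a le_rfl ht.le h1
    linarith
end LO

section lip
variable {d : ℕ} {H : Phase d → ℝ} (hH : TonelliHam H) {av : ℝ}

include hH in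
lemma seg_cost (av R : ℝ) : ∃ C : ℝ, 0 ≤ C ∧ ∀ (s : ℝ) (y q : Euc d), 0 < s → s ≤ 1 →
    ‖q - y‖ ≤ R * s → ∃ a, Adm (LegendreL H) av s y q a ∧ a ≤ C * s := by
  obtain ⟨C, hC0, hC⟩ := adm_segment hH av R
  obtain ⟨M, hM0, hM⟩ := per_bdd (continuous_L hH) (per_L hH) R
  refine ⟨M + |av| + C, by positivity, fun s y q hs hs1 h => ?_⟩
  have hv : ‖s⁻¹ • (q - y)‖ ≤ R := by
    rw [norm_smul, norm_inv, Real.norm_of_nonneg hs.le, inv_mul_le_iff₀ hs]; linarith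
  obtain ⟨a, h1, h2⟩ := hC s q (s⁻¹ • (q - y)) hs.le hs1 hv
  rw [smul_inv_smul₀ hs.ne', sub_sub_cancel] at h1
  refine ⟨a, h1, h2.trans ?_⟩
  have h3 := (le_abs_self _).trans (hM q _ hv)
  have h4 := le_abs_self av
  have h5 : C * s ^ 2 ≤ C * s := by
    have : s ^ 2 ≤ s := by nlinarith
    gcongr
  nlinarith

include hH in
lemma shorten (av M B : ℝ) (hM : 0 ≤ M) (hB0 : 0 ≤ B)
    (hB : ∀ (s : ℝ) (y q : Euc d) (a : ℝ), 0 ≤ s → Adm (LegendreL H) av s y q a →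
      1 * ‖q - y‖ ≤ a + B * s) : ∃ C : ℝ, 0 ≤ C ∧ ∀ (N : ℕ) (s : ℝ) (y q : Euc d) (c : ℝ),
    0 < s → s ≤ 1 → Adm (LegendreL H) av ((N + 1) * s) y q c →
    c + B * ((N + 1) * s) ≤ M * ((N + 1) * s) →
    ∃ c', Adm (LegendreL H) av ((N + 1) * s - s / 2) y q c' ∧ c' ≤ c + C * s := by
  obtain ⟨C, hC0, hC⟩ := seg_cost hH av (2 * M)
  refine ⟨C + B, by positivity, fun N => ?_⟩
  have base : ∀ (s : ℝ) (y q : Euc d) (c : ℝ), 0 < s → s ≤ 1 → Adm (LegendreL H) av s y q c →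
      c + B * s ≤ M * s → ∃ c', Adm (LegendreL H) av (s / 2) y q c' ∧ c' ≤ c + (C + B) * s := by
    intro s y q c hs hs1 h hc
    have h1 := hB s y q c hs.le h
    obtain ⟨a, h2, h3⟩ := hC (s / 2) y q (by linarith) (by linarith) (by nlinarith)
    refine ⟨a, h2, h3.trans ?_⟩
    have := norm_nonneg (q - y)
    nlinarith
  induction N with
  | zero =>
    intro s y q c hs hs1 h hc
    have := base s y q c hs hs1 (by simpa using h) (by simpa using hc)
    convert this using 4
    push_cast; ring
  | succ N ih =>
    intro s y q c hs hs1 h hc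
    push_cast at h hc ⊢
    rw [show ((N : ℝ) + 1 + 1) * s = (N + 1) * s + s by ring] at h
    obtain ⟨x, a, b, h1, h2, rfl⟩ := adm_split (by positivity) hs.le h
    by_cases hb : b + B * s ≤ M * s
    · obtain ⟨c', h3, h4⟩ := base s x q b hs hs1 h2 hb
      refine ⟨a + c', ?_, by linarith⟩
      have := adm_concat (by positivity) (by positivity) h1 h3
      convert this using 1; ring
    · push Not at hb
      obtain ⟨c', h3, h4⟩ := ih s y x a hs hs1 h1 (by nlinarith)
      refine ⟨c' + b, ?_, by linarith⟩
      have := adm_concat (by nlinarith [show (0:ℝ) ≤ N * s by positivity]) hs.le h3 h2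
      convert this using 1; ring

lemma SG.mono_time {U : ℝ → Euc d → ℝ} (h : SG H av U) (hH : TonelliHam H) :
    ∃ C : ℝ, 0 ≤ C ∧ ∀ t δ q, 1 ≤ t → 0 < δ → δ ≤ 1/4 → U (t - δ) q ≤ U t q + C * δ := by
  obtain ⟨B0, hB0, hU⟩ := h.bdd
  obtain ⟨B, hBn, hB⟩ := adm_lower hH av 1 zero_le_one
  obtain ⟨C, hCn, hS⟩ := shorten hH av (2 * (2 * B0 + 1) + B) B (by positivity) hBn hB
  refine ⟨2 * C + 2, by positivity, fun t δ q ht hδ hδ' => ?_⟩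
  set s := 2 * δ with hs
  obtain ⟨N, hN⟩ : ∃ N : ℕ, ⌊1 / s⌋₊ = N + 1 := by
    refine Nat.exists_eq_succ_of_ne_zero (Nat.pos_iff_ne_zero.1 (Nat.floor_pos.2 ?_))
    rw [le_div_iff₀ (by positivity)]; linarith
  have hN1 : ((N : ℝ) + 1) * s ≤ 1 := by
    have := Nat.floor_le (show 0 ≤ 1 / s by positivity)
    rw [hN, le_div_iff₀ (by positivity)] at this
    exact_mod_cast this
  have hN2 : 1 / 2 ≤ ((N : ℝ) + 1) * s := by
    have := Nat.lt_floor_add_one (1 / s)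
    rw [hN, div_lt_iff₀ (by positivity)] at this
    push_cast at this
    nlinarith
  obtain ⟨y, c, h1, h2⟩ := h.s2 (t - (N + 1) * s) ((N + 1) * s) q s (by linarith) (by linarith)
    (by positivity)
  rw [sub_add_cancel] at h2
  have b1 := abs_le.1 (hU (t - (N + 1) * s) (by linarith) y)
  have b2 := abs_le.1 (hU t (by linarith) q)
  obtain ⟨c', h3, h4⟩ := hS N s y q c (by positivity) (by linarith) h1 (by nlinarith)
  have h5 := h.s1 (t - (N + 1) * s) _ y q c' (by linarith) (by linarith) h3
  rw [show t - (N + 1) * s + ((N + 1) * s - s / 2) = t - δ by rw [hs]; ring] at h5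
  rw [hs] at h4 h2
  linarith

lemma SG.lip {U : ℝ → Euc d → ℝ} (h : SG H av U) (hH : TonelliHam H) :
    ∃ C : ℝ, 0 ≤ C ∧ ∀ t x y, 1 ≤ t → |U t x - U t y| ≤ C * ‖x - y‖ := by
  obtain ⟨B0, hB0, hU⟩ := h.bdd
  obtain ⟨C, hC0, hC⟩ := h.mono_time hH
  obtain ⟨C', hC0', hC'⟩ := seg_cost hH av 1
  have key : ∀ t x y, 1 ≤ t → U t y - U t x ≤ (C + C' + 8 * B0) * ‖y - x‖ := by
    intro t x y ht
    rcases le_or_gt ‖y - x‖ (1/4) with hxy | hxy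
    · rcases eq_or_ne y x with rfl | hne
      · simp
      have hδ : 0 < ‖y - x‖ := norm_pos_iff.2 (sub_ne_zero.2 hne)
      have h1 := hC t ‖y - x‖ x ht hδ hxy
      obtain ⟨a, h2, h3⟩ := hC' ‖y - x‖ x y hδ (by linarith) (by linarith)
      have h4 := h.s1 (t - ‖y - x‖) _ x y a (by linarith) hδ.le h2
      rw [sub_add_cancel] at h4
      nlinarith
    · have b1 := abs_le.1 (hU t (by linarith) x)
      have b2 := abs_le.1 (hU t (by linarith) y)
      have : 0 ≤ (C + C') * ‖y - x‖ := by positivity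
      nlinarith
  refine ⟨C + C' + 8 * B0, by positivity, fun t x y ht => abs_le.2 ⟨?_, ?_⟩⟩
  · have := key t x y ht
    rw [norm_sub_rev] at this; linarith
  · exact key t y x ht

/-- (i) -/
lemma SG.step_le {U : ℝ → Euc d → ℝ} (h : SG H av U) (hH : TonelliHam H) (R : ℝ) :
    ∃ C : ℝ, 0 ≤ C ∧ ∀ t δ q v, 0 ≤ t → 0 ≤ δ → δ ≤ 1 → ‖v‖ ≤ R →
      U (t + δ) q ≤ U t (q - δ • v) + δ * (LegendreL H (q, v) + av) + C * δ ^ 2 := by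
  obtain ⟨C, hC0, hC⟩ := adm_segment hH av R
  refine ⟨C, hC0, fun t δ q v ht hδ hδ1 hv => ?_⟩
  obtain ⟨a, h1, h2⟩ := hC δ q v hδ hδ1 hv
  have := h.s1 t δ _ q a ht hδ h1
  linarith

/-- (ii) -/
lemma SG.step_ge {U : ℝ → Euc d → ℝ} (h : SG H av U) (hH : TonelliHam H) :
    ∃ R C : ℝ, 0 ≤ R ∧ 0 ≤ C ∧ ∀ t δ q, 1 ≤ t → 0 < δ → δ ≤ 1 → ∃ v, ‖v‖ ≤ R ∧
      U t (q - δ • v) + δ * (LegendreL H (q, v) + av) - C * δ ^ 2 ≤ U (t + δ) q := by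
  obtain ⟨ℓ, hℓ0, hℓ⟩ := h.lip hH
  obtain ⟨c0, hc0, hc⟩ := seg_cost hH av 0
  obtain ⟨B, hB0, hB⟩ := adm_lower hH av (ℓ + 1) (by positivity)
  set R := c0 + B + 1 with hR
  obtain ⟨M, hM0, hM⟩ := per_bdd (contDiff_Pm hH).continuous (per_Pm hH) R
  obtain ⟨C, B', hC0, hB0', hF⟩ := adm_lower' hH av M
  refine ⟨R, C * (c0 + 1 + ℓ * R + B') + 1, by positivity, by positivity, fun t δ q ht hδ hδ1 => ?_⟩
  obtain ⟨y, a, h1, h2⟩ := h.s2 t δ q (δ ^ 2) (by linarith) hδ.le (by positivity)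
  obtain ⟨a0, h3, h4⟩ := hc δ q q hδ hδ1 (by simp)
  have h5 := h.s1 t δ q q a0 (by linarith) hδ.le h3
  have h6 := hB δ y q a hδ.le h1
  have h7 := abs_le.1 (hℓ t y q ht)
  rw [norm_sub_rev] at h7
  have hδ2 : δ ^ 2 ≤ δ := by nlinarith
  have h8 : ‖q - y‖ ≤ R * δ := by rw [hR]; nlinarith
  have h9 : a ≤ (c0 + 1 + ℓ * R) * δ := by nlinarith
  set v := δ⁻¹ • (q - y) with hv
  have hvR : ‖v‖ ≤ R := by
    rw [hv, norm_smul, norm_inv, Real.norm_of_nonneg hδ.le, inv_mul_le_iff₀ hδ]; linarith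
  have hy : q - δ • v = y := by rw [hv, smul_inv_smul₀ hδ.ne', sub_sub_cancel]
  have hqy : q - y = δ • v := by rw [hv, smul_inv_smul₀ hδ.ne']
  refine ⟨v, hvR, ?_⟩
  rw [hy]
  have h10 := hF δ y q (Pm hH (q, v)) a hδ.le (hM q v hvR) h1
  rw [hqy, inner_smul_right] at h10
  have h11 := leg_isLUB hH (q, v)
  simp only at h11
  rw [h11]
  have h12 : C * δ * (a + B' * δ) ≤ C * (c0 + 1 + ℓ * R + B') * δ ^ 2 := by
    have : C * δ * (a + B' * δ) ≤ C * δ * ((c0 + 1 + ℓ * R) * δ + B' * δ) := by gcongr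
    nlinarith
  nlinarith
end lip


section chains
variable {d : ℕ} {H : Phase d → ℝ} {av : ℝ}

lemma SG.chain_le {U : ℝ → Euc d → ℝ} (h : SG H av U) (hH : TonelliHam H) (R : ℝ) :
    ∃ C : ℝ, 0 ≤ C ∧ ∀ (t δ : ℝ) (N : ℕ) (y : ℕ → Euc d), 0 ≤ t - N * δ → 0 < δ → δ ≤ 1 →
      (∀ k < N, ‖δ⁻¹ • (y k - y (k + 1))‖ ≤ R) →
      U t (y 0) ≤ U (t - N * δ) (y N) + ∑ k ∈ Finset.range N,
        δ * (LegendreL H (y k, δ⁻¹ • (y k - y (k + 1))) + av) + C * (N * δ) * δ := by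
  obtain ⟨C, hC0, hC⟩ := h.step_le hH R
  refine ⟨C, hC0, fun t δ N y => ?_⟩
  induction N with
  | zero => intro _ _ _ _; simp
  | succ N ih =>
    intro ht hδ hδ1 hv
    push_cast at ht
    have h1 := ih (by linarith) hδ hδ1 (fun k hk => hv k (by omega))
    have h2 := hC (t - (N + 1) * δ) δ (y N) _ ht hδ.le hδ1 (hv N (by omega))
    rw [smul_inv_smul₀ hδ.ne', sub_sub_cancel, show t - (N + 1) * δ + δ = t - N * δ by ring] at h2
    rw [Finset.sum_range_succ]
    push_cast
    nlinarith

lemma SG.chain_ge {U : ℝ → Euc d → ℝ} (h : SG H av U) (hH : TonelliHam H) :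
    ∃ R C : ℝ, 0 ≤ R ∧ 0 ≤ C ∧ ∀ (t δ : ℝ) (N : ℕ) (q : Euc d), 1 ≤ t - N * δ → 0 < δ → δ ≤ 1 →
      ∃ y : ℕ → Euc d, y 0 = q ∧ (∀ k < N, ‖δ⁻¹ • (y k - y (k + 1))‖ ≤ R) ∧
      U (t - N * δ) (y N) + ∑ k ∈ Finset.range N,
        δ * (LegendreL H (y k, δ⁻¹ • (y k - y (k + 1))) + av) - C * (N * δ) * δ ≤ U t q := by
  obtain ⟨R, C, hR0, hC0, hC⟩ := h.step_ge hH
  refine ⟨R, C, hR0, hC0, fun t δ N q => ?_⟩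
  induction N with
  | zero => intro _ _ _; exact ⟨fun _ => q, rfl, by simp, by simp⟩
  | succ N ih =>
    intro ht hδ hδ1
    push_cast at ht
    obtain ⟨y, h0, h1, h2⟩ := ih (by linarith) hδ hδ1
    obtain ⟨v, h3, h4⟩ := hC (t - (N + 1) * δ) δ (y N) ht hδ hδ1
    rw [show t - (N + 1) * δ + δ = t - N * δ by ring] at h4
    set y' : ℕ → Euc d := fun k => if k ≤ N then y k else y N - δ • v with hy'
    have e1 : ∀ k ≤ N, y' k = y k := fun k hk => by simp [hy', hk]
    have e2 : y' (N + 1) = y N - δ • v := by simp [hy']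
    have e3 : δ⁻¹ • (y' N - y' (N + 1)) = v := by
      rw [e1 N le_rfl, e2, sub_sub_cancel, inv_smul_smul₀ hδ.ne']
    refine ⟨y', by rw [e1 0 (by omega), h0], fun k hk => ?_, ?_⟩
    · rcases Nat.lt_succ_iff_lt_or_eq.1 hk with hk | rfl
      · rw [e1 k hk.le, e1 (k + 1) hk]; exact h1 k hk
      · rw [e3]; exact h3
    · rw [Finset.sum_range_succ, e3, e2, e1 N le_rfl]
      have : ∑ k ∈ Finset.range N, δ * (LegendreL H (y' k, δ⁻¹ • (y' k - y' (k + 1))) + av) =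
          ∑ k ∈ Finset.range N, δ * (LegendreL H (y k, δ⁻¹ • (y k - y (k + 1))) + av) := by
        refine Finset.sum_congr rfl fun k hk => ?_
        have hk := Finset.mem_range.1 hk
        rw [e1 k hk.le, e1 (k + 1) hk]
      rw [this]
      push_cast
      nlinarith

lemma sum_taylor (hH : TonelliHam H) (R : ℝ) : ∃ K M : ℝ, 0 ≤ K ∧ 0 ≤ M ∧
    ∀ (δ : ℝ) (N : ℕ) (y : ℕ → Euc d) (c : ℕ → ℝ), 0 < δ → N * δ = 1 →
      (∀ k < N, ‖δ⁻¹ • (y k - y (k + 1))‖ ≤ R) → (∀ k < N, |c k| ≤ 1) →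
      (∀ k < N, |c k - c (k + 1)| ≤ δ) →
      ∃ P : Euc d, ‖P‖ ≤ M ∧ ∀ w, ‖w‖ ≤ 1 →
        (∀ k < N, ‖δ⁻¹ • (y k + c k • w - (y (k + 1) + c (k + 1) • w))‖ ≤ R + 1) ∧
        ∑ k ∈ Finset.range N, δ * (LegendreL H (y k + c k • w,
          δ⁻¹ • (y k + c k • w - (y (k + 1) + c (k + 1) • w))) + av) ≤
        ∑ k ∈ Finset.range N, δ * (LegendreL H (y k, δ⁻¹ • (y k - y (k + 1))) + av) +
          ⟪P, w⟫ + K * ‖w‖ ^ 2 := by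
  obtain ⟨K, hK0, hK⟩ := taylor1 hH (R + 1)
  obtain ⟨M, hM0, hM⟩ := per_bdd (contDiff_gradL hH).continuous (per_gradL hH) R
  refine ⟨K, 2 * M, hK0, by positivity, fun δ N y c hδ hN hy hc hc' => ?_⟩
  set V : ℕ → Euc d := fun k => δ⁻¹ • (y k - y (k + 1)) with hV
  set e : ℕ → ℝ := fun k => δ⁻¹ * (c k - c (k + 1)) with he
  have he1 : ∀ k < N, |e k| ≤ 1 := fun k hk => by
    rw [he]; simp only
    rw [abs_mul, abs_inv, abs_of_pos hδ, inv_mul_le_iff₀ hδ, mul_one]; exact hc' k hk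
  have hVV : ∀ k w, δ⁻¹ • (y k + c k • w - (y (k + 1) + c (k + 1) • w)) = V k + e k • w := by
    intro k w
    simp only [hV, he]; module
  refine ⟨∑ k ∈ Finset.range N, δ • (c k • (gradL hH (y k, V k)).1 + e k • (gradL hH (y k, V k)).2),
    ?_, fun w hw => ⟨fun k hk => ?_, ?_⟩⟩
  · calc _ ≤ ∑ k ∈ Finset.range N, δ * (2 * M) := by
          refine norm_sum_le_of_le _ fun k hk => ?_
          have hk := Finset.mem_range.1 hk
          have h1 := hM (y k) (V k) (hy k hk)
          have h2 := (norm_fst_le (gradL hH (y k, V k))).trans h1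
          have h3 := (norm_snd_le (gradL hH (y k, V k))).trans h1
          rw [norm_smul, Real.norm_of_nonneg hδ.le]
          gcongr
          refine (norm_add_le _ _).trans ?_
          rw [norm_smul, norm_smul, Real.norm_eq_abs, Real.norm_eq_abs]
          have := hc k hk
          have := he1 k hk
          have : |c k| * ‖(gradL hH (y k, V k)).1‖ ≤ 1 * M := by gcongr
          have : |e k| * ‖(gradL hH (y k, V k)).2‖ ≤ 1 * M := by gcongr
          linarith
      _ = (N * δ) * (2 * M) := by rw [Finset.sum_const, Finset.card_range, nsmul_eq_mul]; ring
      _ = 2 * M := by rw [hN, one_mul]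
  · rw [hVV]
    refine (norm_add_le _ _).trans (add_le_add (hy k hk) ?_)
    rw [norm_smul]
    exact mul_le_one₀ (he1 k hk) (norm_nonneg _) hw
  · calc _ ≤ ∑ k ∈ Finset.range N, (δ * (LegendreL H (y k, V k) + av) +
          (⟪δ • (c k • (gradL hH (y k, V k)).1 + e k • (gradL hH (y k, V k)).2), w⟫ +
            δ * (K * ‖w‖ ^ 2))) := by
          refine Finset.sum_le_sum fun k hk => ?_
          have hk := Finset.mem_range.1 hk
          rw [hVV]
          have h0 : ‖e k • w‖ ≤ 1 * ‖w‖ := by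
            rw [norm_smul]; have := he1 k hk; rw [Real.norm_eq_abs]; gcongr
          have h0' : ‖c k • w‖ ≤ 1 * ‖w‖ := by
            rw [norm_smul]; have := hc k hk; rw [Real.norm_eq_abs]; gcongr
          have h1 := hK (y k, V k) (c k • w, e k • w) ((hy k hk).trans (by linarith)) (by
            refine (norm_add_le _ _).trans (add_le_add (hy k hk) (by linarith)))
          have h2 : ‖((c k • w, e k • w) : Phase d)‖ ≤ ‖w‖ := by
            rw [Prod.norm_mk]; exact max_le (by linarith) (by linarith)
          have h3 : K * ‖((c k • w, e k • w) : Phase d)‖ ^ 2 ≤ K * ‖w‖ ^ 2 := by gcongr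
          have h4 := (abs_le.1 h1).2
          simp only [Prod.mk_add_mk, pair, inner_smul_right] at h4
          rw [inner_smul_left, inner_add_left, inner_smul_left, inner_smul_left]
          simp only [RCLike.conj_to_real]
          nlinarith
      _ = _ := by
          rw [Finset.sum_add_distrib, Finset.sum_add_distrib, ← sum_inner, Finset.sum_const,
            Finset.card_range, nsmul_eq_mul, ← mul_assoc, hN]
          ring

lemma compact_grad {f : Euc d → ℝ} {K M : ℝ}
    (h : ∀ η > 0, ∃ P : Euc d, ‖P‖ ≤ M ∧ ∀ w, ‖w‖ ≤ 1 → f w ≤ ⟪P, w⟫ + K * ‖w‖ ^ 2 + η) :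
    ∃ P : Euc d, ‖P‖ ≤ M ∧ ∀ w, ‖w‖ ≤ 1 → f w ≤ ⟪P, w⟫ + K * ‖w‖ ^ 2 := by
  choose P hP1 hP2 using fun n : ℕ => h (1 / ((n : ℝ) + 1)) Nat.one_div_pos_of_nat
  obtain ⟨P0, h0, s, hs, hs'⟩ := (isCompact_closedBall (0 : Euc d) M).tendsto_subseq
    (fun n => mem_closedBall_zero_iff.2 (hP1 n))
  refine ⟨P0, mem_closedBall_zero_iff.1 h0, fun w hw => ?_⟩
  have h1 : Tendsto (fun n => ⟪P (s n), w⟫ + K * ‖w‖ ^ 2 + 1 / ((s n : ℝ) + 1)) atTop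
      (nhds (⟪P0, w⟫ + K * ‖w‖ ^ 2 + 0)) :=
    ((hs'.inner tendsto_const_nhds).add_const _).add
      (tendsto_one_div_add_atTop_nhds_zero_nat.comp hs.tendsto_atTop)
  rw [add_zero] at h1
  exact ge_of_tendsto' h1 fun n => hP2 (s n) w hw

lemma SG.semiconcave {U : ℝ → Euc d → ℝ} (h : SG H av U) (hH : TonelliHam H) :
    ∃ K M : ℝ, 0 ≤ K ∧ 0 ≤ M ∧ ∀ t q, 2 ≤ t → ∃ p, ‖p‖ ≤ M ∧ ∀ w,
      U t (q + w) ≤ U t q + ⟪p, w⟫ + K * ‖w‖ ^ 2 := by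
  obtain ⟨ℓ, hℓ0, hℓ⟩ := h.lip hH
  obtain ⟨R, C, hR0, hC0, hC⟩ := h.chain_ge hH
  obtain ⟨C', hC0', hC'⟩ := h.chain_le hH (R + 1)
  obtain ⟨K, M, hK0, hM0, hK⟩ := sum_taylor (av := av) hH R
  refine ⟨K + ℓ + M, M, by positivity, hM0, fun t q ht => ?_⟩
  obtain ⟨P, hP1, hP2⟩ : ∃ P : Euc d, ‖P‖ ≤ M ∧ ∀ w, ‖w‖ ≤ 1 →
      U t (q + w) - U t q ≤ ⟪P, w⟫ + K * ‖w‖ ^ 2 := by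
    apply compact_grad
    intro η hη
    obtain ⟨n, hn⟩ := exists_nat_gt ((C + C') / η)
    set δ : ℝ := 1 / ((n : ℝ) + 1) with hδ
    have hδ0 : 0 < δ := by positivity
    have hδ1 : δ ≤ 1 := by rw [hδ, div_le_one (by positivity)]; linarith [n.cast_nonneg (α := ℝ)]
    have hN : ((n + 1 : ℕ) : ℝ) * δ = 1 := by rw [hδ]; push_cast; field_simp
    obtain ⟨y, hy0, hy1, hy2⟩ := hC t δ (n + 1) q (by rw [hN]; linarith) hδ0 hδ1
    obtain ⟨P, hP, hP'⟩ := hK δ (n + 1) y (fun k => 1 - k * δ) hδ0 hN hy1 (fun k hk => by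
        have : (k : ℝ) * δ ≤ (n + 1 : ℕ) * δ := by gcongr
        rw [hN] at this
        have : 0 ≤ (k : ℝ) * δ := by positivity
        exact abs_le.2 ⟨by linarith, by linarith⟩) (fun k hk => by
        push_cast
        rw [show 1 - (k : ℝ) * δ - (1 - (k + 1) * δ) = δ by ring, abs_of_pos hδ0])
    refine ⟨P, hP, fun w hw => ?_⟩
    obtain ⟨h1, h2⟩ := hP' w hw
    have h3 := hC' t δ (n + 1) (fun k => y k + (1 - k * δ) • w) (by rw [hN]; linarith) hδ0 hδ1 h1
    simp only [hN] at h3 hy2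
    simp only [CharP.cast_eq_zero, zero_mul, sub_zero, one_smul, sub_self, zero_smul, add_zero,
      hy0] at h3
    have h4 : (C + C') * δ ≤ η := by
      rw [hδ, mul_one_div, div_le_iff₀ (by positivity)]
      rw [div_lt_iff₀ hη] at hn
      nlinarith
    linarith
  refine ⟨P, hP1, fun w => ?_⟩
  rcases le_or_gt ‖w‖ 1 with hw | hw
  · have := hP2 w hw
    have : 0 ≤ (ℓ + M) * ‖w‖ ^ 2 := by positivity
    linarith
  · have h1 := (abs_le.1 (hℓ t (q + w) q (by linarith))).2
    rw [add_sub_cancel_left] at h1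
    have h2 := (abs_le.1 (abs_real_inner_le_norm P w)).1
    have h3 : ‖P‖ * ‖w‖ ≤ M * ‖w‖ := by gcongr
    have h4 : ‖w‖ ≤ ‖w‖ ^ 2 := by nlinarith
    have h5 : 0 ≤ K * ‖w‖ ^ 2 := by positivity
    nlinarith
end chains

section hj
variable {d : ℕ} {H : Phase d → ℝ} {av : ℝ} {u : Euc d → ℝ}

lemma c1_taylor (hu : ContDiff ℝ 1 u) {x y : Euc d} {η : ℝ}
    (h : ∀ z ∈ segment ℝ x y, ‖gradient u z - gradient u x‖ ≤ η) :
    |u y - u x - ⟪gradient u x, y - x⟫| ≤ η * ‖y - x‖ := by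
  have := (convex_segment x y).norm_image_sub_le_of_norm_hasFDerivWithin_le' (f := u)
    (f' := fun z => innerSL ℝ (gradient u z)) (φ := innerSL ℝ (gradient u x)) (C := η)
    (fun z _ => ((hu.differentiable one_ne_zero z).hasGradientAt.hasFDerivAt).hasFDerivWithinAt)
    (fun z hz => by
      rw [← map_sub, innerSL_apply_norm]; exact h z hz)
    (left_mem_segment ℝ x y) (right_mem_segment ℝ x y)
  simpa using this

lemma continuous_grad (hu : ContDiff ℝ 1 u) : Continuous (gradient u) := by
  have := hu.continuous_fderiv one_ne_zero
  unfold gradient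
  exact (InnerProductSpace.toDual ℝ (Euc d)).symm.continuous.comp this

lemma per_grad (hp : PerFun u) : PerFun (gradient u) := by
  intro k x
  unfold gradient
  congr 1
  have : (fun y => u (y + intVec k)) = u := funext fun y => hp k y
  rw [← fderiv_comp_add_right, this]

lemma grad_uc (hu : ContDiff ℝ 1 u) (hp : PerFun u) (ε : ℝ) (hε : 0 < ε) : ∃ C : ℝ, 0 ≤ C ∧
    ∀ x y, |u y - u x - ⟪gradient u x, y - x⟫| ≤ (ε + C * ‖y - x‖ ^ 2) * ‖y - x‖ := by
  have hc := continuous_grad hu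
  obtain ⟨C, hC0, hC⟩ := per_uc (F := fun z : Phase d => gradient u z.1) (by fun_prop)
    (fun k q p => per_grad hp k q) 0 ε hε
  refine ⟨C, hC0, fun x y => c1_taylor hu fun z hz => ?_⟩
  have h1 := hC (z, 0) (x, 0) (by simp) (by simp)
  refine h1.trans ?_
  have : ‖((z, 0) : Phase d) - (x, 0)‖ ≤ ‖y - x‖ := by
    simp only [Prod.mk_sub_mk, sub_self, Prod.norm_mk, norm_zero]
    rw [max_eq_left (norm_nonneg _)]
    have := norm_sub_le_of_mem_segment hz
    simpa [norm_sub_rev] using this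
  gcongr

lemma HJ (hH : TonelliHam H) (hu : ContDiff ℝ 1 u) (h : SG H av (fun _ => u)) (q : Euc d) :
    H (q, gradient u q) = av := by
  have hp := h.per 0 le_rfl
  refine le_antisymm ?_ ?_
  · set v := Hp H (q, gradient u q) with hv
    obtain ⟨C, hC0, hC⟩ := h.step_le hH ‖v‖
    have hL := leg_Hp hH q (gradient u q)
    rw [← hv] at hL
    refine le_of_forall_pos_le_add fun ε hε => ?_
    obtain ⟨C', hC0', hC'⟩ := grad_uc hu hp (ε / (2 * (‖v‖ + 1))) (by positivity)
    -- choose δ small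
    have hlim : Tendsto (fun δ : ℝ => C * δ + (ε / (2 * (‖v‖ + 1)) + C' * (δ * ‖v‖) ^ 2) * ‖v‖)
        (nhdsWithin 0 (Ioi 0)) (nhds (C * 0 + (ε / (2 * (‖v‖ + 1)) + C' * (0 * ‖v‖) ^ 2) * ‖v‖)) := by
      refine Tendsto.mono_left ?_ nhdsWithin_le_nhds
      exact Continuous.tendsto (by fun_prop) 0
    have hlt : C * 0 + (ε / (2 * (‖v‖ + 1)) + C' * (0 * ‖v‖) ^ 2) * ‖v‖ < ε := by
      have : ε / (2 * (‖v‖ + 1)) * ‖v‖ < ε := by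
        rw [div_mul_eq_mul_div, div_lt_iff₀ (by positivity)]
        nlinarith [norm_nonneg v]
      simpa using this
    obtain ⟨δ, h1, h2⟩ := ((hlim.eventually (gt_mem_nhds hlt)).and
      (Ioc_mem_nhdsGT (show (0:ℝ) < 1 by norm_num))).exists
    have h3 := hC 0 δ q v le_rfl h2.1.le h2.2 le_rfl
    have h4 := (abs_le.1 (hC' q (q - δ • v))).2
    simp only [sub_sub_cancel_left, inner_neg_right, inner_smul_right, norm_neg, norm_smul,
      Real.norm_of_nonneg h2.1.le] at h4
    rw [hL] at h3
    have hδ := h2.1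
    have : δ * (H (q, gradient u q) - av - ε) ≤ 0 := by
      have := mul_le_mul_of_nonneg_left h1.le hδ.le
      nlinarith
    have := nonpos_of_mul_nonpos_right this hδ
    linarith
  · obtain ⟨R, C, hR0, hC0, hC⟩ := h.step_ge hH
    refine le_of_forall_pos_le_add fun ε hε => ?_
    obtain ⟨C', hC0', hC'⟩ := grad_uc hu hp (ε / (2 * (R + 1))) (by positivity)
    have hlim : Tendsto (fun δ : ℝ => C * δ + (ε / (2 * (R + 1)) + C' * (δ * R) ^ 2) * R)
        (nhdsWithin 0 (Ioi 0)) (nhds (C * 0 + (ε / (2 * (R + 1)) + C' * (0 * R) ^ 2) * R)) := by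
      refine Tendsto.mono_left ?_ nhdsWithin_le_nhds
      exact Continuous.tendsto (by fun_prop) 0
    have hlt : C * 0 + (ε / (2 * (R + 1)) + C' * (0 * R) ^ 2) * R < ε := by
      have : ε / (2 * (R + 1)) * R < ε := by
        rw [div_mul_eq_mul_div, div_lt_iff₀ (by positivity)]
        nlinarith
      simpa using this
    obtain ⟨δ, h1, h2⟩ := ((hlim.eventually (gt_mem_nhds hlt)).and
      (Ioc_mem_nhdsGT (show (0:ℝ) < 1 by norm_num))).exists
    have hδ : 0 < δ := h2.1
    obtain ⟨v, hv, h3⟩ := hC 1 δ q le_rfl h2.1 h2.2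
    have h4 := (abs_le.1 (hC' q (q - δ • v))).1
    simp only [sub_sub_cancel_left, inner_neg_right, inner_smul_right, norm_neg, norm_smul,
      Real.norm_of_nonneg h2.1.le] at h4
    have h5 := fenchel hH q v (gradient u q)
    have h6 : (ε / (2 * (R + 1)) + C' * (δ * ‖v‖) ^ 2) * (δ * ‖v‖) ≤
      (ε / (2 * (R + 1)) + C' * (δ * R) ^ 2) * (δ * R) := by gcongr
    have : δ * (av - H (q, gradient u q) - ε) ≤ 0 := by
      have := mul_le_mul_of_nonneg_left h1.le hδ.le
      have := mul_le_mul_of_nonneg_left h5 hδ.le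
      nlinarith
    have := nonpos_of_mul_nonpos_right this hδ
    linarith
end hj


section c11
variable {d : ℕ} {H : Phase d → ℝ} {av : ℝ} {u : Euc d → ℝ}

lemma superdiff_unique {g p q : Euc d} {K : ℝ} (hg : HasGradientAt u g q)
    (h : ∀ w, ‖w‖ ≤ 1 → u (q + w) ≤ u q + ⟪p, w⟫ + K * ‖w‖ ^ 2) : p = g := by
  set F : Euc d → ℝ := fun y => (⟪p, y - q⟫ + K * ‖y - q‖ ^ 2) - u y with hF
  have hmin : IsLocalMin F q := by
    filter_upwards [closedBall_mem_nhds q one_pos] with y hy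
    have := h (y - q) (by rwa [mem_closedBall, dist_eq_norm] at hy)
    rw [add_sub_cancel] at this
    simp only [hF, sub_self, inner_zero_right, norm_zero]
    linarith
  have h1 : HasFDerivAt (fun y : Euc d => y - q) (ContinuousLinearMap.id ℝ (Euc d)) q :=
    (hasFDerivAt_id q).sub_const q
  have h2 : HasFDerivAt (fun y : Euc d => ⟪p, y - q⟫) (innerSL ℝ p) q := by
    have := (innerSL ℝ p).hasFDerivAt.comp q h1
    rwa [ContinuousLinearMap.comp_id] at this
  have h3 : HasFDerivAt (fun y : Euc d => K * ‖y - q‖ ^ 2) (0 : Euc d →L[ℝ] ℝ) q := by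
    have := (h1.norm_sq).const_mul K
    simpa using this
  have h4 := (h2.add h3).sub hg.hasFDerivAt
  have h5 := hmin.hasFDerivAt_eq_zero h4
  rw [add_zero, sub_eq_zero] at h5
  refine ext_inner_right ℝ fun v => ?_
  have := DFunLike.congr_fun h5 v
  simpa using this

/-- the vector field of the graph -/
def Xu (H : Phase d → ℝ) (u : Euc d → ℝ) (x : Euc d) : Euc d := Hp H (x, gradient u x)

lemma grad_bdd (hu : ContDiff ℝ 1 u) (hp : PerFun u) : ∃ M : ℝ, 0 ≤ M ∧ ∀ x, ‖gradient u x‖ ≤ M := by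
  have hc := continuous_grad hu
  obtain ⟨C, hC0, hC⟩ := per_bdd (F := fun z : Phase d => gradient u z.1) (by fun_prop)
    (fun k q p => per_grad hp k q) 0
  exact ⟨C, hC0, fun x => hC x 0 (by simp)⟩

lemma Xu_bdd (hH : TonelliHam H) (hu : ContDiff ℝ 1 u) (hp : PerFun u) :
    ∃ M : ℝ, 0 ≤ M ∧ ∀ x, ‖Xu H u x‖ ≤ M := by
  obtain ⟨M, hM0, hM⟩ := grad_bdd hu hp
  obtain ⟨C, hC0, hC⟩ := per_bdd (contDiff_Hp hH.smooth).continuous (per_Hp hH) M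
  exact ⟨C, hC0, fun x => hC x _ (hM x)⟩

lemma L_shift (hH : TonelliHam H) (R : ℝ) (hR : 0 ≤ R) : ∃ C : ℝ, 0 ≤ C ∧ ∀ x v δ, ‖v‖ ≤ R → 0 ≤ δ → δ ≤ 1 →
    |LegendreL H (x + δ • v, v) - LegendreL H (x, v)| ≤ C * δ := by
  obtain ⟨K, hK0, hK⟩ := taylor1 hH R
  obtain ⟨M, hM0, hM⟩ := per_bdd (contDiff_gradL hH).continuous (per_gradL hH) R
  refine ⟨2 * M * R + K * R ^ 2, by positivity, fun x v δ hv hδ hδ1 => ?_⟩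
  have h1 := hK (x, v) (δ • v, 0) hv (by simpa using hv)
  have h3 := pair_le (gradL hH (x, v)) (δ • v, 0)
  have h4 : ‖((δ • v, 0) : Phase d)‖ ≤ δ * R := by
    simp only [Prod.norm_mk, norm_zero]
    rw [max_eq_left (norm_nonneg _), norm_smul, Real.norm_of_nonneg hδ]
    gcongr
  have h2 := hM x v hv
  have h5 : 2 * ‖gradL hH (x, v)‖ * ‖((δ • v, 0) : Phase d)‖ ≤ 2 * M * (δ * R) := by
    gcongr
  have h6 : K * ‖((δ • v, 0) : Phase d)‖ ^ 2 ≤ K * (δ * R) ^ 2 := by gcongr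
  have h7 : K * (δ * R) ^ 2 ≤ K * R ^ 2 * δ := by
    have : δ ^ 2 ≤ δ := by nlinarith
    calc K * (δ * R) ^ 2 = K * R ^ 2 * δ ^ 2 := by ring
      _ ≤ _ := by gcongr
  simp only [Prod.mk_add_mk, add_zero] at h1
  have h8 := abs_le.1 h1
  have h9 := abs_le.1 h3
  exact abs_le.2 ⟨by linarith, by linarith⟩

lemma semiconvex (hH : TonelliHam H) (hu : ContDiff ℝ 1 u) (h : SG H av (fun _ => u)) :
    ∃ K : ℝ, 0 ≤ K ∧ ∀ q w, ‖w‖ ≤ 1 → u q + ⟪gradient u q, w⟫ - K * ‖w‖ ^ 2 ≤ u (q + w) := by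
  have hp := h.per 0 le_rfl
  obtain ⟨R, hR0, hR⟩ := Xu_bdd hH hu hp
  obtain ⟨C, hC0, hC⟩ := h.chain_le hH (R + 1)
  obtain ⟨C1, hC10, hC1⟩ := L_shift hH R hR0
  obtain ⟨K, M, hK0, hM0, hK⟩ := sum_taylor (av := av) hH R
  refine ⟨K, hK0, fun q => ?_⟩
  obtain ⟨P, hP1, hP2⟩ : ∃ P : Euc d, ‖P‖ ≤ M ∧ ∀ w, ‖w‖ ≤ 1 →
      u q - u (q + w) ≤ ⟪P, w⟫ + K * ‖w‖ ^ 2 := by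
    apply compact_grad
    intro η hη
    obtain ⟨C2, hC20, hC2⟩ := grad_uc hu hp (η / (2 * (R + 1))) (by positivity)
    set D := C + C1 + C2 * R ^ 3 with hD
    have hD0 : 0 ≤ D := by positivity
    obtain ⟨n, hn⟩ := exists_nat_gt (2 * D / η)
    set δ : ℝ := 1 / ((n : ℝ) + 1) with hδ
    have hδ0 : 0 < δ := by positivity
    have hδ1 : δ ≤ 1 := by rw [hδ, div_le_one (by positivity)]; linarith [n.cast_nonneg (α := ℝ)]
    have hN : ((n + 1 : ℕ) : ℝ) * δ = 1 := by rw [hδ]; push_cast; field_simp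
    have hDδ : D * δ ≤ η / 2 := by
      rw [hδ, mul_one_div, div_le_iff₀ (by positivity)]
      rw [div_lt_iff₀ hη] at hn
      nlinarith
    set y : ℕ → Euc d := fun k => (fun x => x + δ • Xu H u x)^[n + 1 - k] q with hy
    have hyk : ∀ k < n + 1, y k = y (k + 1) + δ • Xu H u (y (k + 1)) := by
      intro k hk
      simp only [hy]
      rw [show n + 1 - k = (n + 1 - (k + 1)) + 1 by omega, Function.iterate_succ_apply']
    have hV : ∀ k < n + 1, δ⁻¹ • (y k - y (k + 1)) = Xu H u (y (k + 1)) := by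
      intro k hk
      rw [hyk k hk, add_sub_cancel_left, inv_smul_smul₀ hδ0.ne']
    have hyN : y (n + 1) = q := by simp [hy]
    obtain ⟨P, hP, hP'⟩ := hK δ (n + 1) y (fun k => k * δ) hδ0 hN
      (fun k hk => by rw [hV k hk]; exact hR _) (fun k hk => by
        have : (k : ℝ) * δ ≤ (n + 1 : ℕ) * δ := by gcongr
        rw [hN] at this
        have : 0 ≤ (k : ℝ) * δ := by positivity
        exact abs_le.2 ⟨by linarith, by linarith⟩) (fun k hk => by
        push_cast
        rw [show (k : ℝ) * δ - (k + 1) * δ = -δ by ring, abs_neg, abs_of_pos hδ0])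
    refine ⟨P, hP, fun w hw => ?_⟩
    obtain ⟨h1, h2⟩ := hP' w hw
    have h3 := hC 1 δ (n + 1) (fun k => y k + (k * δ) • w) (by rw [hN]; linarith) hδ0 hδ1 h1
    simp only [hN] at h3
    simp only [CharP.cast_eq_zero, zero_mul, one_smul, zero_smul, add_zero, hyN] at h3
    have h4 : ∑ k ∈ Finset.range (n + 1), δ * (LegendreL H (y k, δ⁻¹ • (y k - y (k + 1))) + av) ≤
        u (y 0) - u q + (η / 2 + (C1 + C2 * R ^ 3) * δ) := by
      calc _ ≤ ∑ k ∈ Finset.range (n + 1), ((u (y k) - u (y (k + 1))) +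
            δ * (η / 2 + (C1 + C2 * R ^ 3) * δ)) := by
            refine Finset.sum_le_sum fun k hk => ?_
            have hk := Finset.mem_range.1 hk
            rw [hV k hk, hyk k hk]
            set z := y (k + 1)
            have k1 := (abs_le.1 (hC1 z (Xu H u z) δ (hR z) hδ0.le hδ1)).2
            have k2 := leg_Hp hH z (gradient u z)
            rw [HJ hH hu h z] at k2
            have k3 := (abs_le.1 (hC2 z (z + δ • Xu H u z))).1
            rw [add_sub_cancel_left, inner_smul_right, norm_smul, Real.norm_of_nonneg hδ0.le] at k3
            have k4 : (η / (2 * (R + 1)) + C2 * (δ * ‖Xu H u z‖) ^ 2) * (δ * ‖Xu H u z‖) ≤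
              (η / (2 * (R + 1)) + C2 * (δ * R) ^ 2) * (δ * R) := by
              have := hR z
              gcongr
            have k5 : η / (2 * (R + 1)) * R ≤ η / 2 := by
              rw [div_mul_eq_mul_div, div_le_div_iff₀ (by positivity) (by positivity)]
              nlinarith
            have k6 : C2 * (δ * R) ^ 2 * R ≤ C2 * R ^ 3 * δ := by
              have : δ ^ 2 ≤ δ := by nlinarith
              calc _ = C2 * R ^ 3 * δ ^ 2 := by ring
                _ ≤ _ := by gcongr
            change LegendreL H (z, Xu H u z) = ⟪gradient u z, Xu H u z⟫ - av at k2
            have k7 : δ * (LegendreL H (z + δ • Xu H u z, Xu H u z) + av) ≤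
                δ * (⟪gradient u z, Xu H u z⟫ + C1 * δ) := by
              refine mul_le_mul_of_nonneg_left ?_ hδ0.le
              linarith
            have k8 : (η / (2 * (R + 1)) + C2 * (δ * R) ^ 2) * (δ * R) ≤
                δ * (η / 2 + C2 * R ^ 3 * δ) := by
              calc _ = δ * (η / (2 * (R + 1)) * R + C2 * (δ * R) ^ 2 * R) := by ring
                _ ≤ _ := by gcongr
            linarith
        _ = _ := by
            rw [Finset.sum_add_distrib, Finset.sum_range_sub' (fun k => u (y k)), hyN,
              Finset.sum_const, Finset.card_range, nsmul_eq_mul, ← mul_assoc, hN, one_mul]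
    have : D * δ = C * δ + (C1 + C2 * R ^ 3) * δ := by rw [hD]; ring
    linarith
  have hP3 : P = -gradient u q := by
    have hg := (hu.differentiable one_ne_zero q).hasGradientAt
    have hg' : HasGradientAt (fun x => -u x) (-gradient u q) q := by
      have h0 := hg.hasFDerivAt.neg
      rw [hasGradientAt_iff_hasFDerivAt, map_neg]; exact h0
    refine superdiff_unique (K := K) hg' fun w hw => ?_
    have := hP2 w hw
    linarith
  intro w hw
  have := hP2 w hw
  rw [hP3, inner_neg_left] at this
  linarith

lemma C11 (hH : TonelliHam H) (hu : ContDiff ℝ 1 u) (h : SG H av (fun _ => u)) :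
    ∃ K : ℝ, 0 ≤ K ∧ ∀ q w, |u (q + w) - u q - ⟪gradient u q, w⟫| ≤ K * ‖w‖ ^ 2 := by
  obtain ⟨K, hK0, hK⟩ := semiconvex hH hu h
  obtain ⟨K', M, hK0', hM0, hK'⟩ := h.semiconcave hH
  obtain ⟨ℓ, hℓ0, hℓ⟩ := h.lip hH
  obtain ⟨M', hM0', hM'⟩ := grad_bdd hu (h.per 0 le_rfl)
  refine ⟨K + K' + ℓ + M', by positivity, fun q w => ?_⟩
  have hw2 : 0 ≤ ‖w‖ ^ 2 := by positivity
  rcases le_or_gt ‖w‖ 1 with hw | hw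
  · obtain ⟨p, hp1, hp2⟩ := hK' 2 q le_rfl
    have := superdiff_unique (hu.differentiable one_ne_zero q).hasGradientAt (fun w _ => hp2 w)
    subst this
    have h1 := hp2 w
    have h2 := hK q w hw
    exact abs_le.2 ⟨by nlinarith, by nlinarith⟩
  · have h1 := abs_le.1 (hℓ 1 (q + w) q le_rfl)
    rw [add_sub_cancel_left] at h1
    have h2 := abs_le.1 (abs_real_inner_le_norm (gradient u q) w)
    have h3 : ‖gradient u q‖ * ‖w‖ ≤ M' * ‖w‖ := by have := hM' q; gcongr
    have h4 : ‖w‖ ≤ ‖w‖ ^ 2 := by nlinarith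
    have h5 : M' * ‖w‖ ≤ M' * ‖w‖ ^ 2 := by gcongr
    have h6 : ℓ * ‖w‖ ≤ ℓ * ‖w‖ ^ 2 := by gcongr
    have h7 : 0 ≤ (K + K') * ‖w‖ ^ 2 := by positivity
    exact abs_le.2 ⟨by linarith, by linarith⟩

lemma grad_lip (hH : TonelliHam H) (hu : ContDiff ℝ 1 u) (h : SG H av (fun _ => u)) :
    ∃ K : ℝ, 0 ≤ K ∧ ∀ x y, ‖gradient u x - gradient u y‖ ≤ K * ‖x - y‖ := by
  obtain ⟨K, hK0, hK⟩ := C11 hH hu h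
  refine ⟨6 * K, by positivity, fun x y => ?_⟩
  set D := gradient u x - gradient u y with hD
  rcases eq_or_ne D 0 with h0 | h0
  · rw [h0, norm_zero]; positivity
  have hDp : 0 < ‖D‖ := norm_pos_iff.2 h0
  set w : Euc d := (‖x - y‖ / ‖D‖) • D with hw
  have hwn : ‖w‖ = ‖x - y‖ := by
    rw [hw, norm_smul, Real.norm_of_nonneg (by positivity)]; field_simp
  have h1 := abs_le.1 (hK x w)
  have h2 := abs_le.1 (hK y (x - y + w))
  have h3 := abs_le.1 (hK y (x - y))
  rw [show y + (x - y + w) = x + w by abel, inner_add_right] at h2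
  rw [add_sub_cancel] at h3
  have h4 : ⟪gradient u x, w⟫ - ⟪gradient u y, w⟫ = ‖x - y‖ * ‖D‖ := by
    rw [← inner_sub_left, ← hD, hw, inner_smul_right, real_inner_self_eq_norm_sq]
    field_simp
  have h5 : ‖x - y + w‖ ≤ 2 * ‖x - y‖ := by
    refine (norm_add_le _ _).trans ?_; rw [hwn]; linarith
  have h6 : K * ‖x - y + w‖ ^ 2 ≤ K * (2 * ‖x - y‖) ^ 2 := by gcongr
  rw [hwn] at h1
  rcases eq_or_ne x y with hxy | hxy
  · exfalso; apply h0; rw [hD, hxy, sub_self]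
  have hp : 0 < ‖x - y‖ := norm_pos_iff.2 (sub_ne_zero.2 hxy)
  have : ‖x - y‖ * ‖D‖ ≤ ‖x - y‖ * (6 * K * ‖x - y‖) := by nlinarith
  exact le_of_mul_le_mul_left this hp

lemma Xu_lip (hH : TonelliHam H) (hu : ContDiff ℝ 1 u) (h : SG H av (fun _ => u)) :
    ∃ K : ℝ, 0 ≤ K ∧ ∀ x y, ‖Xu H u x - Xu H u y‖ ≤ K * ‖x - y‖ := by
  obtain ⟨K, hK0, hK⟩ := grad_lip hH hu h
  obtain ⟨M, hM0, hM⟩ := grad_bdd hu (h.per 0 le_rfl)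
  obtain ⟨C, hC0, hC⟩ := per_lip (contDiff_Hp hH.smooth) (per_Hp hH) M
  refine ⟨C * (1 + K), by positivity, fun x y => ?_⟩
  have h1 := hC (x, gradient u x) (y, gradient u y) (hM x) (hM y)
  have h2 : ‖((x, gradient u x) : Phase d) - (y, gradient u y)‖ ≤ (1 + K) * ‖x - y‖ := by
    rw [Prod.mk_sub_mk, Prod.norm_mk]
    have h3 : 0 ≤ K * ‖x - y‖ := by positivity
    have h4 := hK x y
    have := norm_nonneg (x - y)
    refine max_le ?_ ?_
    · linarith
    · linarith
  calc ‖Xu H u x - Xu H u y‖ ≤ C * ‖((x, gradient u x) : Phase d) - (y, gradient u y)‖ := h1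
    _ ≤ C * ((1 + K) * ‖x - y‖) := mul_le_mul_of_nonneg_left h2 hC0
    _ = _ := by ring
end c11


section orbits
variable {d : ℕ} {H : Phase d → ℝ} {av : ℝ} {u : Euc d → ℝ}

lemma contDiff_XH (hs : ContDiff ℝ 2 H) : ContDiff ℝ 1 (hamVF H 0) := by
  have : hamVF H 0 = fun z => (Hp H z, -Hq H z) := funext (hamVF_eq hs)
  rw [this]
  exact (contDiff_Hp hs).prodMk (contDiff_Hq hs).neg

lemma per_XH (hH : TonelliHam H) : PerPhase (hamVF H 0) := by
  intro k q p
  rw [hamVF_eq hH.smooth, hamVF_eq hH.smooth, per_Hp hH, per_Hq hH]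

lemma energy (hH : TonelliHam H) {φ : ℝ → Phase d → Phase d} (hφ : IsConformalFlow H 0 φ)
    (z : Phase d) (t : ℝ) : H (φ t z) = H z := by
  have hd : ∀ τ, HasDerivAt (fun τ => H (φ τ z)) 0 τ := by
    intro τ
    have h1 := ((hH.smooth.differentiable two_ne_zero) (φ τ z)).hasFDerivAt.comp_hasDerivAt τ
      (hφ.2.2 z τ)
    rw [fderiv_split, hamVF_eq hH.smooth] at h1
    simp only [inner_neg_right] at h1
    rw [real_inner_comm, add_neg_cancel] at h1
    exact h1
  have := is_const_of_deriv_eq_zero (fun τ => (hd τ).differentiableAt) (fun τ => (hd τ).deriv) t 0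
  rw [this, hφ.1]

lemma strip_of_energy (hH : TonelliHam H) (E : ℝ) : ∃ M : ℝ, 0 ≤ M ∧ ∀ z : Phase d, H z ≤ E → ‖z.2‖ ≤ M := by
  obtain ⟨B, hB⟩ := hH.superlinear 1
  refine ⟨|E - B|, abs_nonneg _, fun z hz => ?_⟩
  have := hB z.1 z.2
  have := le_abs_self (E - B)
  have h3 : H (z.1, z.2) ≤ E := hz
  linarith

lemma lin_le {J : Euc d} {a C : ℝ} (ha : 0 ≤ a) (h : ∀ w, ⟪J, w⟫ ≤ a * ‖w‖ + C * ‖w‖ ^ 2) :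
    ‖J‖ ≤ a := by
  rcases eq_or_ne J 0 with h0 | h0
  · simpa [h0] using ha
  have hJ : 0 < ‖J‖ := norm_pos_iff.2 h0
  have hlim : Tendsto (fun s : ℝ => a + C * s * ‖J‖) (nhdsWithin 0 (Ioi 0)) (nhds (a + C * 0 * ‖J‖)) :=
    Tendsto.mono_left (Continuous.tendsto (by fun_prop) 0) nhdsWithin_le_nhds
  simp only [mul_zero, zero_mul, add_zero] at hlim
  refine ge_of_tendsto hlim ?_
  filter_upwards [self_mem_nhdsWithin] with s hs
  have hs : 0 < s := hs
  have h1 := h (s • J)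
  rw [inner_smul_right, real_inner_self_eq_norm_sq, norm_smul, Real.norm_of_nonneg hs.le] at h1
  have : (s * ‖J‖) * ‖J‖ ≤ (s * ‖J‖) * (a + C * s * ‖J‖) := by nlinarith
  exact le_of_mul_le_mul_left this (by positivity)

lemma grad_curve (hH : TonelliHam H) (hu : ContDiff ℝ 1 u) (h : SG H av (fun _ => u))
    {γ : ℝ → Euc d} {a b : ℝ} (hγ : ∀ τ ∈ Ioo a b, HasDerivAt γ (Xu H u (γ τ)) τ) :
    ∀ τ ∈ Ioo a b, HasDerivAt (fun τ => gradient u (γ τ)) (-Hq H (γ τ, gradient u (γ τ))) τ := by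
  obtain ⟨K, hK0, hK⟩ := C11 hH hu h
  obtain ⟨R, hR0, hR⟩ := Xu_bdd hH hu (h.per 0 le_rfl)
  obtain ⟨K', hK0', hK'⟩ := taylor1 hH R
  have hcg := continuous_grad hu
  set c : ℝ → Euc d := fun τ => -Hq H (γ τ, gradient u (γ τ)) with hc
  intro τ0 hτ0
  have hcc : ContinuousAt c τ0 := by
    have h1 := (hγ τ0 hτ0).continuousAt
    have h2 := (contDiff_Hq hH.smooth).continuous
    have h3 : Continuous fun x => -Hq H (x, gradient u x) := by fun_prop
    exact h3.continuousAt.comp h1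
  rw [hasDerivAt_iff_isLittleO, Asymptotics.isLittleO_iff]
  intro ε hε
  obtain ⟨r, hr, hr'⟩ := Metric.mem_nhds_iff.1 (inter_mem (isOpen_Ioo.mem_nhds hτ0)
    (hcc.preimage_mem_nhds (closedBall_mem_nhds _ hε)))
  -- the key inequality
  have key : ∀ τ ∈ ball τ0 r, ∀ σ ∈ ball τ0 r, τ ≤ σ →
      ‖gradient u (γ σ) - gradient u (γ τ) - (σ - τ) • c τ0‖ ≤ ε * (σ - τ) := by
    intro τ hτ σ hσ hle
    refine lin_le (C := 2 * K + K' * (σ - τ)) (mul_nonneg hε.le (by linarith)) fun w => ?_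
    have hd : ∀ x ∈ ball τ0 r, HasDerivAt (fun τ => u (γ τ + w) - u (γ τ))
        (⟪gradient u (γ x + w), Xu H u (γ x)⟫ - ⟪gradient u (γ x), Xu H u (γ x)⟫) x := by
      intro x hx
      have h1 := hγ x (hr' hx).1
      have e1 := ((hu.differentiable one_ne_zero (γ x + w)).hasGradientAt.hasFDerivAt).comp_hasDerivAt
        x (h1.add_const w)
      have e2 := ((hu.differentiable one_ne_zero (γ x)).hasGradientAt.hasFDerivAt).comp_hasDerivAt x h1
      exact e1.sub e2
    have hle' := (convex_ball τ0 r).image_sub_le_mul_sub_of_deriv_le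
      (fun x hx => (hd x hx).continuousAt.continuousWithinAt)
      (fun x hx => (hd x (interior_subset hx)).differentiableAt.differentiableWithinAt)
      (C := ⟪c τ0, w⟫ + ε * ‖w‖ + K' * ‖w‖ ^ 2) (fun x hx => by
        have hx := interior_subset hx
        rw [(hd x hx).deriv]
        have f1 := fenchel hH (γ x + w) (Xu H u (γ x)) (gradient u (γ x + w))
        rw [HJ hH hu h] at f1
        have f2 := leg_Hp hH (γ x) (gradient u (γ x))
        rw [HJ hH hu h] at f2
        change LegendreL H (γ x, Xu H u (γ x)) = ⟪gradient u (γ x), Xu H u (γ x)⟫ - av at f2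
        have f3 := (abs_le.1 (hK' (γ x, Xu H u (γ x)) (w, 0) (hR _) (by simpa using hR _))).2
        have f4 : gradL hH (γ x, Xu H u (γ x)) = (c x, gradient u (γ x)) := by
          have : Pm hH (γ x, Xu H u (γ x)) = gradient u (γ x) := Pm_Hp hH _ _
          simp only [gradL, this, hc]
        have f5 : ‖((w, 0) : Phase d)‖ = ‖w‖ := by
          simp [Prod.norm_mk]
        rw [f4, f5] at f3
        simp only [Prod.mk_add_mk, add_zero, pair, inner_zero_right] at f3
        have f6 : ‖c x - c τ0‖ ≤ ε := by
          have := (hr' hx).2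
          rwa [mem_preimage, mem_closedBall, dist_eq_norm] at this
        have f7 : ⟪c x - c τ0, w⟫ ≤ ε * ‖w‖ :=
          (real_inner_le_norm _ _).trans (by gcongr)
        rw [inner_sub_left] at f7
        rw [real_inner_comm] at f1
        rw [real_inner_comm]
        rw [real_inner_comm] at f2
        linarith [real_inner_comm (gradient u (γ x)) (Xu H u (γ x)),
          real_inner_comm (gradient u (γ x + w)) (Xu H u (γ x))]) τ hτ σ hσ hle
    have h1 := (abs_le.1 (hK (γ σ) w)).1
    have h2 := (abs_le.1 (hK (γ τ) w)).2
    rw [inner_sub_left, inner_sub_left, inner_smul_left]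
    simp only [RCLike.conj_to_real]
    nlinarith
  filter_upwards [ball_mem_nhds τ0 hr] with τ hτ
  rcases le_total τ0 τ with hle | hle
  · have := key τ0 (mem_ball_self hr) τ hτ hle
    rwa [Real.norm_of_nonneg (by linarith)]
  · have := key τ hτ τ0 (mem_ball_self hr) hle
    rw [norm_sub_rev τ τ0, Real.norm_of_nonneg (by linarith)]
    have e : gradient u (γ τ) - gradient u (γ τ0) - (τ - τ0) • c τ0
        = -(gradient u (γ τ0) - gradient u (γ τ) - (τ0 - τ) • c τ0) := by module
    rw [e, norm_neg]
    exact this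

lemma exists_curve (hH : TonelliHam H) (hu : ContDiff ℝ 1 u) (h : SG H av (fun _ => u))
    (θ : Euc d) (T : ℝ) (hT : 0 < T) : ∃ γ : ℝ → Euc d, γ 0 = θ ∧
      ∀ τ ∈ Ioo (-T) T, HasDerivAt γ (Xu H u (γ τ)) τ := by
  obtain ⟨R, hR0, hR⟩ := Xu_bdd hH hu (h.per 0 le_rfl)
  obtain ⟨K, hK0, hK⟩ := Xu_lip hH hu h
  have hpl : IsPicardLindelof (fun _ => Xu H u) (tmin := -T) (tmax := T)
      ⟨0, by constructor <;> linarith⟩ θ (⟨R * T, by positivity⟩ : NNReal) 0 ⟨R, hR0⟩ ⟨K, hK0⟩ := by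
    refine ⟨fun t _ => LipschitzOnWith.of_dist_le_mul fun x _ y _ => ?_, fun x _ => continuousOn_const,
      fun t _ x _ => hR x, ?_⟩
    · rw [dist_eq_norm, dist_eq_norm]; exact hK x y
    · simp only [sub_zero, zero_sub, neg_neg, max_self]
      show R * T ≤ R * T - 0
      rw [sub_zero]
  obtain ⟨γ, h0, h1⟩ := hpl.exists_eq_forall_mem_Icc_hasDerivWithinAt₀
  exact ⟨γ, h0, fun τ hτ => (h1 τ (Ioo_subset_Icc_self hτ)).hasDerivAt (Icc_mem_nhds hτ.1 hτ.2)⟩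

lemma graph_inv (hH : TonelliHam H) (hu : ContDiff ℝ 1 u) (h : SG H av (fun _ => u))
    {φ : ℝ → Phase d → Phase d} (hφ : IsConformalFlow H 0 φ) (θ : Euc d) (t : ℝ) :
    (φ t (θ, gradient u θ)).2 = gradient u (φ t (θ, gradient u θ)).1 := by
  obtain ⟨γ, h0, hγ⟩ := exists_curve hH hu h θ (|t| + 1) (by positivity)
  have hg := grad_curve hH hu h hγ
  obtain ⟨M, hM0, hM⟩ := strip_of_energy hH av
  obtain ⟨K, hK0, hK⟩ := per_lip (contDiff_XH hH.smooth) (per_XH hH) M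
  have := ODE_solution_unique_of_mem_Ioo (v := fun _ => hamVF H 0)
    (s := fun _ => {z : Phase d | ‖z.2‖ ≤ M}) (K := ⟨K, hK0⟩) (t₀ := 0)
    (f := fun τ => φ τ (θ, gradient u θ)) (g := fun τ => (γ τ, gradient u (γ τ)))
    (a := -(|t| + 1)) (b := |t| + 1)
    (fun t _ => LipschitzOnWith.of_dist_le_mul fun x hx y hy => by
      rw [dist_eq_norm, dist_eq_norm]; exact hK x y hx hy)
    (by constructor <;> linarith [abs_nonneg t])
    (fun τ _ => ⟨hφ.2.2 _ τ, hM _ (by rw [energy hH hφ, HJ hH hu h])⟩)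
    (fun τ hτ => ⟨by
      rw [hamVF_eq hH.smooth]
      exact (hγ τ hτ).prodMk (hg τ hτ), hM _ (by rw [HJ hH hu h])⟩)
    (by simp only [hφ.1, h0])
  have := this (x := t) (by constructor <;> linarith [neg_abs_le t, le_abs_self t])
  simp only at this
  rw [this]
end orbits


lemma disc_gronwall {K δ : ℝ} (hK : 0 ≤ K) (hδ : 0 ≤ δ) {D e : ℕ → ℝ} {N : ℕ} (h0 : D 0 ≤ 0)
    (he : ∀ k, 0 ≤ e k) (h : ∀ k < N, D (k+1) ≤ (1 + K * δ) * D k + e k) :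
    ∀ k ≤ N, D k ≤ Real.exp (K * (k * δ)) * ∑ j ∈ Finset.range k, e j := by
  intro k
  induction k with
  | zero => intro _; simpa using h0
  | succ k ih =>
    intro hk
    have h1 := ih (by omega)
    have h2 := h k (by omega)
    have h3 : Real.exp (K * ((k+1 : ℕ) * δ)) = Real.exp (K * δ) * Real.exp (K * (k * δ)) := by
      rw [← Real.exp_add]; push_cast; ring_nf
    have h4 : 1 + K * δ ≤ Real.exp (K * δ) := by
      have := Real.add_one_le_exp (K * δ); linarith
    have h5 : 1 ≤ Real.exp (K * ((k+1 : ℕ) * δ)) := Real.one_le_exp (by positivity)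
    rw [Finset.sum_range_succ, mul_add, h3]
    rw [h3] at h5
    have h6 : 0 ≤ Real.exp (K * (k * δ)) * ∑ j ∈ Finset.range k, e j :=
      mul_nonneg (Real.exp_pos _).le (Finset.sum_nonneg fun j _ => he j)
    have h7 : (1 + K * δ) * D k ≤ (1 + K * δ) * (Real.exp (K * (k * δ)) * ∑ j ∈ Finset.range k, e j) :=
      mul_le_mul_of_nonneg_left h1 (by positivity)
    have h8 := mul_le_mul_of_nonneg_right h4 h6
    have h9 := mul_le_mul_of_nonneg_right h5 (he k)
    nlinarith

/-- Uniform first order Taylor expansion for `C¹` curves. -/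
lemma unif_taylor {E : Type*} [NormedAddCommGroup E] [NormedSpace ℝ E] {f f' : ℝ → E}
    (hf : ∀ τ, HasDerivAt f (f' τ) τ) (hc : Continuous f') (T ε : ℝ) (hε : 0 < ε) :
    ∃ δ0, 0 < δ0 ∧ ∀ τ ∈ Icc (-T) 0, ∀ δ, 0 < δ → δ ≤ δ0 → ‖f τ - f (τ - δ) - δ • f' τ‖ ≤ ε * δ := by
  have huc : UniformContinuousOn f' (Icc (-T-1) 0) :=
    isCompact_Icc.uniformContinuousOn_of_continuous hc.continuousOn
  rw [Metric.uniformContinuousOn_iff_le] at huc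
  obtain ⟨δ0, hδ0, h⟩ := huc ε hε
  refine ⟨min δ0 1, by positivity, fun τ hτ δ hδ hδ' => ?_⟩
  have hd1 : δ ≤ δ0 := hδ'.trans (min_le_left _ _)
  have hd2 : δ ≤ 1 := hδ'.trans (min_le_right _ _)
  have := Convex.norm_image_sub_le_of_norm_hasDerivWithin_le (𝕜 := ℝ)
    (f := fun s => f s - s • f' τ) (f' := fun s => f' s - (1:ℝ) • f' τ) (s := Icc (τ - δ) τ) (C := ε)
    (fun s _ => ((hf s).sub ((hasDerivAt_id s).smul_const (f' τ))).hasDerivWithinAt)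
    (fun s hs => by
      rw [one_smul, ← dist_eq_norm]
      refine h s ⟨?_, ?_⟩ τ ⟨?_, ?_⟩ ?_
      · linarith [hs.1, hτ.1]
      · linarith [hs.2, hτ.2]
      · linarith [hτ.1]
      · exact hτ.2
      · rw [Real.dist_eq, abs_le]; constructor <;> linarith [hs.1, hs.2])
    (convex_Icc _ _) (left_mem_Icc.2 (by linarith)) (right_mem_Icc.2 (by linarith))
  simp only [Real.norm_eq_abs, sub_sub_cancel, abs_of_pos hδ] at this
  convert this using 2
  module

lemma kδ_mem {T : ℝ} (hT : 0 < T) {N : ℕ} (hN : 0 < N) {k : ℕ} (hk : k ≤ N) :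
    -(k * (T / N)) ∈ Icc (-T) 0 := by
  have hN' : (0:ℝ) < N := by exact_mod_cast hN
  have hk' : (k:ℝ) ≤ N := by exact_mod_cast hk
  constructor
  · have : (k:ℝ) * (T / N) ≤ N * (T / N) := by gcongr
    rw [mul_div_cancel₀ _ hN'.ne'] at this
    linarith
  · have : 0 ≤ (k:ℝ) * (T / N) := by positivity
    linarith

lemma riemann {g g' : ℝ → ℝ} (hg : ∀ τ, HasDerivAt g (g' τ) τ) (hc : Continuous g') {T : ℝ} (hT : 0 < T)
    (ε : ℝ) (hε : 0 < ε) :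
    ∃ δ0, 0 < δ0 ∧ ∀ N : ℕ, 0 < N → T / N ≤ δ0 →
      ∑ k ∈ Finset.range N, (T / N) * g' (-(k * (T / N))) ≤ g 0 - g (-T) + ε * T := by
  obtain ⟨δ0, hδ0, h⟩ := unif_taylor hg hc T ε hε
  refine ⟨δ0, hδ0, fun N hN hδ => ?_⟩
  have hN' : (0:ℝ) < N := by exact_mod_cast hN
  set δ := T / N with hδd
  have hNδ : (N:ℝ) * δ = T := mul_div_cancel₀ _ hN'.ne'
  have h1 : ∀ k ∈ Finset.range N, δ * g' (-(k * δ)) ≤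
      (g (-((k:ℕ) * δ)) - g (-(((k+1 : ℕ) : ℝ) * δ))) + ε * δ := by
    intro k hk
    have h2 := h (-(k * δ)) (kδ_mem hT hN (Finset.mem_range.1 hk).le) δ (by positivity) hδ
    rw [Real.norm_eq_abs, smul_eq_mul] at h2
    have := (abs_le.1 h2).1
    have e : -(((k+1 : ℕ) : ℝ) * δ) = -(k * δ) - δ := by push_cast; ring
    rw [e]; linarith
  refine (Finset.sum_le_sum h1).trans ?_
  rw [Finset.sum_add_distrib, Finset.sum_range_sub' (fun k : ℕ => g (-((k:ℝ) * δ)))]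
  simp only [Finset.sum_const, Finset.card_range, nsmul_eq_mul, Nat.cast_zero, zero_mul, neg_zero, hNδ]
  have : (N:ℝ) * (ε * δ) = ε * T := by rw [← hNδ]; ring
  linarith

section close
variable {d : ℕ} {H : Phase d → ℝ} {av : ℝ} {u : Euc d → ℝ} {U : ℝ → Euc d → ℝ}

lemma quad_pert (A : Phase d →L[ℝ] Phase d) (W W' : Phase d) :
    pair (A W') W' ≤ pair (A W) W + 2 * ‖A‖ * ‖W' - W‖ * (‖W‖ + ‖W'‖) := by
  have e : pair (A W') W' - pair (A W) W = pair (A (W' - W)) W' + pair (A W) (W' - W) := by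
    rw [map_sub]
    simp only [pair, Prod.fst_sub, Prod.snd_sub, inner_sub_left, inner_sub_right]
    ring
  have h1 := (le_abs_self _).trans (pair_le (A (W' - W)) W')
  have h2 := (le_abs_self _).trans (pair_le (A W) (W' - W))
  have h3 := A.le_opNorm (W' - W)
  have h4 := A.le_opNorm W
  have h5 : 2 * ‖A (W' - W)‖ * ‖W'‖ ≤ 2 * (‖A‖ * ‖W' - W‖) * ‖W'‖ := by gcongr
  have h6 : 2 * ‖A W‖ * ‖W' - W‖ ≤ 2 * (‖A‖ * ‖W‖) * ‖W' - W‖ := by gcongr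
  nlinarith

set_option maxHeartbeats 1600000 in
lemma SG.close (h : SG H av U) (hH : TonelliHam H) (hu : ContDiff ℝ 1 u) (hs : SG H av (fun _ => u))
    {γ : ℝ → Euc d} (hγ : ∀ τ, HasDerivAt γ (Xu H u (γ τ)) τ) {T : ℝ} (hT : 0 < T) :
    ∃ R C : ℝ, 0 ≤ R ∧ 0 ≤ C ∧ ∀ (t κ : ℝ) (N : ℕ), 1 ≤ t - T → 0 < N → T / N ≤ 1 →
      (∀ x, |U t x - u x| ≤ κ) → (∀ x, |U (t - T) x - u x| ≤ κ) →
      ∃ y : ℕ → Euc d, y 0 = γ 0 ∧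
        (∀ k < N, ‖(T / N : ℝ)⁻¹ • (y k - y (k+1))‖ ≤ R) ∧
        U (t - T) (y N) + ∑ k ∈ Finset.range N,
          (T / N) * (LegendreL H (y k, (T / N : ℝ)⁻¹ • (y k - y (k+1))) + av) - C * (T / N) ≤ U t (γ 0) ∧
        ∑ k ∈ Finset.range N, (T / N) *
          ‖(y k, (T / N : ℝ)⁻¹ • (y k - y (k+1))) -
            (γ (-(k * (T / N))), Xu H u (γ (-(k * (T / N)))))‖ ^ 2 ≤ C * (κ + T / N) := by
  obtain ⟨R, C, hR0, hC0, hch⟩ := h.chain_ge hH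
  obtain ⟨K1, hK10, hK1⟩ := C11 hH hu hs
  obtain ⟨K, hK0, hK⟩ := Xu_lip hH hu hs
  obtain ⟨M, hM0, hM⟩ := grad_bdd hu (hs.per 0 le_rfl)
  obtain ⟨MX, hMX0, hMX⟩ := Xu_bdd hH hu (hs.per 0 le_rfl)
  obtain ⟨c, hc, hgap⟩ := fenchel_gap hH R M
  -- constants
  set C1 : ℝ := (C * T + K1 * R ^ 2 * T + 2) / c with hC1
  have hC10 : 0 ≤ C1 := by positivity
  set E := Real.exp (K * T) with hE
  set C5 : ℝ := K * MX with hC5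
  set C6 : ℝ := 2 * (1 + K) ^ 2 * T * (E ^ 2 * (2 * T * C1 + 2 * (C5 * T) ^ 2)) + 2 * C1 with hC6
  have hC60 : 0 ≤ C6 := by positivity
  refine ⟨R, C * T + C6, hR0, by positivity, fun t κ N ht hN hδ1 hκ hκ' => ?_⟩
  have hN' : (0:ℝ) < N := by exact_mod_cast hN
  set δ := T / N with hδd
  have hδ : 0 < δ := by positivity
  have hNδ : (N:ℝ) * δ = T := mul_div_cancel₀ _ hN'.ne'
  have hκ0 : 0 ≤ κ := (abs_nonneg _).trans (hκ 0)
  obtain ⟨y, hy0, hyR, hych⟩ := hch t δ N (γ 0) (by rw [hNδ]; exact ht) hδ hδ1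
  rw [hNδ] at hych
  set vv : ℕ → Euc d := fun k => δ⁻¹ • (y k - y (k+1)) with hvv
  have hyv : ∀ k, y (k+1) = y k - δ • vv k := by
    intro k
    simp only [hvv, smul_smul, mul_inv_cancel₀ hδ.ne', one_smul, sub_sub_cancel]
  refine ⟨y, hy0, hyR, by nlinarith, ?_⟩
  change ∑ k ∈ Finset.range N, δ * ‖(y k, vv k) - (γ (-(k * δ)), Xu H u (γ (-(k * δ))))‖ ^ 2 ≤ _
  change ∀ k < N, ‖vv k‖ ≤ R at hyR
  change U (t - T) (y N) + ∑ k ∈ Finset.range N, δ * (LegendreL H (y k, vv k) + av) - _ ≤ _ at hych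
  set a : ℕ → ℝ := fun k => ‖vv k - Xu H u (y k)‖ with ha
  -- energy estimate
  have hA : ∑ k ∈ Finset.range N, δ * a k ^ 2 ≤ C1 * (κ + δ) := by
    have h1 : ∀ k ∈ Finset.range N, c * (δ * a k ^ 2) ≤
        δ * (LegendreL H (y k, vv k) + av) - (u (y k) - u (y (k+1))) + K1 * R ^ 2 * δ * δ := by
      intro k hk
      have hk := Finset.mem_range.1 hk
      have g1 := hgap (y k) (vv k) (gradient u (y k)) (hyR k hk) (hM _)
      rw [HJ hH hu hs] at g1
      have g2 := (abs_le.1 (hK1 (y k) (-(δ • vv k)))).1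
      rw [← sub_eq_add_neg, ← hyv, inner_neg_right, inner_smul_right, norm_neg, norm_smul,
        Real.norm_of_nonneg hδ.le] at g2
      have g3 : (δ * ‖vv k‖) ^ 2 ≤ (δ * R) ^ 2 := by
        have := hyR k hk
        gcongr
      have g4 := mul_le_mul_of_nonneg_left g3 hK10
      have g5 := mul_le_mul_of_nonneg_left g1 hδ.le
      change δ * (c * a k ^ 2) ≤ _ at g5
      nlinarith
    have h2 := Finset.sum_le_sum h1
    rw [← Finset.mul_sum, Finset.sum_add_distrib, Finset.sum_sub_distrib,
      Finset.sum_range_sub' (fun k => u (y k))] at h2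
    simp only [Finset.sum_const, Finset.card_range, nsmul_eq_mul] at h2
    have h3 : (N:ℝ) * (K1 * R ^ 2 * δ * δ) = K1 * R ^ 2 * T * δ := by rw [← hNδ]; ring
    have h4 := (abs_le.1 (hκ (γ 0))).2
    have h5 := (abs_le.1 (hκ' (y N))).1
    rw [hC1, div_mul_eq_mul_div, le_div_iff₀ hc, hy0] at *
    have : 0 ≤ (C * T + K1 * R ^ 2 * T) * κ := by positivity
    nlinarith
  have hS0 : 0 ≤ ∑ k ∈ Finset.range N, δ * a k := Finset.sum_nonneg fun k _ => by positivity
  have hA1 : (∑ k ∈ Finset.range N, δ * a k) ^ 2 ≤ T * (C1 * (κ + δ)) := by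
    have := Finset.sum_mul_sq_le_sq_mul_sq (Finset.range N) (fun _ => Real.sqrt δ) (fun k => Real.sqrt δ * a k)
    simp only [← mul_assoc, Real.mul_self_sqrt hδ.le, mul_pow, Real.sq_sqrt hδ.le] at this
    refine this.trans ?_
    simp only [Finset.sum_const, Finset.card_range, nsmul_eq_mul, hNδ]
    gcongr
  -- Gronwall
  have hγstep : ∀ k : ℕ, ‖γ (-(((k+1 : ℕ) : ℝ) * δ)) - (γ (-(k * δ)) - δ • Xu H u (γ (-(k * δ))))‖ ≤
      C5 * δ * δ := by
    intro k
    set τ := -((k:ℝ) * δ) with hτ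
    have e : -(((k+1 : ℕ) : ℝ) * δ) = τ - δ := by push_cast; ring
    rw [e]
    have lipγ : ∀ s ∈ Icc (τ - δ) τ, ‖γ s - γ τ‖ ≤ MX * ‖s - τ‖ := fun s hs =>
      Convex.norm_image_sub_le_of_norm_hasDerivWithin_le (𝕜 := ℝ) (f := γ) (s := univ) (C := MX)
        (fun s _ => (hγ s).hasDerivWithinAt) (fun s _ => hMX _) convex_univ (mem_univ _) (mem_univ _)
    have := Convex.norm_image_sub_le_of_norm_hasDerivWithin_le (𝕜 := ℝ)
      (f := fun s => γ s - s • Xu H u (γ τ)) (f' := fun s => Xu H u (γ s) - (1:ℝ) • Xu H u (γ τ))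
      (s := Icc (τ - δ) τ) (C := C5 * δ)
      (fun s _ => ((hγ s).sub ((hasDerivAt_id s).smul_const _)).hasDerivWithinAt)
      (fun s hs => by
        rw [one_smul]
        refine (hK _ _).trans ?_
        have g1 := lipγ s hs
        have g2 : ‖s - τ‖ ≤ δ := by
          rw [Real.norm_eq_abs, abs_le]; constructor <;> linarith [hs.1, hs.2]
        have g3 : MX * ‖s - τ‖ ≤ MX * δ := by gcongr
        rw [hC5, mul_assoc]
        exact mul_le_mul_of_nonneg_left (g1.trans g3) hK0)
      (convex_Icc _ _) (right_mem_Icc.2 (by linarith)) (left_mem_Icc.2 (by linarith))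
    rw [Real.norm_eq_abs, abs_of_nonpos (by linarith)] at this
    have e1 : γ (τ - δ) - (γ τ - δ • Xu H u (γ τ)) =
      γ (τ - δ) - (τ - δ) • Xu H u (γ τ) - (γ τ - τ • Xu H u (γ τ)) := by module
    rw [e1]
    refine this.trans (le_of_eq ?_)
    ring
  set D : ℕ → ℝ := fun k => ‖y k - γ (-(k * δ))‖ with hD
  have hDk := disc_gronwall (D := D) (e := fun k => δ * a k + C5 * δ * δ) (N := N) hK0 hδ.le
    (by simp [hD, hy0]) (fun k => by positivity) (fun k _ => by
      have e : y (k+1) - γ (-(((k+1 : ℕ) : ℝ) * δ)) = (y k - γ (-(k * δ))) - δ • (vv k - Xu H u (y k))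
          - δ • (Xu H u (y k) - Xu H u (γ (-(k * δ))))
          - (γ (-(((k+1 : ℕ) : ℝ) * δ)) - (γ (-(k * δ)) - δ • Xu H u (γ (-(k * δ))))) := by
        rw [hyv]; module
      have g1 : D (k+1) ≤ D k + δ * a k + δ * (K * D k) + C5 * δ * δ := by
        show ‖y (k+1) - γ (-(((k+1 : ℕ) : ℝ) * δ))‖ ≤ _
        rw [e]
        refine (norm_sub_le _ _).trans (add_le_add ((norm_sub_le _ _).trans
          (add_le_add ((norm_sub_le _ _).trans (add_le_add le_rfl ?_)) ?_)) (hγstep k))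
        · rw [norm_smul, Real.norm_of_nonneg hδ.le]
        · rw [norm_smul, Real.norm_of_nonneg hδ.le]
          exact mul_le_mul_of_nonneg_left (hK _ _) hδ.le
      linarith)
  have hDB : ∀ k ≤ N, D k ^ 2 ≤ E ^ 2 * (2 * T * C1 + 2 * (C5 * T) ^ 2) * (κ + δ) := by
    intro k hk
    have hk' : (k:ℝ) ≤ N := by exact_mod_cast hk
    have g1 := hDk k hk
    have g2 : ∑ j ∈ Finset.range k, (δ * a j + C5 * δ * δ) ≤
        ∑ j ∈ Finset.range N, (δ * a j + C5 * δ * δ) :=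
      Finset.sum_le_sum_of_subset_of_nonneg (Finset.range_subset_range.2 hk) fun _ _ _ => by positivity
    have g3 : ∑ j ∈ Finset.range N, (δ * a j + C5 * δ * δ) = (∑ j ∈ Finset.range N, δ * a j) + C5 * T * δ := by
      rw [Finset.sum_add_distrib]
      simp only [Finset.sum_const, Finset.card_range, nsmul_eq_mul]
      rw [← hNδ]; ring
    have g4 : Real.exp (K * (k * δ)) ≤ E := by
      rw [hE]; apply Real.exp_le_exp.2
      rw [← hNδ]; gcongr
    have g5 : D k ≤ E * ((∑ j ∈ Finset.range N, δ * a j) + C5 * T * δ) := by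
      refine g1.trans ?_
      rw [← g3]
      exact mul_le_mul g4 g2 (Finset.sum_nonneg fun _ _ => by positivity) (Real.exp_pos _).le
    have g6 : D k ^ 2 ≤ (E * ((∑ j ∈ Finset.range N, δ * a j) + C5 * T * δ)) ^ 2 :=
      pow_le_pow_left₀ (norm_nonneg (y k - γ (-(k * δ)))) g5 2
    have g7 : δ * δ ≤ κ + δ := by nlinarith
    have g8 : (C5 * T * δ) ^ 2 ≤ (C5 * T) ^ 2 * (κ + δ) := by
      have := mul_le_mul_of_nonneg_left g7 (sq_nonneg (C5 * T)); nlinarith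
    have g9 : ((∑ j ∈ Finset.range N, δ * a j) + C5 * T * δ) ^ 2 ≤
        (2 * T * C1 + 2 * (C5 * T) ^ 2) * (κ + δ) := by
      nlinarith [sq_nonneg ((∑ j ∈ Finset.range N, δ * a j) - C5 * T * δ)]
    rw [mul_pow] at g6
    have g10 := mul_le_mul_of_nonneg_left g9 (sq_nonneg E)
    linarith
  -- conclusion
  have hfin : ∀ k ∈ Finset.range N, δ * ‖(y k, vv k) - (γ (-(k * δ)), Xu H u (γ (-(k * δ))))‖ ^ 2 ≤
      δ * (2 * (1 + K) ^ 2 * (E ^ 2 * (2 * T * C1 + 2 * (C5 * T) ^ 2) * (κ + δ))) + 2 * (δ * a k ^ 2) := by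
    intro k hk
    have hk := (Finset.mem_range.1 hk).le
    have g1 : ‖(y k, vv k) - (γ (-(k * δ)), Xu H u (γ (-(k * δ))))‖ ≤ (1 + K) * D k + a k := by
      rw [Prod.mk_sub_mk, Prod.norm_mk]
      have hD0 : 0 ≤ D k := norm_nonneg _
      have ha0 : 0 ≤ a k := norm_nonneg _
      refine max_le ?_ ?_
      · change D k ≤ _
        nlinarith
      · have e : vv k - Xu H u (γ (-(k * δ))) = (vv k - Xu H u (y k)) +
          (Xu H u (y k) - Xu H u (γ (-(k * δ)))) := by abel
        rw [e]
        have := (norm_add_le (vv k - Xu H u (y k)) (Xu H u (y k) - Xu H u (γ (-(k * δ))))).trans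
          (add_le_add_right (hK _ _) _)
        change _ ≤ a k + K * D k at this
        linarith
    have g2 := pow_le_pow_left₀ (norm_nonneg _) g1 2
    have g3 : ((1 + K) * D k + a k) ^ 2 ≤ 2 * (1 + K) ^ 2 * D k ^ 2 + 2 * a k ^ 2 := by
      nlinarith [sq_nonneg ((1 + K) * D k - a k)]
    have g4 := mul_le_mul_of_nonneg_left (hDB k hk) (by positivity : 0 ≤ 2 * (1 + K) ^ 2)
    have g5 := mul_le_mul_of_nonneg_left (g2.trans (g3.trans (add_le_add_left g4 _))) hδ.le
    linarith
  refine (Finset.sum_le_sum hfin).trans ?_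
  rw [Finset.sum_add_distrib, Finset.sum_const, Finset.card_range, nsmul_eq_mul, ← Finset.mul_sum]
  have e : (N:ℝ) * (δ * (2 * (1 + K) ^ 2 * (E ^ 2 * (2 * T * C1 + 2 * (C5 * T) ^ 2) * (κ + δ)))) =
      2 * (1 + K) ^ 2 * T * (E ^ 2 * (2 * T * C1 + 2 * (C5 * T) ^ 2)) * (κ + δ) := by
    nth_rewrite 3 [← hNδ]
    rw [← hNδ]; ring
  rw [e, hC6]
  have : 0 ≤ C * T * (κ + δ) := by positivity
  linarith
end close


section lemB
variable {d : ℕ} {H : Phase d → ℝ} {av : ℝ} {u : Euc d → ℝ} {U : ℝ → Euc d → ℝ}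

set_option maxHeartbeats 1600000 in
lemma SG.second_diff (h : SG H av U) (hH : TonelliHam H) (hu : ContDiff ℝ 1 u)
    (hs : SG H av (fun _ => u)) (hUu : TendstoUniformly U u atTop)
    {γ : ℝ → Euc d} (hγ : ∀ τ, HasDerivAt γ (Xu H u (γ τ)) τ) {T : ℝ} (hT : 0 < T)
    {ξ ξ' : ℝ → Euc d} (hξ : ∀ τ, HasDerivAt ξ (ξ' τ) τ) (hξc : Continuous ξ') (hξT : ξ (-T) = 0)
    {g g' : ℝ → ℝ} (hg : ∀ τ, HasDerivAt g (g' τ) τ) (hgc : Continuous g')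
    (hfg : ∀ τ ∈ Icc (-T) 0, pair (fderiv ℝ (gradL hH) (γ τ, Xu H u (γ τ)) (ξ τ, ξ' τ)) (ξ τ, ξ' τ) ≤ g' τ)
    (ε : ℝ) (hε : 0 < ε) :
    ∃ t1, ∀ t ≥ t1, ∃ h0 > 0, ∀ r, 0 < r → r < h0 →
      U t (γ 0 + r • ξ 0) + U t (γ 0 - r • ξ 0) - 2 * U t (γ 0) ≤ r ^ 2 * (g 0 - g (-T) + ε) := by
  obtain ⟨R0, C, hR00, hC0, hcl⟩ := h.close hH hu hs hγ hT
  obtain ⟨MX, hMX0, hMX⟩ := Xu_bdd hH hu (hs.per 0 le_rfl)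
  set R := R0 + MX + 1 with hR
  obtain ⟨C', hC'0, hchle⟩ := h.chain_le hH R
  -- bounds
  have hξcont : Continuous ξ := continuous_iff_continuousAt.2 fun τ => (hξ τ).continuousAt
  obtain ⟨B1, hB1⟩ := (isCompact_Icc (a := -T) (b := (0:ℝ))).exists_bound_of_continuousOn hξcont.continuousOn
  obtain ⟨B2, hB2⟩ := (isCompact_Icc (a := -T) (b := (0:ℝ))).exists_bound_of_continuousOn hξc.continuousOn
  set B := max B1 B2 + 1 with hB
  have hB10 : 0 ≤ B1 := (norm_nonneg _).trans (hB1 0 ⟨by linarith, le_rfl⟩)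
  have hB1' : ∀ τ ∈ Icc (-T) 0, ‖ξ τ‖ ≤ B := fun τ hτ => (hB1 τ hτ).trans (by
    rw [hB]; linarith [le_max_left B1 B2])
  have hB2' : ∀ τ ∈ Icc (-T) 0, ‖ξ' τ‖ ≤ B - 1 := fun τ hτ => (hB2 τ hτ).trans (by
    rw [hB]; linarith [le_max_right B1 B2])
  have hB0 : 1 ≤ B := by rw [hB]; linarith [le_max_left B1 B2]
  obtain ⟨CA, hCA0, hCA⟩ := per_bdd ((contDiff_gradL hH).continuous_fderiv one_ne_zero)
    (per_fderiv (per_gradL hH)) MX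
  set ε2 := ε / (8 * T * B ^ 2) with hε2
  have hε2p : 0 < ε2 := by positivity
  obtain ⟨C2, hC20, ht2⟩ := taylor2 hH R ε2 hε2p
  set ε3 := ε / (8 * T * (2 * CA * (2 * B) + 1)) with hε3
  have hε3p : 0 < ε3 := by positivity
  obtain ⟨δ1, hδ1, hR1⟩ := riemann hg hgc hT (ε / (8 * T)) (by positivity)
  obtain ⟨δ2, hδ2, hR2⟩ := unif_taylor hξ hξc T (min ε3 1) (by positivity)
  set κ := ε / (16 * (2 * C2 * B ^ 2 * C + 1)) with hκ
  have hκp : 0 < κ := by positivity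
  obtain ⟨t0, ht0⟩ := eventually_atTop.1 (Metric.tendstoUniformly_iff.1 hUu κ hκp)
  have hUκ : ∀ t ≥ t0, ∀ x, |U t x - u x| ≤ κ := fun t ht x => by
    have := ht0 t ht x
    rw [dist_comm, Real.dist_eq] at this
    exact this.le
  refine ⟨max t0 1 + T, fun t ht => ?_⟩
  have ht1 : t0 ≤ t - T := by linarith [le_max_left t0 1]
  have ht2' : 1 ≤ t - T := by linarith [le_max_right t0 1]
  -- choice of h0
  set h0 := min (1 / B) (ε / (8 * (2 * C2 * T * B ^ 4 + 1))) with hh0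
  refine ⟨h0, by positivity, fun r hr hrh => ?_⟩
  have hrB : r * B ≤ 1 := by
    have : r ≤ 1 / B := hrh.le.trans (min_le_left _ _)
    rwa [le_div_iff₀ (by positivity)] at this
  have hr1 : r ≤ 1 := by
    have := mul_le_mul_of_nonneg_left hB0 hr.le
    linarith
  have hr2 : r * (8 * (2 * C2 * T * B ^ 4 + 1)) ≤ ε := by
    have : r ≤ ε / (8 * (2 * C2 * T * B ^ 4 + 1)) := hrh.le.trans (min_le_right _ _)
    rwa [le_div_iff₀ (by positivity)] at this
  -- choice of N
  set δ0 := min (min 1 (min δ1 δ2)) (min κ (r ^ 2 * ε / (8 * (2 * C' * T + 2 * C + 1)))) with hδ0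
  have hδ0p : 0 < δ0 := by positivity
  obtain ⟨N, hN⟩ := exists_nat_gt (T / δ0)
  have hN0 : (0:ℝ) < N := (by positivity : 0 < T / δ0).trans hN
  have hN0' : 0 < N := by exact_mod_cast hN0
  have hδle : T / N ≤ δ0 := by
    rw [div_le_iff₀ hN0]; rw [div_lt_iff₀ hδ0p] at hN; linarith
  have d1 : T / N ≤ 1 := hδle.trans ((min_le_left _ _).trans (min_le_left _ _))
  have d2 : T / N ≤ δ1 := hδle.trans ((min_le_left _ _).trans ((min_le_right _ _).trans (min_le_left _ _)))
  have d3 : T / N ≤ δ2 := hδle.trans ((min_le_left _ _).trans ((min_le_right _ _).trans (min_le_right _ _)))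
  have d4 : T / N ≤ κ := hδle.trans ((min_le_right _ _).trans (min_le_left _ _))
  have d5 : T / N ≤ r ^ 2 * ε / (8 * (2 * C' * T + 2 * C + 1)) :=
    hδle.trans ((min_le_right _ _).trans (min_le_right _ _))
  have hrie := hR1 N hN0' d2
  obtain ⟨y, hy0, hyR, hych, hycl⟩ := hcl t κ N ht2' hN0' d1 (hUκ t (by linarith)) (hUκ _ ht1)
  have hmem : ∀ k ≤ N, -((k:ℝ) * (T / N)) ∈ Icc (-T) 0 := fun k hk => kδ_mem hT hN0' hk
  set δ := T / N with hδd
  have hδ : 0 < δ := by positivity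
  have hNδ : (N:ℝ) * δ = T := mul_div_cancel₀ _ hN0.ne'
  clear_value δ
  set vv : ℕ → Euc d := fun k => δ⁻¹ • (y k - y (k+1)) with hvv
  set x : ℕ → Euc d := fun k => ξ (-(k * δ)) with hx
  set w2 : ℕ → Euc d := fun k => δ⁻¹ • (x k - x (k+1)) with hw2
  have hw2' : ∀ k < N, ‖w2 k - ξ' (-(k * δ))‖ ≤ min ε3 1 := by
    intro k hk
    have := hR2 _ (hmem k hk.le) δ hδ d3
    have e : -(((k+1 : ℕ) : ℝ) * δ) = -(k * δ) - δ := by push_cast; ring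
    have e2 : w2 k - ξ' (-(k * δ)) = δ⁻¹ • (ξ (-(k * δ)) - ξ (-(k * δ) - δ) - δ • ξ' (-(k * δ))) := by
      simp only [hw2, hx]
      rw [e, smul_sub δ⁻¹ (_ - _) (δ • _), smul_smul, inv_mul_cancel₀ hδ.ne', one_smul]
    rw [e2, norm_smul, norm_inv, Real.norm_of_nonneg hδ.le, inv_mul_le_iff₀ hδ, mul_comm δ (min ε3 1)]
    exact this
  have hw2B : ∀ k < N, ‖w2 k‖ ≤ B := by
    intro k hk
    have g1 := hw2' k hk
    have g2 := hB2' _ (hmem k hk.le)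
    have g3 := norm_le_norm_add_norm_sub' (w2 k) (ξ' (-(k * δ)))
    linarith [min_le_right ε3 1]
  have hWB : ∀ k < N, ‖(x k, w2 k)‖ ≤ B := fun k hk => by
    rw [Prod.norm_mk]; exact max_le (hB1' _ (hmem k hk.le)) (hw2B k hk)
  -- perturbed chains
  have chain : ∀ s : ℝ, |s| = r → U t (γ 0 + s • ξ 0) ≤ U (t - T) (y N) +
      ∑ k ∈ Finset.range N, δ * (LegendreL H ((y k, vv k) + s • (x k, w2 k)) + av) + C' * T * δ := by
    intro s hs
    have hstep : ∀ k, δ⁻¹ • ((y k + s • x k) - (y (k+1) + s • x (k+1))) = vv k + s • w2 k := by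
      intro k; simp only [hvv, hw2]; module
    have := hchle t δ N (fun k => y k + s • x k) (by rw [hNδ]; linarith) hδ d1 (fun k hk => by
      rw [hstep]
      refine (norm_add_le _ _).trans ?_
      rw [norm_smul s, Real.norm_eq_abs, hs]
      have g1 := hyR k hk
      have g2 := mul_le_mul_of_nonneg_left (hw2B k hk) hr.le
      change ‖vv k‖ ≤ _ at g1
      linarith)
    simp only [hstep, hNδ] at this
    have e0 : x 0 = ξ 0 := by simp [hx]
    have eN : x N = 0 := by simp only [hx, hNδ, hξT]
    rw [e0, eN, hy0, smul_zero, add_zero] at this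
    exact this
  have hp := chain r (abs_of_pos hr)
  have hm := chain (-r) (by rw [abs_neg, abs_of_pos hr])
  rw [neg_smul, ← sub_eq_add_neg] at hm
  -- Taylor
  set F : ℕ → Phase d := fun k => (γ (-(k * δ)), Xu H u (γ (-(k * δ)))) with hF
  have hkey : ∀ k ∈ Finset.range N,
      δ * (LegendreL H ((y k, vv k) + r • (x k, w2 k)) + av) +
      δ * (LegendreL H ((y k, vv k) + (-r) • (x k, w2 k)) + av) -
      2 * (δ * (LegendreL H (y k, vv k) + av)) ≤
      r ^ 2 * (δ * g' (-(k * δ)) + δ * (ε / (4 * T)) + 2 * C2 * B ^ 2 * (δ * ‖(y k, vv k) - F k‖ ^ 2)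
        + δ * (2 * C2 * r ^ 2 * B ^ 4)) := by
    intro k hk
    have hk := Finset.mem_range.1 hk
    have hWk := hWB k hk
    have n1 : ‖vv k‖ ≤ R0 := hyR k hk
    have n2 := mul_le_mul_of_nonneg_left (hw2B k hk) hr.le
    have n3 : ‖r • w2 k‖ ≤ 1 := by rw [norm_smul, Real.norm_of_nonneg hr.le]; linarith
    have g1 := ht2 (y k, vv k) (r • (x k, w2 k)) (F k)
      ((norm_add_le (vv k) (r • w2 k)).trans (by linarith))
      ((norm_sub_le (vv k) (r • w2 k)).trans (by linarith))
      ((hMX _).trans (by linarith))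
    have nrW : ‖r • (x k, w2 k)‖ = r * ‖(x k, w2 k)‖ := by
      rw [norm_smul, Real.norm_of_nonneg hr.le]
    have epair : pair (fderiv ℝ (gradL hH) (F k) (r • (x k, w2 k))) (r • (x k, w2 k)) =
        r ^ 2 * pair (fderiv ℝ (gradL hH) (F k) (x k, w2 k)) (x k, w2 k) := by
      rw [map_smul]
      simp only [pair, Prod.smul_fst, Prod.smul_snd, inner_smul_left, inner_smul_right,
        RCLike.conj_to_real]
      ring
    rw [epair, nrW] at g1
    have g2 := quad_pert (fderiv ℝ (gradL hH) (F k)) (x k, ξ' (-(k * δ))) (x k, w2 k)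
    have g3 : ‖(x k, w2 k) - (x k, ξ' (-(k * δ)))‖ ≤ ε3 := by
      rw [Prod.mk_sub_mk, sub_self, Prod.norm_mk, norm_zero]
      exact max_le hε3p.le ((hw2' k hk).trans (min_le_left _ _))
    have g4 : ‖(x k, ξ' (-(k * δ)))‖ ≤ B := by
      rw [Prod.norm_mk]
      exact max_le (hB1' _ (hmem k hk.le)) ((hB2' _ (hmem k hk.le)).trans (by linarith))
    have g5 : ‖fderiv ℝ (gradL hH) (F k)‖ ≤ CA := hCA _ _ (hMX _)
    have g6 : 2 * ‖fderiv ℝ (gradL hH) (F k)‖ * ‖(x k, w2 k) - (x k, ξ' (-(k * δ)))‖ *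
        (‖(x k, ξ' (-(k * δ)))‖ + ‖(x k, w2 k)‖) ≤ 2 * CA * ε3 * (B + B) := by gcongr
    have g7 : 2 * CA * ε3 * (B + B) ≤ ε / (8 * T) := by
      have : ε3 * (2 * CA * (2 * B) + 1) = ε / (8 * T) := by
        rw [hε3]; field_simp
      linarith
    have g8 : pair (fderiv ℝ (gradL hH) (F k) (x k, ξ' (-(k * δ)))) (x k, ξ' (-(k * δ))) ≤ g' (-(k * δ)) :=
      hfg _ (hmem k hk.le)
    have g9 : pair (fderiv ℝ (gradL hH) (F k) (x k, w2 k)) (x k, w2 k) ≤ g' (-(k * δ)) + ε / (8 * T) := by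
      linarith
    set q := ‖(y k, vv k) - F k‖ with hq
    set W := ‖(x k, w2 k)‖ with hW
    have hW0 : 0 ≤ W := norm_nonneg _
    have hq0 : 0 ≤ q := norm_nonneg _
    have g10 : (ε2 + C2 * (q + r * W) ^ 2) * (r * W) ^ 2 ≤
        r ^ 2 * (ε / (8 * T) + 2 * C2 * B ^ 2 * q ^ 2 + 2 * C2 * r ^ 2 * B ^ 4) := by
      have i1 : (q + r * W) ^ 2 ≤ 2 * q ^ 2 + 2 * (r * B) ^ 2 := by
        have : r * W ≤ r * B := by gcongr
        have : (q + r * W) ^ 2 ≤ (q + r * B) ^ 2 := by gcongr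
        nlinarith [sq_nonneg (q - r * B)]
      have i2 : (ε2 + C2 * (q + r * W) ^ 2) * (r * W) ^ 2 ≤
          (ε2 + C2 * (2 * q ^ 2 + 2 * (r * B) ^ 2)) * (r * B) ^ 2 := by gcongr
      have i3 : ε2 * B ^ 2 = ε / (8 * T) := by rw [hε2]; field_simp
      refine i2.trans (le_of_eq ?_)
      rw [← i3]; ring
    have g11 : LegendreL H ((y k, vv k) + r • (x k, w2 k)) +
        LegendreL H ((y k, vv k) + (-r) • (x k, w2 k)) - 2 * LegendreL H (y k, vv k) ≤
        r ^ 2 * (g' (-(k * δ)) + ε / (8 * T)) +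
        r ^ 2 * (ε / (8 * T) + 2 * C2 * B ^ 2 * q ^ 2 + 2 * C2 * r ^ 2 * B ^ 4) := by
      rw [neg_smul, ← sub_eq_add_neg]
      have := mul_le_mul_of_nonneg_left g9 (sq_nonneg r)
      linarith
    have g12 := mul_le_mul_of_nonneg_left g11 hδ.le
    have e4 : ε / (4 * T) = ε / (8 * T) + ε / (8 * T) := by field_simp; norm_num
    rw [e4]
    linarith
  have hsum := Finset.sum_le_sum hkey
  rw [Finset.sum_sub_distrib, Finset.sum_add_distrib, ← Finset.mul_sum _ _ (2:ℝ),
    ← Finset.mul_sum _ _ (r ^ 2), Finset.sum_add_distrib, Finset.sum_add_distrib, Finset.sum_add_distrib,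
    ← Finset.mul_sum _ _ (2 * C2 * B ^ 2)] at hsum
  simp only [Finset.sum_const, Finset.card_range, nsmul_eq_mul, ← mul_assoc (N:ℝ) δ, hNδ] at hsum
  have f1 : T * (ε / (4 * T)) = ε / 4 := by field_simp
  have f2 : ε / (8 * T) * T = ε / 8 := by field_simp
  have f3 : 2 * C2 * B ^ 2 * (∑ k ∈ Finset.range N, δ * ‖(y k, vv k) - F k‖ ^ 2) ≤ ε / 8 := by
    have j1 : ∑ k ∈ Finset.range N, δ * ‖(y k, vv k) - F k‖ ^ 2 ≤ C * (κ + δ) := hycl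
    have j2 : C * (κ + δ) ≤ C * (2 * κ) := mul_le_mul_of_nonneg_left (by linarith) hC0
    have j3 := mul_le_mul_of_nonneg_left (j1.trans j2) (by positivity : 0 ≤ 2 * C2 * B ^ 2)
    have j4 : κ * (2 * C2 * B ^ 2 * C + 1) = ε / 16 := by rw [hκ]; field_simp
    linarith
  have f4 : T * (2 * C2 * r ^ 2 * B ^ 4) ≤ ε / 8 := by
    have : r ^ 2 ≤ r := by rw [sq]; exact mul_le_of_le_one_left hr.le hr1
    have : T * (2 * C2 * r ^ 2 * B ^ 4) ≤ T * (2 * C2 * r * B ^ 4) := by gcongr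
    linarith
  have f5 : 2 * C' * T * δ + 2 * C * δ ≤ r ^ 2 * (ε / 8) := by
    have : δ * (8 * (2 * C' * T + 2 * C + 1)) ≤ r ^ 2 * ε := by
      rwa [le_div_iff₀ (by positivity)] at d5
    linarith
  rw [f1] at hsum
  rw [f2] at hrie
  have f6 := mul_le_mul_of_nonneg_left (add_le_add (add_le_add (add_le_add_left hrie (ε/4)) f3) f4) (sq_nonneg r)
  change U (t - T) (y N) + ∑ k ∈ Finset.range N, δ * (LegendreL H (y k, vv k) + av) - _ ≤ _ at hych
  have f7 := hsum.trans f6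
  have f8 : 0 ≤ r ^ 2 * ε := by positivity
  linarith
end lemB


section lemA
variable {d : ℕ} {H : Phase d → ℝ} {av : ℝ} {u : Euc d → ℝ} {U : ℝ → Euc d → ℝ}

lemma gradL_diff (hH : TonelliHam H) (R ε : ℝ) (hε : 0 < ε) : ∃ C : ℝ, 0 ≤ C ∧ ∀ y w : Phase d,
    ‖y.2‖ ≤ R → ‖(y + w).2‖ ≤ R →
    ‖gradL hH (y + w) - gradL hH y - fderiv ℝ (gradL hH) y w‖ ≤ (ε + C * ‖w‖ ^ 2) * ‖w‖ := by
  obtain ⟨C, hC0, hC⟩ := per_uc ((contDiff_gradL hH).continuous_fderiv one_ne_zero)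
    (per_fderiv (per_gradL hH)) R ε hε
  refine ⟨C, hC0, fun y w h1 h2 => ?_⟩
  have := Convex.norm_image_sub_le_of_norm_hasFDerivWithin_le' (𝕜 := ℝ) (f := gradL hH)
    (f' := fderiv ℝ (gradL hH)) (φ := fderiv ℝ (gradL hH) y) (s := segment ℝ y (y + w))
    (C := ε + C * ‖w‖ ^ 2) (x := y) (y := y + w)
    (fun x _ => ((contDiff_gradL hH).differentiable one_ne_zero x).hasFDerivAt.hasFDerivWithinAt)
    (fun x hx => by
      rw [segment_eq_image'] at hx
      obtain ⟨s, hs, rfl⟩ := hx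
      simp only [add_sub_cancel_left]
      have g1 := hC (y + s • w) y (strip_seg h1 h2 hs) h1
      have g2 : ‖y + s • w - y‖ ≤ ‖w‖ := by
        rw [add_sub_cancel_left, norm_smul, Real.norm_of_nonneg hs.1]
        exact mul_le_of_le_one_left (norm_nonneg _) hs.2
      have g3 : C * ‖y + s • w - y‖ ^ 2 ≤ C * ‖w‖ ^ 2 := by gcongr
      linarith)
    (convex_segment _ _) (left_mem_segment _ _ _) (right_mem_segment _ _ _)
  rwa [add_sub_cancel_left] at this

/-- Exact variational identity for difference quotients. -/
lemma pair_quot (hH : TonelliHam H) {y W e : Phase d} {r ρ B : ℝ} (hr : 0 < r) (hW : ‖W‖ ≤ B)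
    (hρ : 0 ≤ ρ)
    (h : ‖gradL hH (y + r • W) - gradL hH y - fderiv ℝ (gradL hH) y (r • W)‖ ≤ ρ * ‖r • W‖)
    (he : gradL hH (y + r • W) - gradL hH y = r • e) :
    pair (fderiv ℝ (gradL hH) y W) W ≤ pair e W + 2 * ρ * B ^ 2 := by
  have hB : 0 ≤ B := (norm_nonneg _).trans hW
  rw [he, map_smul, ← smul_sub, norm_smul, norm_smul, Real.norm_of_nonneg hr.le] at h
  have h1 : ‖e - fderiv ℝ (gradL hH) y W‖ ≤ ρ * ‖W‖ := by
    refine le_of_mul_le_mul_left ?_ hr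
    linarith
  have h2 := (neg_le_abs _).trans (pair_le (e - fderiv ℝ (gradL hH) y W) W)
  rw [pair_sub_left] at h2
  have h3 : 2 * ‖e - fderiv ℝ (gradL hH) y W‖ * ‖W‖ ≤ 2 * (ρ * B) * B := by
    have : ρ * ‖W‖ ≤ ρ * B := by gcongr
    gcongr
    exact h1.trans this
  linarith

lemma orbit_gronwall (hH : TonelliHam H) {φ : ℝ → Phase d → Phase d} (hφ : IsConformalFlow H 0 φ)
    {M K : ℝ} (hK0 : 0 ≤ K)
    (hK : ∀ z z' : Phase d, ‖z.2‖ ≤ M → ‖z'.2‖ ≤ M → ‖hamVF H 0 z - hamVF H 0 z'‖ ≤ K * ‖z - z'‖)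
    {z z' : Phase d} (hz : ∀ s, ‖(φ s z).2‖ ≤ M) (hz' : ∀ s, ‖(φ s z').2‖ ≤ M) (T : ℝ) :
    ∀ s ∈ Icc 0 T, ‖φ s z - φ s z'‖ ≤ ‖z - z'‖ * Real.exp (K * T) := by
  intro s hs
  have hc : ∀ z, Continuous fun s => φ s z := fun z =>
    continuous_iff_continuousAt.2 fun τ => (hφ.2.2 z τ).continuousAt
  have := dist_le_of_trajectories_ODE_of_mem (v := fun _ => hamVF H 0)
    (s := fun _ => {z : Phase d | ‖z.2‖ ≤ M}) (K := ⟨K, hK0⟩) (a := 0) (b := T) (δ := ‖z - z'‖)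
    (f := fun s => φ s z) (g := fun s => φ s z')
    (fun t _ => LipschitzOnWith.of_dist_le_mul fun x hx y hy => by
      rw [dist_eq_norm, dist_eq_norm]; exact hK x y hx hy)
    (hc z).continuousOn (fun t _ => (hφ.2.2 z t).hasDerivWithinAt) (fun t _ => hz t)
    (hc z').continuousOn (fun t _ => (hφ.2.2 z' t).hasDerivWithinAt) (fun t _ => hz' t)
    (by simp only [hφ.1, dist_eq_norm]; exact le_rfl) s hs
  rw [dist_eq_norm] at this
  refine this.trans (mul_le_mul_of_nonneg_left (Real.exp_le_exp.2 ?_) (norm_nonneg _))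
  show K * (s - 0) ≤ K * T
  rw [sub_zero]
  exact mul_le_mul_of_nonneg_left hs.2 hK0

set_option maxHeartbeats 1000000 in
lemma jacobi (hH : TonelliHam H) {φ : ℝ → Phase d → Phase d} (hφ : IsConformalFlow H 0 φ)
    (x : Phase d) {T : ℝ} (hT : 0 < T) {S : Euc d →L[ℝ] Euc d} (hS : IsHeight (GreenT φ T x) S)
    (v : Euc d) (ε : ℝ) (hε : 0 < ε) :
    ∃ ξ ξ' : ℝ → Euc d, ∃ g g' : ℝ → ℝ, (∀ τ, HasDerivAt ξ (ξ' τ) τ) ∧ Continuous ξ' ∧ ξ (-T) = 0 ∧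
      ξ 0 = v ∧ (∀ τ, HasDerivAt g (g' τ) τ) ∧ Continuous g' ∧
      (∀ τ ∈ Icc (-T) 0, pair (fderiv ℝ (gradL hH) ((φ τ x).1, Hp H (φ τ x)) (ξ τ, ξ' τ)) (ξ τ, ξ' τ)
        ≤ g' τ) ∧ g 0 - g (-T) ≤ ⟪S v, v⟫ + ε := by
  rcases eq_or_ne v 0 with rfl | hv
  · refine ⟨fun _ => 0, fun _ => 0, fun _ => 0, fun _ => 0, fun τ => hasDerivAt_const _ _,
      continuous_const, rfl, rfl, fun τ => hasDerivAt_const _ _, continuous_const, ?_, ?_⟩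
    · intro τ _; simp [pair]
    · simp [hε.le]
  set z0 := φ (-T) x with hz0
  have hmem : (v, S v) ∈ GreenT φ T x := by rw [hS.2]; simp
  obtain ⟨⟨ζ1, η⟩, hζ, hζe⟩ := hmem
  have hζ1 : ζ1 = 0 := by simpa [Vert] using hζ
  subst hζ1
  change fderiv ℝ (φ T) z0 (0, η) = (v, S v) at hζe
  have hdiff : DifferentiableAt ℝ (φ T) z0 := by
    by_contra hn
    rw [fderiv_zero_of_not_differentiableAt hn] at hζe
    exact hv (Prod.ext_iff.1 hζe).1.symm
  have hlim := hasDerivAt_iff_tendsto_slope_zero.1 (hdiff.hasFDerivAt.hasLineDerivAt (0, η))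
  simp only [zero_add, zero_smul, add_zero, hζe] at hlim
  have hlim := hlim.mono_left (show nhdsWithin (0:ℝ) (Ioi 0) ≤ nhdsWithin 0 {0}ᶜ from
    nhdsWithin_mono (0:ℝ) (fun x (hx : 0 < x) => hx.ne'))
  -- strip
  obtain ⟨E, hE⟩ := (isCompact_Icc (a := (0:ℝ)) (b := 1)).exists_bound_of_continuousOn
    (f := fun r : ℝ => H (z0 + r • ((0, η) : Phase d)))
    (by have := hH.smooth.continuous; fun_prop)
  obtain ⟨M, hM0, hM⟩ := strip_of_energy hH E
  have hstrip : ∀ r ∈ Icc (0:ℝ) 1, ∀ s, ‖(φ s (z0 + r • ((0, η) : Phase d))).2‖ ≤ M := by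
    intro r hr s
    apply hM
    rw [energy hH hφ]
    exact (le_abs_self _).trans (hE r hr)
  have hstrip0 : ∀ s, ‖(φ s z0).2‖ ≤ M := fun s => by
    simpa using hstrip 0 ⟨le_rfl, zero_le_one⟩ s
  obtain ⟨K, hK0, hK⟩ := per_lip (contDiff_XH hH.smooth) (per_XH hH) M
  obtain ⟨RH, hRH0, hRH⟩ := per_bdd (contDiff_Hp hH.smooth).continuous (per_Hp hH) M
  obtain ⟨CA, hCA0, hCA⟩ := per_bdd ((contDiff_gradL hH).continuous_fderiv one_ne_zero)
    (per_fderiv (per_gradL hH)) RH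
  set B0 := ‖((0, η) : Phase d)‖ * Real.exp (K * T) with hB0
  set B := (1 + K) * B0 + 1 with hB
  have hB00 : 0 ≤ B0 := by positivity
  have hBp : 0 < B := by positivity
  set β := ε / (2 * T) with hβ
  have hβp : 0 < β := by positivity
  obtain ⟨C, hC0, hC⟩ := gradL_diff hH RH (β / (8 * B ^ 2)) (by positivity)
  -- difference quotients
  set Z : ℝ → ℝ → Phase d := fun r τ => φ (T + τ) (z0 + r • ((0, η) : Phase d)) with hZ
  have hz : ∀ τ, φ (T + τ) z0 = φ τ x := fun τ => by
    rw [hz0, hφ.2.1]; congr 1; ring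
  set e : ℝ → Euc d := fun r => v - (r⁻¹ • (Z r 0 - φ 0 x)).1 with he
  set c := 1 + T⁻¹ with hc
  have hlim' : Tendsto (fun r => r⁻¹ • (Z r 0 - φ 0 x)) (nhdsWithin 0 (Ioi 0)) (nhds (v, S v)) := by
    refine hlim.congr fun r => ?_
    simp only [hZ]
    rw [← hz 0, add_zero]
  have hlim1 := (continuous_fst.tendsto _).comp hlim'
  have hlim2 := (continuous_snd.tendsto _).comp hlim'
  have hlime : Tendsto (fun r => ‖e r‖) (nhdsWithin 0 (Ioi 0)) (nhds 0) := by
    have : Tendsto e (nhdsWithin 0 (Ioi 0)) (nhds (v - v)) := tendsto_const_nhds.sub hlim1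
    simpa using this.norm
  have ev1 : ∀ᶠ r in nhdsWithin (0:ℝ) (Ioi 0), 2 * C * r ^ 2 * B ^ 4 < β / 4 := by
    have : Tendsto (fun r : ℝ => 2 * C * r ^ 2 * B ^ 4) (nhdsWithin 0 (Ioi 0)) (nhds (2 * C * 0 ^ 2 * B ^ 4)) :=
      (Continuous.tendsto (by fun_prop) 0).mono_left nhdsWithin_le_nhds
    exact this.eventually_lt_const (by simp; positivity)
  have ev2 : ∀ᶠ r in nhdsWithin (0:ℝ) (Ioi 0), 2 * CA * (c * ‖e r‖) * (B + (B + c * ‖e r‖)) < β / 2 := by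
    have h1 : Tendsto (fun r => 2 * CA * (c * ‖e r‖) * (B + (B + c * ‖e r‖))) (nhdsWithin 0 (Ioi 0))
        (nhds (2 * CA * (c * 0) * (B + (B + c * 0)))) :=
      ((hlime.const_mul c).const_mul (2 * CA)).mul (tendsto_const_nhds.add (tendsto_const_nhds.add (hlime.const_mul c)))
    exact h1.eventually_lt_const (by simp; positivity)
  have ev3 : ∀ᶠ r in nhdsWithin (0:ℝ) (Ioi 0),
      ⟪(r⁻¹ • (Z r 0 - φ 0 x)).2, (r⁻¹ • (Z r 0 - φ 0 x)).1⟫ < ⟪S v, v⟫ + ε / 2 := by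
    have h1 : Tendsto (fun r => ⟪(r⁻¹ • (Z r 0 - φ 0 x)).2, (r⁻¹ • (Z r 0 - φ 0 x)).1⟫)
      (nhdsWithin 0 (Ioi 0)) (nhds ⟪S v, v⟫) := hlim2.inner hlim1
    exact h1.eventually_lt_const (by linarith)
  have ev4 : ∀ᶠ r in nhdsWithin (0:ℝ) (Ioi 0), r ∈ Ioo (0:ℝ) 1 := Ioo_mem_nhdsGT zero_lt_one
  obtain ⟨r, h1, h2, h3, hr0, hr1⟩ := (ev1.and (ev2.and (ev3.and ev4))).exists
  set er := e r with her
  set ζ : ℝ → Phase d := fun τ => r⁻¹ • (Z r τ - φ τ x) with hζd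
  set ζ' : ℝ → Phase d := fun τ => r⁻¹ • (hamVF H 0 (Z r τ) - hamVF H 0 (φ τ x)) with hζ'd
  have dZ : ∀ τ, HasDerivAt (Z r) (hamVF H 0 (Z r τ)) τ := fun τ => by
    have := HasDerivAt.scomp τ (hφ.2.2 (z0 + r • ((0, η) : Phase d)) (T + τ)) ((hasDerivAt_id τ).const_add T)
    rw [one_smul] at this
    exact this
  have dζ : ∀ τ, HasDerivAt ζ (ζ' τ) τ := fun τ =>
    HasDerivAt.const_smul r⁻¹ ((dZ τ).sub (hφ.2.2 x τ))
  have cZ : Continuous (Z r) := continuous_iff_continuousAt.2 fun τ => (dZ τ).continuousAt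
  have cx : Continuous fun τ => φ τ x := continuous_iff_continuousAt.2 fun τ => (hφ.2.2 x τ).continuousAt
  have cζ : Continuous ζ := continuous_iff_continuousAt.2 fun τ => (dζ τ).continuousAt
  have cζ' : Continuous ζ' := by
    have := (contDiff_XH hH.smooth).continuous
    simp only [hζ'd]; fun_prop
  have d1 : ∀ τ, HasDerivAt (fun τ => (ζ τ).1) (ζ' τ).1 τ := fun τ => (ContinuousLinearMap.fst ℝ (Euc d) (Euc d)).hasFDerivAt.comp_hasDerivAt τ (dζ τ)
  have d2 : ∀ τ, HasDerivAt (fun τ => (ζ τ).2) (ζ' τ).2 τ := fun τ => (ContinuousLinearMap.snd ℝ (Euc d) (Euc d)).hasFDerivAt.comp_hasDerivAt τ (dζ τ)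
  have hζT : (ζ (-T)).1 = 0 := by
    simp only [hζd, hZ, add_neg_cancel, hφ.1]
    rw [← hz0]; simp
  refine ⟨fun τ => (ζ τ).1 + (1 + T⁻¹ * τ) • er, fun τ => (ζ' τ).1 + T⁻¹ • er,
    fun τ => ⟪(ζ τ).2, (ζ τ).1⟫ + β * τ, fun τ => ⟪(ζ τ).2, (ζ' τ).1⟫ + ⟪(ζ' τ).2, (ζ τ).1⟫ + β,
    fun τ => ?_, by fun_prop, ?_, ?_, fun τ => ?_, by fun_prop, fun τ hτ => ?_, ?_⟩
  · have := (((hasDerivAt_id τ).const_mul T⁻¹).const_add 1).smul_const er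
    rw [mul_one] at this
    exact (d1 τ).add this
  · simp only [hζT]
    rw [mul_neg, inv_mul_cancel₀ hT.ne', add_neg_cancel, zero_smul, add_zero]
  · simp only [mul_zero, add_zero, one_smul]
    rw [her]; simp only [he]
    exact add_sub_cancel _ _
  · have := ((d2 τ).inner ℝ (d1 τ)).add ((hasDerivAt_id τ).const_mul β)
    rw [mul_one] at this
    exact this
  · -- main inequality
    have hrI : r ∈ Icc (0:ℝ) 1 := ⟨hr0.le, hr1.le⟩
    have hsI : T + τ ∈ Icc 0 T := ⟨by linarith [hτ.1], by linarith [hτ.2]⟩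
    have b1 := orbit_gronwall hH hφ hK0 hK (hstrip r hrI) hstrip0 T (T + τ) hsI
    rw [add_sub_cancel_left, norm_smul, Real.norm_of_nonneg hr0.le, hz, mul_assoc, ← hB0] at b1
    change ‖Z r τ - φ τ x‖ ≤ r * B0 at b1
    have sZ : ‖(Z r τ).2‖ ≤ M := hstrip r hrI _
    have sx : ‖(φ τ x).2‖ ≤ M := by rw [← hz]; exact hstrip0 _
    have b2 : ‖ζ τ‖ ≤ B0 := by
      simp only [hζd]
      rw [norm_smul, norm_inv, Real.norm_of_nonneg hr0.le, inv_mul_le_iff₀ hr0]; exact b1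
    have b3 : ‖ζ' τ‖ ≤ K * B0 := by
      simp only [hζ'd]
      rw [norm_smul, norm_inv, Real.norm_of_nonneg hr0.le, inv_mul_le_iff₀ hr0]
      have := (hK (Z r τ) (φ τ x) sZ sx).trans (mul_le_mul_of_nonneg_left b1 hK0)
      linarith
    set W : Phase d := ((ζ τ).1, (ζ' τ).1) with hW
    have bW : ‖W‖ ≤ B := by
      have : 0 ≤ K * B0 := by positivity
      rw [hW, Prod.norm_mk]
      exact max_le ((norm_fst_le _).trans (by rw [hB]; linarith)) ((norm_fst_le _).trans (by rw [hB]; linarith))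
    set y : Phase d := ((φ τ x).1, Hp H (φ τ x)) with hy
    have i1 : Z r τ = φ τ x + r • ζ τ := by
      simp only [hζd, smul_smul, mul_inv_cancel₀ hr0.ne', one_smul, add_sub_cancel]
    have i2 : hamVF H 0 (Z r τ) = hamVF H 0 (φ τ x) + r • ζ' τ := by
      simp only [hζ'd, smul_smul, mul_inv_cancel₀ hr0.ne', one_smul, add_sub_cancel]
    have i2a : Hp H (Z r τ) = Hp H (φ τ x) + r • (ζ' τ).1 := by
      have := congrArg Prod.fst i2
      rwa [hamVF_eq hH.smooth, hamVF_eq hH.smooth] at this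
    have i2b : -Hq H (Z r τ) = -Hq H (φ τ x) + r • (ζ' τ).2 := by
      have := congrArg Prod.snd i2
      rwa [hamVF_eq hH.smooth, hamVF_eq hH.smooth] at this
    have i3 : y + r • W = ((Z r τ).1, Hp H (Z r τ)) := by
      rw [i2a, hy, hW]
      refine Prod.ext ?_ rfl
      rw [i1]; rfl
    have gradLam : ∀ z : Phase d, gradL hH (z.1, Hp H z) = (-Hq H z, z.2) := by
      intro z
      have : Pm hH (z.1, Hp H z) = z.2 := Pm_Hp hH z.1 z.2
      simp only [gradL, this]
    have i4 : gradL hH (y + r • W) - gradL hH y = r • ((ζ' τ).2, (ζ τ).2) := by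
      rw [i3, hy, gradLam, gradLam, i2b]
      refine Prod.ext ?_ ?_
      · show -Hq H (φ τ x) + r • (ζ' τ).2 - -Hq H (φ τ x) = r • (ζ' τ).2
        abel
      · show (Z r τ).2 - (φ τ x).2 = r • (ζ τ).2
        rw [i1, Prod.snd_add, add_sub_cancel_left]; rfl
    have sy : ‖y.2‖ ≤ RH := hRH _ _ sx
    have j1 := hC y (r • W) sy (by rw [i3]; exact hRH _ _ sZ)
    have nrW : ‖r • W‖ ≤ r * B := by
      rw [norm_smul, Real.norm_of_nonneg hr0.le]; gcongr
    have j2 : ‖gradL hH (y + r • W) - gradL hH y - fderiv ℝ (gradL hH) y (r • W)‖ ≤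
        (β / (8 * B ^ 2) + C * (r * B) ^ 2) * ‖r • W‖ := j1.trans (by gcongr)
    have j3 := pair_quot hH hr0 bW (by positivity) j2 i4
    have j4 : 2 * (β / (8 * B ^ 2) + C * (r * B) ^ 2) * B ^ 2 ≤ β / 2 := by
      have : 2 * (β / (8 * B ^ 2) + C * (r * B) ^ 2) * B ^ 2 = β / 4 + 2 * C * r ^ 2 * B ^ 4 := by
        field_simp; ring
      linarith
    have j5 := quad_pert (fderiv ℝ (gradL hH) y) W
      ((ζ τ).1 + (1 + T⁻¹ * τ) • er, (ζ' τ).1 + T⁻¹ • er)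
    have hEd : ((ζ τ).1 + (1 + T⁻¹ * τ) • er, (ζ' τ).1 + T⁻¹ • er) - W = ((1 + T⁻¹ * τ) • er, T⁻¹ • er) := by
      rw [hW, Prod.mk_sub_mk, add_sub_cancel_left, add_sub_cancel_left]
    have hT' : 0 < T⁻¹ := inv_pos.2 hT
    have k1 : ‖((ζ τ).1 + (1 + T⁻¹ * τ) • er, (ζ' τ).1 + T⁻¹ • er) - W‖ ≤ c * ‖er‖ := by
      rw [hEd, Prod.norm_mk]
      have q1 : T⁻¹ * τ ≤ 0 := mul_nonpos_of_nonneg_of_nonpos hT'.le hτ.2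
      have q2 : -1 ≤ T⁻¹ * τ := by
        have := mul_le_mul_of_nonneg_left hτ.1 hT'.le
        rwa [mul_neg, inv_mul_cancel₀ hT.ne'] at this
      refine max_le ?_ ?_
      · rw [norm_smul]
        refine mul_le_mul_of_nonneg_right ?_ (norm_nonneg _)
        rw [Real.norm_of_nonneg (by linarith), hc]; linarith
      · rw [norm_smul, Real.norm_of_nonneg hT'.le]
        refine mul_le_mul_of_nonneg_right ?_ (norm_nonneg _)
        rw [hc]; linarith
    have k2 : ‖((ζ τ).1 + (1 + T⁻¹ * τ) • er, (ζ' τ).1 + T⁻¹ • er)‖ ≤ B + c * ‖er‖ := by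
      have := norm_le_norm_add_norm_sub' ((ζ τ).1 + (1 + T⁻¹ * τ) • er, (ζ' τ).1 + T⁻¹ • er) W
      linarith
    have k3 : ‖fderiv ℝ (gradL hH) y‖ ≤ CA := hCA _ _ sy
    have hc0 : 0 ≤ c := by positivity
    have k4 : 2 * ‖fderiv ℝ (gradL hH) y‖ *
        ‖((ζ τ).1 + (1 + T⁻¹ * τ) • er, (ζ' τ).1 + T⁻¹ • er) - W‖ *
        (‖W‖ + ‖((ζ τ).1 + (1 + T⁻¹ * τ) • er, (ζ' τ).1 + T⁻¹ • er)‖) ≤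
        2 * CA * (c * ‖er‖) * (B + (B + c * ‖er‖)) := by
      refine mul_le_mul (mul_le_mul (by linarith) k1 (norm_nonneg _) (by positivity))
        (add_le_add bW k2) (by positivity) (by positivity)
    have k5 : pair ((ζ' τ).2, (ζ τ).2) W = ⟪(ζ τ).2, (ζ' τ).1⟫ + ⟪(ζ' τ).2, (ζ τ).1⟫ := by
      simp only [pair, hW]; ring
    rw [k5] at j3
    linarith
  · have e1 : ⟪(ζ (-T)).2, (ζ (-T)).1⟫ = 0 := by rw [hζT, inner_zero_right]
    show ⟪(ζ 0).2, (ζ 0).1⟫ + β * 0 - (⟪(ζ (-T)).2, (ζ (-T)).1⟫ + β * (-T)) ≤ _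
    rw [e1]
    have e2 : β * T = ε / 2 := by rw [hβ]; field_simp
    have e3 : ⟪(ζ 0).2, (ζ 0).1⟫ < ⟪S v, v⟫ + ε / 2 := h3
    linarith

/-- The key estimate at a regular point. -/
lemma SG.green_bound (h : SG H av U) (hH : TonelliHam H) (hu : ContDiff ℝ 1 u)
    (hs : SG H av (fun _ => u)) (hUu : TendstoUniformly U u atTop)
    {φ : ℝ → Phase d → Phase d} (hφ : IsConformalFlow H 0 φ) {θ p : Euc d} {S : Euc d →L[ℝ] Euc d}
    (hp : HasGradientAt u p θ) (hG : ∀ t > (0:ℝ), ∃ S', IsHeight (GreenT φ t (θ, p)) S')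
    (hlim : Tendsto (fun t : ℝ => heightOf (GreenT φ t (θ, p))) atTop (nhds S))
    (v : Euc d) (ε : ℝ) (hε : 0 < ε) :
    ∃ t1, ∀ t ≥ t1, ∃ h0 > 0, ∀ r, 0 < r → r < h0 →
      U t (θ + r • v) + U t (θ - r • v) - 2 * U t θ ≤ r ^ 2 * (⟪S v, v⟫ + ε) := by
  have hp' : p = gradient u θ := hp.gradient.symm
  subst hp'
  have hl : Tendsto (fun t : ℝ => ⟪heightOf (GreenT φ t (θ, gradient u θ)) v, v⟫) atTop (nhds ⟪S v, v⟫) := by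
    have h1 : Continuous fun A : Euc d →L[ℝ] Euc d => ⟪A v, v⟫ := by fun_prop
    exact (h1.tendsto S).comp hlim
  obtain ⟨T, hT1, hT⟩ := ((hl.eventually_lt_const (show ⟪S v, v⟫ < ⟪S v, v⟫ + ε / 3 by linarith)).and
    (eventually_gt_atTop 0)).exists
  have hS : IsHeight (GreenT φ T (θ, gradient u θ)) (heightOf (GreenT φ T (θ, gradient u θ))) := by
    unfold heightOf
    rw [dif_pos (hG T hT)]
    exact (hG T hT).choose_spec
  obtain ⟨ξ, ξ', g, g', hξ, hξc, hξT, hξ0, hg, hgc, hfg, hgv⟩ :=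
    jacobi hH hφ (θ, gradient u θ) hT hS v (ε / 3) (by positivity)
  have hgi := graph_inv hH hu hs hφ θ
  have hX : ∀ τ, Hp H (φ τ (θ, gradient u θ)) = Xu H u (φ τ (θ, gradient u θ)).1 := fun τ => by
    unfold Xu; rw [← hgi τ]
  obtain ⟨t1, ht1⟩ := h.second_diff hH hu hs hUu (γ := fun τ => (φ τ (θ, gradient u θ)).1)
    (fun τ => by
      have := (ContinuousLinearMap.fst ℝ (Euc d) (Euc d)).hasFDerivAt.comp_hasDerivAt τ (hφ.2.2 (θ, gradient u θ) τ)
      rw [hamVF_eq hH.smooth, hX] at this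
      exact this) hT hξ hξc hξT hg hgc (fun τ hτ => by rw [← hX]; exact hfg τ hτ) (ε / 3) (by positivity)
  refine ⟨t1, fun t ht => ?_⟩
  obtain ⟨h0, hh0, hh⟩ := ht1 t ht
  refine ⟨h0, hh0, fun r hr hrh => ?_⟩
  have := hh r hr hrh
  simp only [hφ.1, hξ0] at this
  refine this.trans (mul_le_mul_of_nonneg_left ?_ (sq_nonneg r))
  linarith
end lemA


section alex
variable {d : ℕ} {f : Euc d → ℝ}

/-- subgradient -/
def Sbg (f : Euc d → ℝ) (x q : Euc d) : Prop := ∀ y, f x + ⟪q, y - x⟫ ≤ f y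

lemma Sbg.mono {x y q q' : Euc d} (h : Sbg f x q) (h' : Sbg f y q') :
    0 ≤ ⟪q' - q, y - x⟫ := by
  have h1 := h y
  have h2 := h' x
  have h3 : ⟪q', x - y⟫ = - ⟪q', y - x⟫ := by rw [← inner_neg_right]; congr 1; abel
  rw [inner_sub_left]
  linarith

lemma Sbg.firm {x y q q' : Euc d} (h : Sbg f x q) (h' : Sbg f y q') :
    ‖y - x‖ ^ 2 ≤ ⟪y - x, (y + q') - (x + q)⟫ := by
  have h1 := h.mono h'
  have : (y + q') - (x + q) = (y - x) + (q' - q) := by abel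
  rw [this, inner_add_right, real_inner_self_eq_norm_sq, real_inner_comm]
  linarith

lemma Sbg.nonexp {x y q q' : Euc d} (h : Sbg f x q) (h' : Sbg f y q') :
    ‖y - x‖ ≤ ‖(y + q') - (x + q)‖ := by
  have h1 := h.firm h'
  have h2 := real_inner_le_norm (y - x) ((y + q') - (x + q))
  by_contra hc
  push Not at hc
  have := norm_nonneg ((y + q') - (x + q))
  nlinarith

lemma Sbg.cvx (hex : ∀ x, ∃ q, Sbg f x q) (x y : Euc d) (s : ℝ) (h0 : 0 ≤ s) (h1 : s ≤ 1) :
    f (x + s • (y - x)) ≤ (1 - s) * f x + s * f y := by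
  obtain ⟨q, hq⟩ := hex (x + s • (y - x))
  have a := hq x
  have b := hq y
  have e1 : x - (x + s • (y - x)) = (-s) • (y - x) := by module
  have e2 : y - (x + s • (y - x)) = (1 - s) • (y - x) := by module
  rw [e1, inner_smul_right] at a
  rw [e2, inner_smul_right] at b
  have a' := mul_le_mul_of_nonneg_left a (by linarith : 0 ≤ 1 - s)
  have b' := mul_le_mul_of_nonneg_left b h0
  linarith

lemma prox_exists (hf : Continuous f) (hex : ∀ x, ∃ q, Sbg f x q) (z : Euc d) :
    ∃ x, Sbg f x (z - x) := by
  obtain ⟨q0, hq0⟩ := hex z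
  set R := 2 * ‖q0‖ with hR
  have hR0 : 0 ≤ R := by positivity
  have hg : Continuous fun x => f x + ‖x - z‖ ^ 2 / 2 := by fun_prop
  obtain ⟨x, hx, hmin⟩ := (isCompact_closedBall z R).exists_isMinOn
    ⟨z, mem_closedBall_self hR0⟩ hg.continuousOn
  have hm : ∀ y, f x + ‖x - z‖ ^ 2 / 2 ≤ f y + ‖y - z‖ ^ 2 / 2 := by
    intro y
    by_cases hy : y ∈ closedBall z R
    · exact hmin hy
    · rw [mem_closedBall, dist_eq_norm] at hy
      push Not at hy
      have h1 : f x + ‖x - z‖ ^ 2 / 2 ≤ f z + ‖z - z‖ ^ 2 / 2 := hmin (mem_closedBall_self hR0)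
      have h2 := hq0 y
      have h3 := neg_le_of_abs_le (abs_real_inner_le_norm q0 (y - z))
      simp at h1
      nlinarith [norm_nonneg q0]
  refine ⟨x, fun y => ?_⟩
  refine le_of_forall_pos_le_add fun ε hε => ?_
  obtain ⟨s, hs0, hs1, hsε⟩ : ∃ s : ℝ, 0 < s ∧ s ≤ 1 ∧ s * ‖y - x‖ ^ 2 ≤ ε := by
    refine ⟨min 1 (ε / (‖y - x‖ ^ 2 + 1)), by positivity, min_le_left _ _, ?_⟩
    calc _ ≤ (ε / (‖y - x‖ ^ 2 + 1)) * (‖y - x‖ ^ 2 + 1) :=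
          mul_le_mul (min_le_right _ _) (by linarith) (by positivity) (by positivity)
      _ = ε := by field_simp
  have h1 := hm (x + s • (y - x))
  have h2 := Sbg.cvx hex x y s hs0.le hs1
  have h3 : x + s • (y - x) - z = (x - z) + s • (y - x) := by abel
  rw [h3, norm_add_sq_real, inner_smul_right, norm_smul, Real.norm_of_nonneg hs0.le] at h1
  have h4 : ⟪z - x, y - x⟫ = - ⟪x - z, y - x⟫ := by rw [← inner_neg_left]; congr 1; abel
  rw [h4]
  have h5 : 0 ≤ s * (f y - f x + ⟪x - z, y - x⟫ + s * ‖y - x‖ ^ 2 / 2) := by nlinarith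
  have h6 := nonneg_of_mul_nonneg_right h5 hs0
  have h7 : 0 ≤ s * ‖y - x‖ ^ 2 := by positivity
  linarith

lemma null_image {P : Euc d → Euc d} (hP : LipschitzWith 1 P) {N : Set (Euc d)}
    (hN : volume N = 0) : volume (P '' N) = 0 := by
  have hac : (volume : Measure (Euc d)) ≪ (Measure.hausdorffMeasure (Module.finrank ℝ (Euc d))) :=
    Measure.absolutelyContinuous_isAddHaarMeasure _ _
  have hac' : (Measure.hausdorffMeasure (Module.finrank ℝ (Euc d)) : Measure (Euc d)) ≪ volume :=
    Measure.absolutelyContinuous_isAddHaarMeasure _ _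
  apply hac
  have := (hP.lipschitzOnWith (s := N)).hausdorffMeasure_image_le
    (d := (Module.finrank ℝ (Euc d) : ℝ)) (by positivity)
  rw [hac' hN] at this
  simpa using this

lemma tele_bound {ψ : ℝ → ℝ} {C C' : ℝ}
    (h : ∀ s s', 0 ≤ s → s ≤ s' → s' ≤ 1 → ψ s' - ψ s ≤ C * (s' - s) + C' * (s' - s) ^ 2) :
    ψ 1 - ψ 0 ≤ C := by
  have hN : ∀ n : ℕ, ψ 1 - ψ 0 ≤ C + C' * (1 / ((n : ℝ) + 1)) := by
    intro n
    set N : ℝ := (n : ℝ) + 1 with hNd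
    have hNp : 0 < N := by positivity
    have hk : ∀ k : ℕ, k ≤ n + 1 → ψ (k / N) - ψ 0 ≤ k * (C / N + C' / N ^ 2) := by
      intro k
      induction k with
      | zero => intro _; simp
      | succ k ih =>
        intro hk
        have h1 := ih (by omega)
        have hk' : ((k : ℝ) + 1) ≤ N := by rw [hNd]; exact_mod_cast hk
        have h2 := h (k / N) ((k + 1) / N) (by positivity) (by gcongr; linarith)
          (by rw [div_le_one hNp]; exact hk')
        have e : ((k : ℝ) + 1) / N - k / N = 1 / N := by field_simp; ring
        rw [e] at h2
        push_cast
        have e2 : C * (1 / N) + C' * (1 / N) ^ 2 = C / N + C' / N ^ 2 := by field_simp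
        linarith
    have := hk (n + 1) le_rfl
    push_cast at this
    rw [← hNd, div_self hNp.ne'] at this
    have e2 : N * (C / N + C' / N ^ 2) = C + C' * (1 / N) := by field_simp
    linarith
  have ht : Tendsto (fun n : ℕ => C + C' * (1 / ((n : ℝ) + 1))) atTop (nhds (C + C' * 0)) :=
    (tendsto_one_div_add_atTop_nhds_zero_nat.const_mul C').const_add C
  have := ge_of_tendsto' ht hN
  linarith

lemma sbg_taylor (hex : ∀ x, ∃ q, Sbg f x q) {x q : Euc d} {M : Euc d →L[ℝ] Euc d} {ε ρ : ℝ}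
    (hM : ∀ y, ‖y - x‖ < ρ → ∀ qy, Sbg f y qy → ‖qy - q - M (y - x)‖ ≤ ε * ‖y - x‖)
    (h : Euc d) (hh : ‖h‖ < ρ) :
    |f (x + h) - f x - ⟪q, h⟫ - (1/2) * ⟪M h, h⟫| ≤ ε * ‖h‖ ^ 2 := by
  have key : ∀ s, 0 ≤ s → s ≤ 1 → ∃ qs, Sbg f (x + s • h) qs ∧
      |⟪qs, h⟫ - ⟪q, h⟫ - s * ⟪M h, h⟫| ≤ ε * ‖h‖ ^ 2 := by
    intro s h0 h1
    obtain ⟨qs, hqs⟩ := hex (x + s • h)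
    refine ⟨qs, hqs, ?_⟩
    have e : x + s • h - x = s • h := by abel
    have hn : ‖s • h‖ = s * ‖h‖ := by rw [norm_smul, Real.norm_of_nonneg h0]
    have := hM (x + s • h) (by rw [e, hn]; nlinarith [norm_nonneg h]) qs hqs
    rw [e, hn] at this
    have e2 : ⟪qs, h⟫ - ⟪q, h⟫ - s * ⟪M h, h⟫ = ⟪qs - q - M (s • h), h⟫ := by
      rw [inner_sub_left, inner_sub_left, map_smul, inner_smul_left]; simp
    rw [e2]
    have h3 := abs_real_inner_le_norm (qs - q - M (s • h)) h
    have h4 : 0 ≤ ε * (s * ‖h‖) := (norm_nonneg _).trans this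
    have h5 := mul_le_mul_of_nonneg_right this (norm_nonneg h)
    have h6 : ε * (s * ‖h‖) * ‖h‖ ≤ ε * ‖h‖ ^ 2 := by
      have : 0 ≤ ε * ‖h‖ ^ 2 ∨ h = 0 ∨ ε < 0 := by
        by_cases hε : 0 ≤ ε
        · left; positivity
        · right; right; linarith
      rcases this with h | h | hε
      · nlinarith
      · simp [h]
      · have := hM (x + h) (by simpa using hh) _ (hex (x + h)).choose_spec
        have h9 : 0 ≤ ε * ‖x + h - x‖ := (norm_nonneg _).trans this
        have h10 : 0 ≤ ε * ‖h‖ := by simpa using h9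
        have : 0 ≤ ε * ‖h‖ ^ 2 := by nlinarith [norm_nonneg h]
        nlinarith
    linarith
  have hdiff : ∀ s s' : ℝ, x + s' • h - (x + s • h) = (s' - s) • h := fun s s' => by module
  have up := tele_bound (ψ := fun s => f (x + s • h) - s * ⟪q, h⟫ - s ^ 2 * (1/2) * ⟪M h, h⟫)
    (C := ε * ‖h‖ ^ 2) (C' := ⟪M h, h⟫ / 2) (by
      intro s s' h0 h1 h2
      obtain ⟨qs, hq1, hq2⟩ := key s' (h0.trans h1) h2
      have a := hq1 (x + s • h)
      rw [hdiff, inner_smul_right] at a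
      have b := mul_le_mul_of_nonneg_left (abs_le.1 hq2).2 (sub_nonneg.2 h1)
      show f (x + s' • h) - s' * ⟪q, h⟫ - s' ^ 2 * (1/2) * ⟪M h, h⟫ -
        (f (x + s • h) - s * ⟪q, h⟫ - s ^ 2 * (1/2) * ⟪M h, h⟫) ≤ _
      linarith)
  have lo := tele_bound (ψ := fun s => -(f (x + s • h) - s * ⟪q, h⟫ - s ^ 2 * (1/2) * ⟪M h, h⟫))
    (C := ε * ‖h‖ ^ 2) (C' := ⟪M h, h⟫ / 2) (by
      intro s s' h0 h1 h2
      obtain ⟨qs, hq1, hq2⟩ := key s h0 (h1.trans h2)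
      have a := hq1 (x + s' • h)
      rw [hdiff, inner_smul_right] at a
      have b := mul_le_mul_of_nonneg_left (abs_le.1 hq2).1 (sub_nonneg.2 h1)
      show -(f (x + s' • h) - s' * ⟪q, h⟫ - s' ^ 2 * (1/2) * ⟪M h, h⟫) -
        -(f (x + s • h) - s * ⟪q, h⟫ - s ^ 2 * (1/2) * ⟪M h, h⟫) ≤ _
      linarith)
  simp only [one_smul, zero_smul, add_zero, one_mul, one_pow, zero_mul, sub_zero, ne_eq,
    OfNat.ofNat_ne_zero, not_false_eq_true, zero_pow] at up lo
  rw [abs_le]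
  constructor <;> linarith

end alex


section alex2
variable {d : ℕ} {f : Euc d → ℝ}

lemma sbg_diff {P : Euc d → Euc d} (hP : ∀ z, Sbg f (P z) (z - P z))
    {z x : Euc d} (hx : P z = x) {A B : Euc d →L[ℝ] Euc d} (hA : HasFDerivAt P A z)
    (hBA : ∀ k, B (A k) = k) (ε : ℝ) (hε : 0 < ε) :
    ∃ ρ > 0, ∀ y, ‖y - x‖ < ρ → ∀ qy, Sbg f y qy →
      ‖qy - (z - x) - (B - ContinuousLinearMap.id ℝ (Euc d)) (y - x)‖ ≤ ε * ‖y - x‖ := by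
  obtain ⟨b, hb0, hb⟩ : ∃ b : ℝ, 0 < b ∧ ∀ w, ‖B w‖ ≤ b * ‖w‖ :=
    ⟨‖B‖ + 1, by positivity, fun w => (B.le_opNorm w).trans (by gcongr; linarith)⟩
  have hPu : ∀ y qy, Sbg f y qy → P (y + qy) = y := by
    intro y qy h
    have := h.nonexp (hP (y + qy))
    rw [add_sub_cancel, sub_self, norm_zero] at this
    exact sub_eq_zero.1 (norm_le_zero_iff.1 this)
  have hfirm : ∀ a c, ‖P a - P c‖ ^ 2 ≤ ⟪P a - P c, a - c⟫ := by
    intro a c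
    have := (hP c).firm (hP a)
    rwa [add_sub_cancel, add_sub_cancel] at this
  have hlin : ∀ η : ℝ, 0 < η → ∃ r > 0, ∀ k, ‖k‖ ≤ r → ‖P (z + k) - x - A k‖ ≤ η * ‖k‖ := by
    intro η hη
    have h1 := (hasFDerivAt_iff_isLittleO_nhds_zero.1 hA).def hη
    obtain ⟨r, hr, h2⟩ := Metric.eventually_nhds_iff.1 h1
    refine ⟨r / 2, by positivity, fun k hk => ?_⟩
    have := h2 (show dist k 0 < r by rw [dist_zero_right]; linarith)
    rwa [hx] at this
  set c : ℝ := 1 / (2 * b) with hc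
  have hc0 : 0 < c := by positivity
  have hbc : b * c = 1 / 2 := by rw [hc]; field_simp
  obtain ⟨r, hr, hrl⟩ := hlin c hc0
  have hlow : ∀ k, ‖k‖ ≤ r → c * ‖k‖ ≤ ‖P (z + k) - x‖ := by
    intro k hk
    have h1 := hrl k hk
    have h2 := hb (A k)
    rw [hBA] at h2
    have h3 : ‖A k‖ ≤ ‖P (z + k) - x‖ + c * ‖k‖ := by
      have := norm_sub_le (P (z + k) - x) (P (z + k) - x - A k)
      rw [sub_sub_cancel] at this
      linarith
    have h4 := mul_le_mul_of_nonneg_left h3 hb0.le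
    have h5 : b * (c * ‖k‖) ≤ b * ‖P (z + k) - x‖ := by
      have : b * (c * ‖k‖) = ‖k‖ / 2 := by rw [← mul_assoc, hbc]; ring
      nlinarith
    exact le_of_mul_le_mul_left h5 hb0
  obtain ⟨r', hr', hrl'⟩ := hlin (ε * c / b) (by positivity)
  refine ⟨min (c ^ 2 * r) (c * r'), by positivity, fun y hy qy hqy => ?_⟩
  have hy1 := lt_of_lt_of_le hy (min_le_left _ _)
  have hy2 := lt_of_lt_of_le hy (min_le_right _ _)
  set k := y + qy - z with hk
  have hzk : P (z + k) = y := by rw [hk, add_sub_cancel]; exact hPu y qy hqy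
  have hkr : ‖k‖ ≤ r := by
    by_contra hcon
    push Not at hcon
    have hk0 : 0 < ‖k‖ := hr.trans hcon
    set s := r / ‖k‖ with hs
    have hs0 : 0 < s := by positivity
    have hs1 : s < 1 := (div_lt_one hk0).2 hcon
    have hsk : ‖s • k‖ = r := by
      rw [norm_smul, Real.norm_of_nonneg hs0.le, hs]; field_simp
    have h1 := hlow (s • k) hsk.le
    rw [hsk] at h1
    have h2 := hfirm (z + k) (z + s • k)
    have h3 := hfirm (z + s • k) z
    rw [hzk] at h2
    rw [hx] at h3
    have e1 : z + k - (z + s • k) = (1 - s) • k := by module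
    have e2 : z + s • k - z = s • k := by abel
    rw [e1, inner_smul_right] at h2
    rw [e2, inner_smul_right] at h3
    set y' := P (z + s • k)
    have h4 : 0 ≤ ⟪y - y', k⟫ :=
      nonneg_of_mul_nonneg_right ((sq_nonneg _).trans h2) (by linarith)
    have h5 : ⟪y - x, k⟫ = ⟪y - y', k⟫ + ⟪y' - x, k⟫ := by
      rw [← inner_add_left]; congr 1; abel
    have h6 := real_inner_le_norm (y - x) k
    have h7 : (c * r) ^ 2 ≤ s * (‖y - x‖ * ‖k‖) := by
      calc (c * r) ^ 2 ≤ ‖y' - x‖ ^ 2 := by gcongr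
        _ ≤ _ := h3
        _ ≤ _ := by
          apply mul_le_mul_of_nonneg_left _ hs0.le
          linarith
    have h8 : s * (‖y - x‖ * ‖k‖) = r * ‖y - x‖ := by rw [hs]; field_simp
    rw [h8] at h7
    nlinarith
  have h1 := hlow k hkr
  rw [hzk] at h1
  have hkr' : ‖k‖ ≤ r' := by
    have : c * ‖k‖ ≤ c * r' := by linarith
    exact le_of_mul_le_mul_left this hc0
  have h2 := hrl' k hkr'
  rw [hzk] at h2
  have h3 := hb (y - x - A k)
  rw [map_sub, hBA] at h3
  have e : qy - (z - x) - (B - ContinuousLinearMap.id ℝ (Euc d)) (y - x) = -(B (y - x) - k) := by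
    simp only [ContinuousLinearMap.sub_apply, ContinuousLinearMap.id_apply, hk]; abel
  rw [e, norm_neg]
  calc _ ≤ _ := h3
    _ ≤ b * (ε * c / b * ‖k‖) := mul_le_mul_of_nonneg_left h2 hb0.le
    _ = ε * (c * ‖k‖) := by field_simp
    _ ≤ _ := mul_le_mul_of_nonneg_left h1 hε.le

lemma alex_convex (hf : Continuous f) (hex : ∀ x, ∃ q, Sbg f x q) :
    ∀ᵐ x ∂(volume : Measure (Euc d)), ∃ (q : Euc d) (M : Euc d →L[ℝ] Euc d), ∀ ε > 0, ∃ ρ > 0,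
      ∀ h, ‖h‖ < ρ → |f (x + h) - f x - ⟪q, h⟫ - (1/2) * ⟪M h, h⟫| ≤ ε * ‖h‖ ^ 2 := by
  choose P hP using prox_exists hf hex
  have hPu : ∀ y qy, Sbg f y qy → P (y + qy) = y := by
    intro y qy h
    have := h.nonexp (hP (y + qy))
    rw [add_sub_cancel, sub_self, norm_zero] at this
    exact sub_eq_zero.1 (norm_le_zero_iff.1 this)
  have hL : LipschitzWith 1 P := by
    refine LipschitzWith.of_dist_le_mul fun a c => ?_
    have := (hP c).nonexp (hP a)
    rw [add_sub_cancel, add_sub_cancel] at this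
    rw [dist_eq_norm, dist_eq_norm]; simpa using this
  have n1 : volume (P '' {z | ¬ DifferentiableAt ℝ P z}) = 0 := by
    apply null_image hL
    have : ∀ᵐ z ∂(volume : Measure (Euc d)), DifferentiableAt ℝ P z := hL.ae_differentiableAt
    exact this
  have n2 : volume (P '' {z | DifferentiableAt ℝ P z ∧ (fderiv ℝ P z).det = 0}) = 0 := by
    apply addHaar_image_eq_zero_of_det_fderivWithin_eq_zero volume (f' := fun z => fderiv ℝ P z)
    · exact fun z hz => hz.1.hasFDerivAt.hasFDerivWithinAt
    · exact fun z hz => hz.2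
  have n3 := measure_union_null n1 n2
  rw [← compl_compl (_ ∪ _)] at n3
  filter_upwards [show _ ∈ ae (volume : Measure (Euc d)) from mem_ae_iff.2 n3] with x hx
  obtain ⟨q, hq⟩ := hex x
  have hz : P (x + q) = x := hPu x q hq
  have hd : DifferentiableAt ℝ P (x + q) := by
    by_contra hcon
    exact hx (Or.inl ⟨x + q, hcon, hz⟩)
  have hdet : (fderiv ℝ P (x + q)).det ≠ 0 := by
    intro hcon
    exact hx (Or.inr ⟨x + q, ⟨hd, hcon⟩, hz⟩)
  let e := (fderiv ℝ P (x + q)).toContinuousLinearEquivOfDetNeZero hdet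
  have hBA : ∀ k, (e.symm : Euc d →L[ℝ] Euc d) (fderiv ℝ P (x + q) k) = k := by
    intro k
    exact e.symm_apply_apply k
  refine ⟨q, (e.symm : Euc d →L[ℝ] Euc d) - ContinuousLinearMap.id ℝ (Euc d), fun ε hε => ?_⟩
  obtain ⟨ρ, hρ, h⟩ := sbg_diff hP hz hd.hasFDerivAt hBA ε hε
  rw [add_sub_cancel_left] at h
  exact ⟨ρ, hρ, fun k hk => sbg_taylor hex h k hk⟩

lemma alexandrov {w : Euc d → ℝ} (hw : Continuous w) {K : ℝ}
    (hK : ∀ q, ∃ p, ∀ y, w (q + y) ≤ w q + ⟪p, y⟫ + K * ‖y‖ ^ 2) :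
    ∀ᵐ x ∂(volume : Measure (Euc d)), ∃ p S, HasAlexandrovAt w p S x := by
  have hf : Continuous fun x => K * ‖x‖ ^ 2 - w x := by fun_prop
  have hexp : ∀ x h : Euc d, ‖x + h‖ ^ 2 = ‖x‖ ^ 2 + 2 * ⟪x, h⟫ + ‖h‖ ^ 2 :=
    fun x h => norm_add_sq_real x h
  have := alex_convex hf (fun x => by
    obtain ⟨p, hp⟩ := hK x
    refine ⟨(2 * K) • x - p, fun y => ?_⟩
    have h1 := hp (y - x)
    have h2 := hexp x (y - x)
    rw [add_sub_cancel] at h1 h2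
    rw [inner_sub_left, inner_smul_left]
    simp only [conj_trivial]
    rw [h2]
    linarith)
  filter_upwards [this] with x ⟨q, M, hx⟩
  have hlo : (fun y => w y - w x - ⟪(2 * K) • x - q, y - x⟫ - (1/2) *
      ⟪((2 * K) • ContinuousLinearMap.id ℝ (Euc d) - M) (y - x), y - x⟫)
      =o[nhds x] fun y => ‖y - x‖ ^ 2 := by
    rw [isLittleO_iff]
    intro ε hε
    obtain ⟨ρ, hρ, h⟩ := hx ε hε
    filter_upwards [Metric.ball_mem_nhds x hρ] with y hy
    rw [mem_ball, dist_eq_norm] at hy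
    have h1 := h (y - x) hy
    have h2 := hexp x (y - x)
    rw [add_sub_cancel] at h1 h2
    rw [Real.norm_eq_abs, Real.norm_of_nonneg (sq_nonneg _), ← abs_neg]
    convert h1 using 2
    rw [inner_sub_left, inner_smul_left, ContinuousLinearMap.sub_apply, inner_sub_left,
      ContinuousLinearMap.smul_apply, inner_smul_left, ContinuousLinearMap.id_apply,
      real_inner_self_eq_norm_sq, h2]
    simp only [conj_trivial]
    ring
  refine ⟨(2 * K) • x - q, (2 * K) • ContinuousLinearMap.id ℝ (Euc d) - M, ?_, hlo⟩
  rw [hasGradientAt_iff_isLittleO]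
  set S := (2 * K) • ContinuousLinearMap.id ℝ (Euc d) - M
  have hsq : (fun y => ‖y - x‖ ^ 2) =o[nhds x] fun y => y - x := by
    rw [isLittleO_iff]
    intro ε hε
    filter_upwards [Metric.ball_mem_nhds x hε] with y hy
    rw [mem_ball, dist_eq_norm] at hy
    rw [Real.norm_of_nonneg (sq_nonneg _), pow_two]
    exact mul_le_mul_of_nonneg_right hy.le (norm_nonneg _)
  have h2 : (fun y => (1/2) * ⟪S (y - x), y - x⟫) =O[nhds x] fun y => ‖y - x‖ ^ 2 := by
    refine IsBigO.of_bound (1/2 * ‖S‖) (Eventually.of_forall fun y => ?_)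
    rw [Real.norm_eq_abs, Real.norm_of_nonneg (sq_nonneg _), abs_mul,
      abs_of_pos (by norm_num : (0:ℝ) < 1/2)]
    have := abs_real_inner_le_norm (S (y - x)) (y - x)
    have h3 := mul_le_mul_of_nonneg_right (S.le_opNorm (y - x)) (norm_nonneg (y - x))
    nlinarith
  have := (hlo.trans hsq).add (h2.trans_isLittleO hsq)
  refine this.congr_left fun y => ?_
  ring

end alex2


section integ
variable {d : ℕ}

/-- second difference quotient -/
def sdq (w : Euc d → ℝ) (r : ℝ) (v θ : Euc d) : ℝ :=
  (w (θ + r • v) + w (θ - r • v) - 2 * w θ) / r ^ 2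

lemma alex_sdq {w : Euc d → ℝ} {p : Euc d} {S : Euc d →L[ℝ] Euc d} {θ : Euc d}
    (h : HasAlexandrovAt w p S θ) (v : Euc d) :
    Tendsto (fun r => sdq w r v θ) (nhdsWithin 0 (Ioi 0)) (nhds ⟪S v, v⟫) := by
  rw [Metric.tendsto_nhds]
  intro ε hε
  set N := ‖v‖ ^ 2 + 1 with hN
  have hN0 : 0 < N := by positivity
  have h1 := h.2.def (show 0 < ε / (4 * N) by positivity)
  obtain ⟨ρ, hρ, h2⟩ := Metric.eventually_nhds_iff.1 h1
  have hlim : Tendsto (fun r : ℝ => r * ‖v‖) (nhdsWithin 0 (Ioi 0)) (nhds 0) := by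
    have : Tendsto (fun r : ℝ => r * ‖v‖) (nhds 0) (nhds (0 * ‖v‖)) :=
      (continuous_id.mul continuous_const).tendsto 0
    rw [zero_mul] at this
    exact this.mono_left nhdsWithin_le_nhds
  filter_upwards [self_mem_nhdsWithin, hlim.eventually (gt_mem_nhds hρ)] with r hr0 hr
  have hr0 : 0 < r := hr0
  have key : ∀ σ : ℝ, (σ = r ∨ σ = -r) →
      |w (θ + σ • v) - w θ - σ * ⟪p, v⟫ - r ^ 2 / 2 * ⟪S v, v⟫| ≤ ε / (4 * N) * (r ^ 2 * ‖v‖ ^ 2) := by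
    intro σ hσ
    have hab : |σ| = r := by rcases hσ with rfl | rfl <;> simp [abs_of_pos hr0]
    have hsq : σ ^ 2 = r ^ 2 := by rw [← hab, sq_abs]
    have hn : ‖σ • v‖ = r * ‖v‖ := by rw [norm_smul, Real.norm_eq_abs, hab]
    have := h2 (y := θ + σ • v) (by rw [dist_eq_norm, add_sub_cancel_left, hn]; exact hr)
    rw [add_sub_cancel_left, map_smul, inner_smul_left, inner_smul_right, inner_smul_right,
      Real.norm_eq_abs, hn, Real.norm_of_nonneg (by positivity)] at this
    simp only [conj_trivial] at this
    rw [← mul_pow, ← hsq]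
    convert this using 2
    ring
  have a := key r (Or.inl rfl)
  have b := key (-r) (Or.inr rfl)
  rw [neg_smul, ← sub_eq_add_neg] at b
  rw [Real.dist_eq]
  have e : sdq w r v θ - ⟪S v, v⟫ = (w (θ + r • v) + w (θ - r • v) - 2 * w θ
      - r ^ 2 * ⟪S v, v⟫) / r ^ 2 := by
    unfold sdq; field_simp
  rw [e, abs_div, abs_of_pos (by positivity : 0 < r ^ 2), div_lt_iff₀ (by positivity)]
  have c : |w (θ + r • v) + w (θ - r • v) - 2 * w θ - r ^ 2 * ⟪S v, v⟫|
      ≤ 2 * (ε / (4 * N) * (r ^ 2 * ‖v‖ ^ 2)) := by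
    rw [abs_le] at a b ⊢
    constructor <;> linarith [a.1, a.2, b.1, b.2]
  refine c.trans_lt ?_
  have h5 : ‖v‖ ^ 2 / N ≤ 1 := by rw [div_le_one hN0]; linarith
  have h6 : 2 * (ε / (4 * N) * (r ^ 2 * ‖v‖ ^ 2)) = (ε * r ^ 2 / 2) * (‖v‖ ^ 2 / N) := by
    field_simp; norm_num
  rw [h6]
  have h7 : 0 < ε * r ^ 2 := by positivity
  nlinarith

lemma D2_spec {w : Euc d → ℝ} {θ : Euc d} (h : ∃ p S, HasAlexandrovAt w p S θ) :
    ∃ p, HasAlexandrovAt w p (D2 w θ) θ := by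
  have h' : ∃ pS : Euc d × (Euc d →L[ℝ] Euc d), HasAlexandrovAt w pS.1 pS.2 θ := by
    obtain ⟨p, S, h⟩ := h
    exact ⟨(p, S), h⟩
  refine ⟨h'.choose.1, ?_⟩
  unfold D2
  rw [dif_pos h']
  exact h'.choose_spec

lemma fundCube_eq : fundCube d =
    ZSpan.fundamentalDomain (EuclideanSpace.basisFun (Fin d) ℝ).toBasis := by
  ext x
  rw [ZSpan.mem_fundamentalDomain]
  simp [fundCube]

instance fundCube_finite : IsFiniteMeasure ((volume : Measure (Euc d)).restrict (fundCube d)) := by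
  rw [fundCube_eq]
  constructor
  rw [Measure.restrict_apply_univ]
  exact (ZSpan.fundamentalDomain_isBounded _).measure_lt_top

open scoped Pointwise in
lemma per_integral {g : Euc d → ℝ} (hg : PerFun g) (w : Euc d) :
    ∫ x in fundCube d, g (x + w) = ∫ x in fundCube d, g x := by
  set b := (EuclideanSpace.basisFun (Fin d) ℝ).toBasis with hb
  have hF := ZSpan.isAddFundamentalDomain' b (volume : Measure (Euc d))
  rw [hb, ← fundCube_eq, ← hb] at hF
  have hinv : ∀ (k : (Submodule.span ℤ (Set.range b)).toAddSubgroup) (x : Euc d),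
      g (k +ᵥ x) = g x := by
    intro k x
    have hk : ∃ m : Fin d → ℤ, (k : Euc d) = intVec m := by
      have := (b.mem_span_iff_repr_mem ℤ (k : Euc d)).1 k.2
      choose m hm using this
      refine ⟨m, ?_⟩
      ext i
      have := hm i
      have e : b.repr (k : Euc d) i = (k : Euc d) i := by simp [hb]
      rw [e] at this
      simpa [intVec] using this.symm
    obtain ⟨m, hm⟩ := hk
    have : k +ᵥ x = x + intVec m := by rw [← hm, add_comm]; rfl
    rw [this, hg]
  haveI : Countable (Submodule.span ℤ (Set.range b)).toAddSubgroup :=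
    inferInstanceAs (Countable (Submodule.span ℤ (Set.range b)))
  have hT := hF.vadd_of_comm w
  have h1 := hF.setIntegral_eq hT hinv
  rw [h1]
  have h2 := (measurePreserving_add_right (volume : Measure (Euc d)) w).setIntegral_preimage_emb
    (measurableEmbedding_addRight w) g (w +ᵥ fundCube d)
  rw [← h2]
  congr 2
  ext x
  simp [mem_vadd_set_iff_neg_vadd_mem, vadd_eq_add, add_comm]

end integ


section integ2
variable {d : ℕ}

lemma cont_integrable_cube {g : Euc d → ℝ} (hg : Continuous g) :
    Integrable g ((volume : Measure (Euc d)).restrict (fundCube d)) := by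
  have hb : Bornology.IsBounded (fundCube d) := by
    rw [fundCube_eq]; exact ZSpan.fundamentalDomain_isBounded _
  exact (hg.continuousOn.integrableOn_compact (μ := volume)
    (isCompact_of_isClosed_isBounded isClosed_closure hb.closure)).mono_set subset_closure

lemma sdq_cont {w : Euc d → ℝ} (hw : Continuous w) (r : ℝ) (v : Euc d) :
    Continuous (sdq w r v) := by
  unfold sdq; fun_prop

lemma sdq_integral {w : Euc d → ℝ} (hw : Continuous w) (hp : PerFun w) (r : ℝ) (v : Euc d) :
    ∫ θ in fundCube d, sdq w r v θ = 0 := by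
  unfold sdq
  rw [integral_div, integral_sub, integral_add]
  · simp only [sub_eq_add_neg]
    rw [per_integral hp, per_integral hp, integral_const_mul]
    have : ∀ a : ℝ, (a + a + -(2 * a)) / r ^ 2 = 0 := fun a => by
      rw [show a + a + -(2 * a) = 0 by ring, zero_div]
    exact this _
  all_goals exact cont_integrable_cube (by fun_prop)

lemma fatou_sdq {w : Euc d → ℝ} (hw : Continuous w) (hp : PerFun w) (v : Euc d) {C : ℝ}
    (hC : ∀ r θ, 0 < r → sdq w r v θ ≤ C) {a : Euc d → ℝ}
    (ha : ∀ᵐ θ ∂((volume : Measure (Euc d)).restrict (fundCube d)),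
      Tendsto (fun r => sdq w r v θ) (nhdsWithin 0 (Ioi 0)) (nhds (a θ))) :
    Integrable a ((volume : Measure (Euc d)).restrict (fundCube d)) ∧
      0 ≤ ∫ θ in fundCube d, a θ ∧
      ∀ᵐ θ ∂((volume : Measure (Euc d)).restrict (fundCube d)), a θ ≤ C := by
  set μ := (volume : Measure (Euc d)).restrict (fundCube d) with hμ
  have hr : Tendsto (fun n : ℕ => 1 / ((n : ℝ) + 1)) atTop (nhdsWithin 0 (Ioi 0)) := by
    rw [tendsto_nhdsWithin_iff]
    refine ⟨tendsto_one_div_add_atTop_nhds_zero_nat, Eventually.of_forall fun n => ?_⟩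
    exact (by positivity : (0:ℝ) < 1 / ((n : ℝ) + 1))
  have hle : ∀ᵐ θ ∂μ, a θ ≤ C := by
    filter_upwards [ha] with θ h
    exact le_of_tendsto h (by filter_upwards [self_mem_nhdsWithin] with r hr using hC r θ hr)
  have hseq : ∀ᵐ θ ∂μ, Tendsto (fun n : ℕ => sdq w (1 / ((n : ℝ) + 1)) v θ) atTop
      (nhds (a θ)) := by
    filter_upwards [ha] with θ h using h.comp hr
  have hmeas : AEMeasurable a μ := aemeasurable_of_tendsto_metrizable_ae atTop
    (fun n => (sdq_cont hw _ v).measurable.aemeasurable) hseq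
  have hfat : ∫⁻ θ, ENNReal.ofReal (C - a θ) ∂μ ≤ ENNReal.ofReal (∫ _, C ∂μ) := by
    calc ∫⁻ θ, ENNReal.ofReal (C - a θ) ∂μ
        = ∫⁻ θ, liminf (fun n : ℕ => ENNReal.ofReal (C - sdq w (1 / ((n : ℝ) + 1)) v θ)) atTop ∂μ := by
          apply lintegral_congr_ae
          filter_upwards [hseq] with θ h
          exact ((ENNReal.tendsto_ofReal (h.const_sub C)).liminf_eq).symm
      _ ≤ liminf (fun n : ℕ => ∫⁻ θ, ENNReal.ofReal (C - sdq w (1 / ((n : ℝ) + 1)) v θ) ∂μ) atTop := by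
          apply lintegral_liminf_le
          intro n
          exact (((sdq_cont hw _ v).measurable).const_sub C).ennreal_ofReal
      _ = liminf (fun n : ℕ => ENNReal.ofReal (∫ _, C ∂μ)) atTop := by
          congr 1
          ext n
          have hi : Integrable (sdq w (1 / ((n : ℝ) + 1)) v) μ :=
            cont_integrable_cube (sdq_cont hw _ v)
          have hi2 : Integrable (fun θ => C - sdq w (1 / ((n : ℝ) + 1)) v θ) μ :=
            (integrable_const C).sub hi
          rw [← ofReal_integral_eq_lintegral_ofReal hi2
            (Eventually.of_forall fun θ => sub_nonneg.2 (hC _ _ (by positivity)))]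
          rw [integral_sub (integrable_const C) hi, hμ, sdq_integral hw hp, sub_zero]
      _ = _ := liminf_const _
  have hnn : 0 ≤ᵐ[μ] fun θ => C - a θ := by
    filter_upwards [hle] with θ h using sub_nonneg.2 h
  have hsm : AEStronglyMeasurable (fun θ => C - a θ) μ := (hmeas.const_sub C).aestronglyMeasurable
  have hi : Integrable (fun θ => C - a θ) μ :=
    ⟨hsm, (hasFiniteIntegral_iff_ofReal hnn).2 (hfat.trans_lt ENNReal.ofReal_lt_top)⟩
  have hia : Integrable a μ := by
    have := (integrable_const C).sub hi
    refine this.congr (Eventually.of_forall fun θ => ?_)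
    simp
  refine ⟨hia, ?_, hle⟩
  rw [← ofReal_integral_eq_lintegral_ofReal hi hnn] at hfat
  have hge : 0 ≤ ∫ θ, (C - a θ) ∂μ := integral_nonneg_of_ae hnn
  rw [integral_sub (integrable_const C) hia] at hfat hge
  by_cases hc : 0 ≤ ∫ _, C ∂μ
  · have := (ENNReal.ofReal_le_ofReal_iff hc).1 hfat
    linarith
  · push Not at hc
    rw [ENNReal.ofReal_of_nonpos hc.le, nonpos_iff_eq_zero, ENNReal.ofReal_eq_zero] at hfat
    -- here `C < 0`, impossible since second differences integrate to zero
    have hi1 : Integrable (sdq w 1 v) μ := cont_integrable_cube (sdq_cont hw _ v)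
    have h0 := integral_mono hi1 (integrable_const C) (fun θ => hC 1 θ one_pos)
    rw [hμ, sdq_integral hw hp, ← hμ] at h0
    linarith

lemma L1_conv {μ : Measure (Euc d)} [IsFiniteMeasure μ] {a : ℕ → Euc d → ℝ} {b : Euc d → ℝ}
    {C C' : ℝ} (ha : ∀ n, Integrable (a n) μ) (ha0 : ∀ n, 0 ≤ ∫ θ, a n θ ∂μ)
    (haC : ∀ n, ∀ᵐ θ ∂μ, a n θ ≤ C) (hb : Integrable b μ) (hb0 : ∫ θ, b θ ∂μ ≤ 0)
    (hbC : ∀ᵐ θ ∂μ, -C' ≤ b θ)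
    (hlim : ∀ᵐ θ ∂μ, ∀ ε > 0, ∀ᶠ n in atTop, a n θ ≤ b θ + ε) :
    Tendsto (fun n => ∫ θ, |a n θ - b θ| ∂μ) atTop (nhds 0) := by
  have h1 : Tendsto (fun n => ∫ θ, max (a n θ - b θ) 0 ∂μ) atTop (nhds (∫ θ, (0:ℝ) ∂μ)) := by
    apply tendsto_integral_of_dominated_convergence (fun _ => |C + C'|)
    · intro n
      exact ((ha n).sub hb).pos_part.aestronglyMeasurable
    · exact integrable_const _
    · intro n
      filter_upwards [haC n, hbC] with θ h1 h2
      rw [Real.norm_of_nonneg (le_max_right _ _)]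
      exact max_le ((by linarith : a n θ - b θ ≤ C + C').trans (le_abs_self _)) (abs_nonneg _)
    · filter_upwards [hlim] with θ h
      rw [Metric.tendsto_nhds]
      intro ε hε
      filter_upwards [h (ε / 2) (by positivity)] with n hn
      rw [Real.dist_eq, sub_zero, abs_of_nonneg (le_max_right _ _)]
      exact max_lt (by linarith) hε
  rw [integral_zero] at h1
  have h2 := h1.const_mul 2
  rw [mul_zero] at h2
  refine squeeze_zero (fun n => integral_nonneg fun θ => abs_nonneg _) (fun n => ?_) h2
  have e : ∀ θ, |a n θ - b θ| = 2 * max (a n θ - b θ) 0 - (a n θ - b θ) := by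
    intro θ
    rcases le_total (a n θ - b θ) 0 with h | h
    · rw [abs_of_nonpos h, max_eq_right h]; ring
    · rw [abs_of_nonneg h, max_eq_left h]; ring
  simp only [e]
  have hi : Integrable (fun θ => max (a n θ - b θ) 0) μ := ((ha n).sub hb).pos_part
  have hi2 : Integrable (fun θ => a n θ - b θ) μ := (ha n).sub hb
  rw [integral_sub (hi.const_mul 2) hi2, integral_sub (ha n) hb, integral_const_mul]
  have := ha0 n
  linarith

lemma qNorm_nonneg (S : Euc d →L[ℝ] Euc d) : 0 ≤ qNorm S :=
  Real.iSup_nonneg fun _ => abs_nonneg _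

lemma qNorm_le (S : Euc d →L[ℝ] Euc d) (e : Fin d → Euc d)
    (he : ∀ i, e i = EuclideanSpace.basisFun (Fin d) ℝ i) :
    qNorm S ≤ ∑ i, ∑ j, (|⟪S (e i + e j), e i + e j⟫| + |⟪S (e i), e i⟫| + |⟪S (e j), e j⟫|) := by
  apply Real.iSup_le
  · rintro ⟨v, hv⟩
    have hv : ‖v‖ = 1 := by simpa using hv
    have hvi : ∀ i, |v i| ≤ 1 := fun i => by
      have := PiLp.norm_apply_le v i
      rwa [hv, Real.norm_eq_abs] at this
    have hsum : v = ∑ i, v i • e i := by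
      have := (EuclideanSpace.basisFun (Fin d) ℝ).sum_repr v
      simp only [he]
      exact this.symm
    have h1 : ⟪S v, v⟫ = ∑ i, ∑ j, v i * v j * ⟪S (e i), e j⟫ := by
      conv_lhs => rw [hsum]
      rw [map_sum, sum_inner]
      refine Finset.sum_congr rfl fun i _ => ?_
      rw [inner_sum]
      refine Finset.sum_congr rfl fun j _ => ?_
      rw [map_smul, inner_smul_left, inner_smul_right]
      simp only [conj_trivial]; ring
    have h2 : ⟪S v, v⟫ = ∑ i, ∑ j, v i * v j * ⟪S (e j), e i⟫ := by
      rw [h1, Finset.sum_comm]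
      refine Finset.sum_congr rfl fun i _ => Finset.sum_congr rfl fun j _ => by ring
    have h3 : ⟪S v, v⟫ = ∑ i, ∑ j, v i * v j * ((⟪S (e i + e j), e i + e j⟫ - ⟪S (e i), e i⟫ -
        ⟪S (e j), e j⟫) / 2) := by
      have : ⟪S v, v⟫ = (⟪S v, v⟫ + ⟪S v, v⟫) / 2 := by ring
      rw [this]
      nth_rewrite 1 [h1]
      rw [h2, ← Finset.sum_add_distrib, Finset.sum_div]
      refine Finset.sum_congr rfl fun i _ => ?_
      rw [← Finset.sum_add_distrib, Finset.sum_div]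
      refine Finset.sum_congr rfl fun j _ => ?_
      rw [map_add, inner_add_left, inner_add_right, inner_add_right]
      ring
    show |⟪S v, v⟫| ≤ _
    rw [h3]
    refine (Finset.abs_sum_le_sum_abs _ _).trans (Finset.sum_le_sum fun i _ => ?_)
    refine (Finset.abs_sum_le_sum_abs _ _).trans (Finset.sum_le_sum fun j _ => ?_)
    rw [abs_mul, abs_mul, abs_div, abs_two]
    have h4 : |v i| * |v j| ≤ 1 := mul_le_one₀ (hvi i) (abs_nonneg _) (hvi j)
    have h5 : |⟪S (e i + e j), e i + e j⟫ - ⟪S (e i), e i⟫ - ⟪S (e j), e j⟫| ≤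
        |⟪S (e i + e j), e i + e j⟫| + |⟪S (e i), e i⟫| + |⟪S (e j), e j⟫| :=
      (abs_sub _ _).trans (by gcongr; exact abs_sub _ _)
    have h6 := abs_nonneg (⟪S (e i + e j), e i + e j⟫ - ⟪S (e i), e i⟫ - ⟪S (e j), e j⟫)
    nlinarith
  · positivity

end integ2


section fin
variable {d : ℕ} {H : Phase d → ℝ} {av : ℝ} {u : Euc d → ℝ} {U : ℝ → Euc d → ℝ}

lemma sdq_le {w : Euc d → ℝ} {K : ℝ}
    (hK : ∀ q, ∃ p, ∀ y, w (q + y) ≤ w q + ⟪p, y⟫ + K * ‖y‖ ^ 2) (v : Euc d) (r : ℝ) (θ : Euc d)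
    (hr : 0 < r) : sdq w r v θ ≤ 2 * K * ‖v‖ ^ 2 := by
  obtain ⟨p, hp⟩ := hK θ
  have h1 := hp (r • v)
  have h2 := hp (-(r • v))
  rw [inner_neg_right, norm_neg, ← sub_eq_add_neg] at h2
  rw [norm_smul, Real.norm_of_nonneg hr.le, mul_pow] at h1 h2
  unfold sdq
  rw [div_le_iff₀ (by positivity)]
  linarith

lemma seq_conv (h : SG H av U) (hH : TonelliHam H) (hu : ContDiff ℝ 1 u)
    (hs : SG H av (fun _ => u)) (hUu : TendstoUniformly U u atTop)
    {φ : ℝ → Phase d → Phase d} (hφ : IsConformalFlow H 0 φ) (hreg : UpperGreenRegular φ u)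
    (τ : ℕ → ℝ) (hτ2 : ∀ n, 2 ≤ τ n) (hτ : Tendsto τ atTop atTop) (v : Euc d) :
    (∀ n, Integrable (fun θ => |⟪(D2 (U (τ n)) θ - D2 u θ) v, v⟫|)
      ((volume : Measure (Euc d)).restrict (fundCube d))) ∧
    Tendsto (fun n => ∫ θ in fundCube d, |⟪(D2 (U (τ n)) θ - D2 u θ) v, v⟫|) atTop (nhds 0) := by
  obtain ⟨ℓ, hℓ0, hℓ⟩ := h.lip hH
  obtain ⟨K, M, hK0, hM0, hK⟩ := h.semiconcave hH
  obtain ⟨K', hK0', hK'⟩ := C11 hH hu hs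
  have hUc : ∀ n, Continuous (U (τ n)) := by
    intro n
    have : LipschitzWith (Real.toNNReal ℓ) (U (τ n)) := LipschitzWith.of_dist_le_mul fun x y => by
      rw [Real.dist_eq, dist_eq_norm, Real.coe_toNNReal _ hℓ0]
      exact hℓ _ x y (by linarith [hτ2 n])
    exact this.continuous
  have hUK : ∀ n q, ∃ p, ∀ y, U (τ n) (q + y) ≤ U (τ n) q + ⟪p, y⟫ + K * ‖y‖ ^ 2 := by
    intro n q
    obtain ⟨p, -, hp⟩ := hK (τ n) q (hτ2 n)
    exact ⟨p, hp⟩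
  have huK : ∀ q, ∃ p, ∀ y, u (q + y) ≤ u q + ⟪p, y⟫ + K' * ‖y‖ ^ 2 := fun q =>
    ⟨gradient u q, fun y => by linarith [(abs_le.1 (hK' q y)).2]⟩
  have hnuK : ∀ q, ∃ p, ∀ y, (-u) (q + y) ≤ (-u) q + ⟪p, y⟫ + K' * ‖y‖ ^ 2 := fun q =>
    ⟨-gradient u q, fun y => by
      rw [inner_neg_left, Pi.neg_apply, Pi.neg_apply]; linarith [(abs_le.1 (hK' q y)).1]⟩
  have hper : PerFun u := hs.per 0 le_rfl
  have aA : ∀ n, ∀ᵐ θ ∂(volume : Measure (Euc d)),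
      Tendsto (fun r => sdq (U (τ n)) r v θ) (nhdsWithin 0 (Ioi 0))
        (nhds ⟪D2 (U (τ n)) θ v, v⟫) := by
    intro n
    filter_upwards [alexandrov (hUc n) (hUK n)] with θ hθ
    obtain ⟨p, hp⟩ := D2_spec hθ
    exact alex_sdq hp v
  have aB : ∀ᵐ θ ∂(volume : Measure (Euc d)),
      Tendsto (fun r => sdq u r v θ) (nhdsWithin 0 (Ioi 0)) (nhds ⟪D2 u θ v, v⟫) := by
    filter_upwards [alexandrov hu.continuous huK] with θ hθ
    obtain ⟨p, hp⟩ := D2_spec hθ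
    exact alex_sdq hp v
  have hN : ∀ r θ, sdq (-u) r v θ = - sdq u r v θ := by
    intro r θ; unfold sdq; simp only [Pi.neg_apply]; ring
  have aN : ∀ᵐ θ ∂(volume : Measure (Euc d)),
      Tendsto (fun r => sdq (-u) r v θ) (nhdsWithin 0 (Ioi 0)) (nhds (-⟪D2 u θ v, v⟫)) := by
    filter_upwards [aB] with θ hθ
    simp only [hN]
    exact hθ.neg
  have fA := fun n => fatou_sdq (hUc n) (h.per _ (by linarith [hτ2 n])) v
    (sdq_le (hUK n) v) (ae_restrict_of_ae (s := fundCube d) (aA n))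
  have fB := fatou_sdq hu.continuous hper v (sdq_le huK v) (ae_restrict_of_ae (s := fundCube d) aB)
  have fN := fatou_sdq hu.continuous.neg (fun k x => by
    rw [Pi.neg_apply, Pi.neg_apply, hper k x]) v (sdq_le hnuK v)
    (ae_restrict_of_ae (s := fundCube d) aN)
  have e : ∀ n θ, ⟪(D2 (U (τ n)) θ - D2 u θ) v, v⟫ = ⟪D2 (U (τ n)) θ v, v⟫ - ⟪D2 u θ v, v⟫ := by
    intro n θ
    rw [ContinuousLinearMap.sub_apply, inner_sub_left]
  simp only [e]
  refine ⟨fun n => ((fA n).1.sub fB.1).abs, ?_⟩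
  apply L1_conv (C := 2 * K * ‖v‖ ^ 2) (C' := 2 * K' * ‖v‖ ^ 2) (fun n => (fA n).1)
    (fun n => (fA n).2.1) (fun n => (fA n).2.2) fB.1
  · have := fN.2.1
    rw [integral_neg] at this
    linarith
  · filter_upwards [fN.2.2] with θ hθ
    linarith
  · apply ae_restrict_of_ae
    filter_upwards [hreg, ae_all_iff.2 aA, aB] with θ ⟨p, S, hp, hG, hlim, hal⟩ hA hB ε hε
    have hS : ⟪S v, v⟫ = ⟪D2 u θ v, v⟫ := tendsto_nhds_unique (alex_sdq hal v) hB
    obtain ⟨t1, ht1⟩ := h.green_bound hH hu hs hUu hφ hp hG hlim v ε hε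
    filter_upwards [hτ.eventually_ge_atTop t1] with n hn
    obtain ⟨h0, hh0, hb⟩ := ht1 _ hn
    rw [← hS]
    refine le_of_tendsto (hA n) ?_
    filter_upwards [Ioo_mem_nhdsGT hh0] with r hr
    unfold sdq
    rw [div_le_iff₀ (by have := hr.1; positivity)]
    linarith [hb r hr.1 hr.2]

lemma SG.d21_tendsto (h : SG H av U) (hH : TonelliHam H) (hu : ContDiff ℝ 1 u)
    (hs : SG H av (fun _ => u)) (hUu : TendstoUniformly U u atTop)
    {φ : ℝ → Phase d → Phase d} (hφ : IsConformalFlow H 0 φ) (hreg : UpperGreenRegular φ u) :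
    Tendsto (fun t => d21 (U t) u) atTop (nhds 0) := by
  refine tendsto_of_seq_tendsto fun τ hτ => ?_
  have hev : (fun n => d21 (U (max (τ n) 2)) u) =ᶠ[atTop] fun n => d21 (U (τ n)) u := by
    filter_upwards [hτ.eventually_ge_atTop 2] with n hn
    rw [max_eq_left hn]
  refine Tendsto.congr' hev ?_
  set σ : ℕ → ℝ := fun n => max (τ n) 2 with hσ
  have hσ2 : ∀ n, 2 ≤ σ n := fun n => le_max_right _ _
  have hσt : Tendsto σ atTop atTop := tendsto_atTop_mono (fun n => le_max_left _ _) hτ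
  have key := seq_conv h hH hu hs hUu hφ hreg σ hσ2 hσt
  let e : Fin d → Euc d := fun i => EuclideanSpace.basisFun (Fin d) ℝ i
  let B : ℕ → Fin d → Fin d → ℝ := fun n i j =>
    (∫ θ in fundCube d, |⟪(D2 (U (σ n)) θ - D2 u θ) (e i + e j), e i + e j⟫|) +
    (∫ θ in fundCube d, |⟪(D2 (U (σ n)) θ - D2 u θ) (e i), e i⟫|) +
    (∫ θ in fundCube d, |⟪(D2 (U (σ n)) θ - D2 u θ) (e j), e j⟫|)
  have hB : Tendsto (fun n => ∑ i, ∑ j, B n i j) atTop (nhds (∑ i : Fin d, ∑ j : Fin d, (0:ℝ))) := by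
    refine tendsto_finsetSum _ fun i _ => tendsto_finsetSum _ fun j _ => ?_
    have := ((key (e i + e j)).2.add (key (e i)).2).add (key (e j)).2
    rw [add_zero, add_zero] at this
    exact this
  simp only [Finset.sum_const_zero] at hB
  refine squeeze_zero (fun n => integral_nonneg fun θ => qNorm_nonneg _) (fun n => ?_) hB
  have hint : ∀ i j, Integrable (fun θ =>
      |⟪(D2 (U (σ n)) θ - D2 u θ) (e i + e j), e i + e j⟫| +
      |⟪(D2 (U (σ n)) θ - D2 u θ) (e i), e i⟫| +
      |⟪(D2 (U (σ n)) θ - D2 u θ) (e j), e j⟫|)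
      ((volume : Measure (Euc d)).restrict (fundCube d)) := fun i j =>
    (((key (e i + e j)).1 n).add ((key (e i)).1 n)).add ((key (e j)).1 n)
  have h1 : d21 (U (σ n)) u ≤ ∫ θ in fundCube d, ∑ i, ∑ j,
      (|⟪(D2 (U (σ n)) θ - D2 u θ) (e i + e j), e i + e j⟫| +
      |⟪(D2 (U (σ n)) θ - D2 u θ) (e i), e i⟫| +
      |⟪(D2 (U (σ n)) θ - D2 u θ) (e j), e j⟫|) := by
    unfold d21
    refine integral_mono_of_nonneg (Eventually.of_forall fun θ => qNorm_nonneg _) ?_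
      (Eventually.of_forall fun θ => qNorm_le _ e fun i => rfl)
    exact integrable_finsetSum _ fun i _ => integrable_finsetSum _ fun j _ => hint i j
  refine h1.trans (le_of_eq ?_)
  rw [integral_finsetSum _ fun i _ => integrable_finsetSum _ fun j _ => hint i j]
  refine Finset.sum_congr rfl fun i _ => ?_
  rw [integral_finsetSum _ fun j _ => hint i j]
  refine Finset.sum_congr rfl fun j _ => ?_
  have i1 := (key (e i + e j)).1 n
  have i2 := (key (e i)).1 n
  have i3 := (key (e j)).1 n
  have i12 : Integrable (fun θ =>
      |⟪(D2 (U (σ n)) θ - D2 u θ) (e i + e j), e i + e j⟫| +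
      |⟪(D2 (U (σ n)) θ - D2 u θ) (e i), e i⟫|)
      ((volume : Measure (Euc d)).restrict (fundCube d)) := i1.add i2
  rw [integral_add i12 i3, integral_add i1 i2]

lemma stmt_aux {d : ℕ} (H : Phase d → ℝ) (hH : TonelliHam H)
    (φ : ℝ → Phase d → Phase d) (hφ : IsConformalFlow H 0 φ)
    (u0 : Euc d → ℝ) (hu0 : Continuous u0) (hu0p : PerFun u0)
    (u : Euc d → ℝ)
    (hconv : TendstoUniformly
      (fun t q => LaxOleinik (LegendreL H) 0 (maneCritical H) 0 u0 t q) u atTop)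
    (hu1 : ContDiff ℝ 1 u) (hreg : UpperGreenRegular φ u) :
    IsWeakKAM H u ∧
      Tendsto (fun t => d21 (LaxOleinik (LegendreL H) 0 (maneCritical H) 0 u0 t) u)
        atTop (nhds 0) := by
  obtain ⟨-, t0, ht0, hU, hs⟩ := SG_LO hH (maneCritical H) hu0 hu0p hu1.continuous hconv
  refine ⟨SG_weakKAM hH hu1.continuous hs, ?_⟩
  have hUu : TendstoUniformly
      (fun t => LaxOleinik (LegendreL H) 0 (maneCritical H) 0 u0 (t0 + t)) u atTop := by
    intro V hV
    exact (tendsto_atTop_add_const_left atTop t0 tendsto_id).eventually (hconv V hV)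
  have := hU.d21_tendsto hH hu1 hs hUu hφ hreg
  have h2 := this.comp (tendsto_atTop_add_const_right atTop (-t0) tendsto_id)
  refine h2.congr fun t => ?_
  simp

end fin

/-- **Theorem (d_{2,1} convergence of the Lax–Oleinik semigroup).** Let `u_t = T_t u₀`
and `u = lim_{t→+∞} u_t`.  If `u` is `C¹` and upper Green regular, then `u` is a weak
K.A.M. solution and `d_{2,1}(u_t, u) → 0` as `t → +∞`. -/
theorem stmt_6 {d : ℕ} (H : Phase d → ℝ) (hH : TonelliHam H)
    (φ : ℝ → Phase d → Phase d) (hφ : IsConformalFlow H 0 φ)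
    (u0 : Euc d → ℝ) (hu0 : Continuous u0) (hu0p : PerFun u0)
    (u : Euc d → ℝ)
    (hconv : TendstoUniformly
      (fun t q => LaxOleinik (LegendreL H) 0 (maneCritical H) 0 u0 t q) u atTop)
    (hu1 : ContDiff ℝ 1 u) (hreg : UpperGreenRegular φ u) :
    IsWeakKAM H u ∧
      Tendsto (fun t => d21 (LaxOleinik (LegendreL H) 0 (maneCritical H) 0 u0 t) u)
        atTop (nhds 0) := by
  exact stmt_aux H hH φ hφ u0 hu0 hu0p u hconv hu1 hreg
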